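/- arXiv:2102.06886 — 3 statements merged into one kernel-verified Lean document; each statement's English description precedes it below -/
import Mathlib

section
/- (Envy-free division dropping at most one tile.) Assume r is a prime number or r = 4. Let A : Fin r → Fin r → Set Δ^{r-1} be an old-style preference matrix that is closed, covering, and satisfies P_dte. Assume moreover there exists ε > 0 such that for every player j and every z ∈ Δ^{r-1} with 0 < z r < ε (where z r is the length of the last tile), z ∉ A r j; that is, a non-degenerate last tile shorter than ε is never preferred. Then there exist z ∈ Δ^{r-1} and a map π : Fin r → Fin r such that z ∈ A (π j) j for every player j, π is injective on {j | z (π j) > 0}, and the set of dropped non-degenerate tiles {i | z i > 0 ∧ i ∉ π '' (Set.univ)} has at most one element. -/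
namespace EnvyFreeDivision

open FreeAbelianGroup

section Chains

variable {α : Type*}

/-- Integral combinations of ordered simplices, a simplex being the list of its vertices. -/
abbrev Chain (α : Type*) := FreeAbelianGroup (List α)

/-- The cone with apex `a`. -/
def cone (a : α) : Chain α →+ Chain α := FreeAbelianGroup.map (List.cons a)

@[simp] theorem cone_of (a : α) (l : List α) : cone a (of l) = of (a :: l) :=
  FreeAbelianGroup.map_of_apply l

/-- The augmented boundary of a simplex. -/
def faces : List α → Chain α
  | [] => 0
  | a :: l => of l - cone a (faces l)

/-- The augmented boundary operator. -/
def boundary : Chain α →+ Chain α := lift faces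

@[simp] theorem boundary_of (l : List α) : boundary (of l) = faces l := lift_apply_of _ _

theorem boundary_cone (a : α) (c : Chain α) : boundary (cone a c) = c - cone a (boundary c) := by
  induction c using FreeAbelianGroup.induction_on with
  | zero => simp
  | of l => simp [faces]
  | neg l h => rw [map_neg, map_neg, h, map_neg, map_neg]; abel
  | add x y hx hy => rw [map_add, map_add, hx, hy, map_add, map_add]; abel

theorem boundary_faces (l : List α) : boundary (faces l) = 0 := by
  induction l with
  | nil => simp [faces]
  | cons a l ih => rw [faces, map_sub, boundary_cone, boundary_of, ih]; simp

/-- Barycentric subdivision of chains of simplices with `k` vertices, for an arbitrary choice `β`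
of the barycenters. -/
def subdiv (β : List α → α) : ℕ → Chain α →+ Chain α
  | 0 => AddMonoidHom.id _
  | k + 1 => lift fun l => cone (β l) (subdiv β k (faces l))

@[simp] theorem subdiv_succ_of (β : List α → α) (k : ℕ) (l : List α) :
    subdiv β (k + 1) (of l) = cone (β l) (subdiv β k (faces l)) := lift_apply_of _ _

theorem boundary_subdiv (β : List α → α) (k : ℕ) (c : Chain α) :
    boundary (subdiv β (k + 1) c) = subdiv β k (boundary c) := by
  induction k generalizing c with
  | zero =>
    induction c using FreeAbelianGroup.induction_on with
    | zero => simp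
    | of l => rw [subdiv_succ_of, boundary_cone]; simp [subdiv, boundary_faces]
    | neg l h => simp only [map_neg, h]
    | add x y hx hy => simp only [map_add, hx, hy]
  | succ k ih =>
    induction c using FreeAbelianGroup.induction_on with
    | zero => simp
    | of l => rw [subdiv_succ_of, boundary_cone, ih, boundary_faces]; simp
    | neg l h => simp only [map_neg, h]
    | add x y hx hy => simp only [map_add, hx, hy]

/-- The chains all of whose simplices satisfy `Q`. -/
def chainsOf (Q : List α → Prop) : AddSubgroup (Chain α) := AddSubgroup.closure (of '' {l | Q l})

theorem of_mem_chainsOf {Q : List α → Prop} {l : List α} (h : Q l) : of l ∈ chainsOf Q :=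
  AddSubgroup.subset_closure ⟨l, h, rfl⟩

theorem map_mem_of_mem_chainsOf {Q : List α → Prop} {A : Type*} [AddCommGroup A]
    (f : Chain α →+ A) (S : AddSubgroup A) (h : ∀ l, Q l → f (of l) ∈ S) {c : Chain α}
    (hc : c ∈ chainsOf Q) : f c ∈ S := by
  have : chainsOf Q ≤ S.comap f := by
    rw [chainsOf, AddSubgroup.closure_le]
    rintro _ ⟨l, hl, rfl⟩
    exact h l hl
  exact this hc

theorem map_eq_zero_of_mem_chainsOf {Q : List α → Prop} {A : Type*} [AddCommGroup A]
    (f : Chain α →+ A) (h : ∀ l, Q l → f (of l) = 0) {c : Chain α}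
    (hc : c ∈ chainsOf Q) : f c = 0 := by
  simpa using map_mem_of_mem_chainsOf f ⊥ (fun l hl => by simpa using h l hl) hc

theorem chainsOf_mono {Q Q' : List α → Prop} (h : ∀ l, Q l → Q' l) {c : Chain α}
    (hc : c ∈ chainsOf Q) : c ∈ chainsOf Q' :=
  map_mem_of_mem_chainsOf (AddMonoidHom.id _) _ (fun l hl => of_mem_chainsOf (h l hl)) hc

theorem faces_mem (l : List α) :
    faces l ∈ chainsOf fun l' => l'.Sublist l ∧ l'.length + 1 = l.length := by
  induction l with
  | nil => exact zero_mem _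
  | cons a l ih =>
    refine sub_mem (of_mem_chainsOf ⟨List.sublist_cons_self a l, rfl⟩) ?_
    refine map_mem_of_mem_chainsOf (cone a) _ (fun l' hl' => ?_) ih
    rw [cone_of]
    exact of_mem_chainsOf ⟨hl'.1.cons_cons a, by simp [← hl'.2]⟩

end Chains

section Subdivision

variable {ι : Type*}

/-- A vertex of a subdivision: its position and one less than the number of vertices of the
simplex it is the barycenter of. -/
abbrev Vertex (ι : Type*) := (ι → ℝ) × ℕ

/-- The positions of the vertices of a simplex. -/
def positions (l : List (Vertex ι)) : Set (ι → ℝ) := {p | ∃ x ∈ l, x.1 = p}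

theorem positions_mono {l l' : List (Vertex ι)} (h : l' ⊆ l) : positions l' ⊆ positions l :=
  fun _ ⟨x, hx, hxp⟩ => ⟨x, h hx, hxp⟩

/-- The barycenter of a simplex. -/
noncomputable def bary (l : List (Vertex ι)) : Vertex ι :=
  ((l.length : ℝ)⁻¹ • (l.map Prod.fst).sum, l.length - 1)

theorem bary_fst_eq_sum (l : List (Vertex ι)) :
    (bary l).1 = ∑ i : Fin l.length, (l.length : ℝ)⁻¹ • (l.get i).1 := by
  rw [← Finset.smul_sum, bary]
  have : (l.map Prod.fst).sum = ((List.ofFn l.get).map Prod.fst).sum := by rw [List.ofFn_get]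
  rw [this, List.map_ofFn, List.sum_ofFn]
  rfl

theorem bary_mem_convexHull {l : List (Vertex ι)} (hl : l ≠ []) :
    (bary l).1 ∈ convexHull ℝ (positions l) := by
  rw [bary_fst_eq_sum]
  refine (convex_convexHull ℝ _).sum_mem (fun i _ => by positivity) ?_ fun i _ =>
    subset_convexHull ℝ _ ⟨l.get i, List.get_mem _ _, rfl⟩
  have : (l.length : ℝ) ≠ 0 := by simpa using hl
  simp [this]

theorem dist_bary_le [Fintype ι] {l : List (Vertex ι)} {d : ℝ}
    (hd : ∀ x ∈ l, ∀ y ∈ l, dist x.1 y.1 ≤ d)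
    {x : Vertex ι} (hx : x ∈ l) : dist (bary l).1 x.1 ≤ (1 - (l.length : ℝ)⁻¹) * d := by
  obtain ⟨i₀, rfl⟩ := List.get_of_mem hx
  have hpos : (0 : ℝ) < l.length := by exact_mod_cast List.length_pos_of_mem hx
  have h : (bary l).1 - (l.get i₀).1
      = (l.length : ℝ)⁻¹ • ∑ i : Fin l.length, ((l.get i).1 - (l.get i₀).1) := by
    rw [bary_fst_eq_sum, ← Finset.smul_sum, Finset.sum_sub_distrib, smul_sub]
    congr 1
    rw [Finset.sum_const, Finset.card_univ, Fintype.card_fin, ← Nat.cast_smul_eq_nsmul ℝ,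
      smul_smul, inv_mul_cancel₀ hpos.ne', one_smul]
  have hsum : ‖∑ i : Fin l.length, ((l.get i).1 - (l.get i₀).1)‖ ≤ (l.length - 1) * d := by
    rw [← Finset.sum_erase Finset.univ (a := i₀) (sub_self _)]
    refine (norm_sum_le_of_le _ fun i _ => (dist_eq_norm (l.get i).1 (l.get i₀).1).symm.trans_le
      (hd _ (List.get_mem _ _) _ hx)).trans_eq ?_
    rw [Finset.sum_const, Finset.card_erase_of_mem (Finset.mem_univ _), Finset.card_univ,
      Fintype.card_fin, nsmul_eq_mul, Nat.cast_sub (List.length_pos_of_mem hx), Nat.cast_one]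
  rw [dist_eq_norm, h, norm_smul, norm_inv, RCLike.norm_natCast]
  calc (l.length : ℝ)⁻¹ * _ ≤ (l.length : ℝ)⁻¹ * ((l.length - 1) * d) := by gcongr
    _ = _ := by field_simp

/-- Every coordinate hyperplane that contains `x` contains `y`. -/
def Dominates (x y : Vertex ι) : Prop := ∀ i, x.1 i = 0 → y.1 i = 0

/-- What is known about a simplex of diameter at most `d` in the barycentric subdivision of a
simplex `l` with `k` vertices. -/
structure IsSubdivisionPiece [Fintype ι] (l : List (Vertex ι)) (k : ℕ) (d : ℝ)
    (l' : List (Vertex ι)) :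
    Prop where
  map_snd : l'.map Prod.snd = (List.range k).reverse
  mem_hull : ∀ x ∈ l', x.1 ∈ convexHull ℝ (positions l)
  dist_le : ∀ x ∈ l', ∀ y ∈ l', dist x.1 y.1 ≤ d
  dominates : l'.Pairwise Dominates

theorem bary_eq_zero {l : List (Vertex ι)} (h0 : ∀ x ∈ l, ∀ i, 0 ≤ x.1 i) {i : ι}
    (hi : (bary l).1 i = 0) {p : ι → ℝ} (hp : p ∈ convexHull ℝ (positions l)) : p i = 0 := by
  have hl : ∀ x ∈ l, x.1 i = 0 := by
    intro x hx
    obtain ⟨i₀, rfl⟩ := List.get_of_mem hx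
    have hpos : (0 : ℝ) < l.length := by exact_mod_cast List.length_pos_of_mem hx
    rw [bary_fst_eq_sum, Finset.sum_apply, Finset.sum_eq_zero_iff_of_nonneg fun j _ => by
      simpa using mul_nonneg (by positivity) (h0 _ (List.get_mem l j) i)] at hi
    simpa [hpos.ne'] using hi i₀ (Finset.mem_univ _)
  have hc : Convex ℝ {p : ι → ℝ | p i = 0} :=
    convex_hyperplane (LinearMap.proj (R := ℝ) (φ := fun _ : ι => ℝ) i).isLinear 0
  exact convexHull_min (by rintro _ ⟨x, hx, rfl⟩; exact hl x hx) hc hp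

theorem subdiv_bary_mem [Fintype ι] {N k : ℕ} (hk : k ≤ N) {l : List (Vertex ι)} (hl : l.length = k)
    (h0 : ∀ x ∈ l, ∀ i, 0 ≤ x.1 i) {d : ℝ} (hd0 : 0 ≤ d)
    (hd : ∀ x ∈ l, ∀ y ∈ l, dist x.1 y.1 ≤ d) :
    subdiv bary k (of l) ∈ chainsOf (IsSubdivisionPiece l k ((1 - (N : ℝ)⁻¹) * d)) := by
  induction k generalizing l with
  | zero =>
    obtain rfl := List.length_eq_zero_iff.1 hl
    exact of_mem_chainsOf ⟨by simp, by simp, by simp, by simp⟩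
  | succ k ih =>
    rw [subdiv_succ_of]
    have hN : (1 : ℝ) ≤ N := by exact_mod_cast (by lia : 1 ≤ N)
    have hρ : 0 ≤ 1 - (N : ℝ)⁻¹ := sub_nonneg.2 (inv_le_one_of_one_le₀ hN)
    have hne : l ≠ [] := by rintro rfl; simp at hl
    refine map_mem_of_mem_chainsOf ((cone (bary l)).comp (subdiv bary k)) _ ?_ (faces_mem l)
    rintro f ⟨hfl, hfk⟩
    have hf := ih (by lia) (l := f) (by lia) (fun x hx => h0 x (hfl.subset hx))
      (fun x hx y hy => hd x (hfl.subset hx) y (hfl.subset hy))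
    refine map_mem_of_mem_chainsOf (cone (bary l)) _ (fun l' hl' => ?_) hf
    rw [cone_of]
    have hin : ∀ x ∈ l', x.1 ∈ convexHull ℝ (positions l) := fun x hx =>
      convexHull_mono (positions_mono hfl.subset) (hl'.mem_hull x hx)
    have hdist : ∀ x ∈ l', dist x.1 (bary l).1 ≤ (1 - (N : ℝ)⁻¹) * d := by
      intro x hx
      refine convexHull_min (t := Metric.closedBall (bary l).1 ((1 - (N : ℝ)⁻¹) * d)) ?_
        (convex_closedBall _ _) (hin x hx)
      rintro _ ⟨y, hy, rfl⟩
      rw [Metric.mem_closedBall, dist_comm]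
      refine (dist_bary_le hd hy).trans ?_
      have : (0 : ℝ) < l.length := by exact_mod_cast List.length_pos_of_mem hy
      have : (l.length : ℝ) ≤ N := by exact_mod_cast hl.trans_le hk
      gcongr
    refine of_mem_chainsOf ⟨?_, ?_, ?_, ?_⟩
    · rw [List.map_cons, hl'.map_snd, List.range_succ, List.reverse_concat]
      simp [bary, hl]
    · simpa using ⟨bary_mem_convexHull hne, fun a b hab => hin (a, b) hab⟩
    · intro x hx y hy
      rcases List.mem_cons.1 hx with rfl | hx <;> rcases List.mem_cons.1 hy with rfl | hy
      · rw [dist_self]; positivity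
      · rw [dist_comm]; exact hdist y hy
      · exact hdist x hx
      · exact hl'.dist_le x hx y hy
    · exact List.pairwise_cons.2 ⟨fun x hx i hi => bary_eq_zero h0 hi (hin x hx), hl'.dominates⟩

end Subdivision

section Wedge

variable {V : Type*} [AddCommGroup V] [Module ℚ V]

/-- The exterior product of a list of vectors. -/
noncomputable def wedge (l : List V) : ExteriorAlgebra ℚ V :=
  (l.map (ExteriorAlgebra.ι ℚ)).prod

@[simp] theorem wedge_nil : wedge ([] : List V) = 1 := rfl

@[simp] theorem wedge_cons (v : V) (l : List V) :
    wedge (v :: l) = ExteriorAlgebra.ι ℚ v * wedge l := rfl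

theorem wedge_append (l l' : List V) : wedge (l ++ l') = wedge l * wedge l' := by
  simp [wedge]

theorem wedge_eq_ιMulti {l : List V} {m : ℕ} (hl : l.length = m) :
    wedge l = ExteriorAlgebra.ιMulti ℚ m (fun i : Fin m => l[i]) := by
  subst hl
  rw [ExteriorAlgebra.ιMulti_apply, wedge]
  exact congrArg List.prod (List.ext_getElem (by simp) (by simp))

theorem ι_mul_wedge_of_mem {v : V} {l : List V} (h : v ∈ l) :
    ExteriorAlgebra.ι ℚ v * wedge l = 0 := by
  induction l with
  | nil => simp at h
  | cons w l ih =>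
    rw [wedge_cons, ← mul_assoc]
    rcases List.mem_cons.1 h with rfl | h
    · rw [ExteriorAlgebra.ι_sq_zero, zero_mul]
    · rw [eq_neg_of_add_eq_zero_left (ExteriorAlgebra.ι_add_mul_swap v w), neg_mul, mul_assoc, ih h,
        mul_zero, neg_zero]

theorem wedge_eq_zero_of_finrank_lt [Module.Finite ℚ V] {l : List V}
    (h : Module.finrank ℚ V < l.length) : wedge l = 0 := by
  rw [wedge_eq_ιMulti rfl]
  refine AlternatingMap.map_linearDependent _ _ fun hl => ?_
  have := hl.fintype_card_le_finrank
  rw [Fintype.card_fin] at this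
  lia

/-- Contraction with a linear functional. -/
noncomputable abbrev contract (d : Module.Dual ℚ V) :
    ExteriorAlgebra ℚ V →ₗ[ℚ] ExteriorAlgebra ℚ V := CliffordAlgebra.contractLeft d

theorem contract_ι_mul (d : Module.Dual ℚ V) (v : V) (x : ExteriorAlgebra ℚ V) :
    contract d (ExteriorAlgebra.ι ℚ v * x) = d v • x - ExteriorAlgebra.ι ℚ v * contract d x :=
  CliffordAlgebra.contractLeft_ι_mul d v x

theorem contract_wedge_mul {d : Module.Dual ℚ V} {l : List V} (h : ∀ v ∈ l, d v = 0)
    (x : ExteriorAlgebra ℚ V) :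
    contract d (wedge l * x) = (-1 : ℚ) ^ l.length • (wedge l * contract d x) := by
  induction l with
  | nil => simp
  | cons v l ih =>
    rw [wedge_cons, mul_assoc, contract_ι_mul, h v (by simp), ih fun w hw => h w (by simp [hw])]
    simp [pow_succ, mul_assoc]

/-- The linear extension to chains of the exterior product of the labels of the vertices. -/
noncomputable def labelWedge {α : Type*} (f : α → V) : Chain α →+ ExteriorAlgebra ℚ V :=
  FreeAbelianGroup.lift fun l => wedge (l.map f)

@[simp] theorem labelWedge_of {α : Type*} (f : α → V) (l : List α) :
    labelWedge f (of l) = wedge (l.map f) := lift_apply_of _ _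

theorem labelWedge_cone {α : Type*} (f : α → V) (a : α) (c : Chain α) :
    labelWedge f (cone a c) = ExteriorAlgebra.ι ℚ (f a) * labelWedge f c := by
  induction c using FreeAbelianGroup.induction_on with
  | zero => simp
  | of l => simp
  | neg l h => simp only [map_neg, h, mul_neg]
  | add x y hx hy => simp only [map_add, hx, hy, mul_add]

theorem contract_wedge_map {α : Type*} {f : α → V} {d y : Module.Dual ℚ V} {q : ℚ} {l : List α}
    (h : ∀ a ∈ l, d (f a) = 1 - q * y (f a)) :
    contract d (wedge (l.map f))
      = labelWedge f (faces l) - q • contract y (wedge (l.map f)) := by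
  induction l with
  | nil => simp [faces, contract]
  | cons a l ih =>
    rw [List.map_cons, wedge_cons, contract_ι_mul, contract_ι_mul, h a (by simp),
      ih fun b hb => h b (by simp [hb]), faces, map_sub, labelWedge_cone, labelWedge_of]
    simp only [sub_smul, one_smul, mul_sub, smul_sub, mul_smul, mul_smul_comm]
    abel

end Wedge

section Volume

variable {n : ℕ}

/-- The coefficient of the volume form. -/
noncomputable def vol (n : ℕ) : ExteriorAlgebra ℚ (Fin n → ℚ) →ₗ[ℚ] ℚ :=
  ExteriorAlgebra.liftAlternating (Pi.single n Matrix.detRowAlternating)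

theorem vol_wedge {l : List (Fin n → ℚ)} (hl : l.length = n) :
    vol n (wedge l) = (Matrix.of fun i : Fin n => l[i]).det := by
  rw [wedge_eq_ιMulti hl, vol, ExteriorAlgebra.liftAlternating_apply_ιMulti, Pi.single_eq_same]
  rfl

theorem vol_wedge_of_ne {l : List (Fin n → ℚ)} (hl : l.length ≠ n) :
    vol n (wedge l) = 0 := by
  rw [wedge_eq_ιMulti rfl, vol, ExteriorAlgebra.liftAlternating_apply_ιMulti, Pi.single_eq_of_ne hl]
  rfl

theorem vol_wedge_eq_zero_of_eq {l : List (Fin n → ℚ)} (hl : l.length = n) {i j : Fin n}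
    (hij : i ≠ j) (h : ∀ v ∈ l, v i = v j) : vol n (wedge l) = 0 := by
  rw [vol_wedge hl]
  exact Matrix.det_zero_of_column_eq hij fun k => h _ (List.getElem_mem _)

theorem vol_wedge_swap {l l' : List (Fin n → ℚ)} (hl : l.length = n) {i j : Fin n} (hij : i ≠ j)
    (h : l' = l.map fun v k => v (Equiv.swap i j k)) :
    vol n (wedge l') = - vol n (wedge l) := by
  rw [vol_wedge hl, vol_wedge (by simp [h, hl])]
  have := Matrix.det_permute' (Equiv.swap i j) (Matrix.of fun k : Fin n => l[k])
  rw [Equiv.Perm.sign_swap hij] at this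
  simp only [Units.val_neg, Units.val_one, Int.cast_neg, Int.cast_one, neg_mul, one_mul] at this
  rw [← this]
  congr 1
  ext a b
  simp [h]

theorem exists_perm_of_vol_ne_zero {l : List (Fin n → ℚ)} (hl : l.length = n)
    (h : vol n (wedge l) ≠ 0) : ∃ σ : Equiv.Perm (Fin n), ∀ i : Fin n, l[i] (σ i) ≠ 0 := by
  by_contra! hσ
  refine h ?_
  rw [vol_wedge hl, ← Matrix.det_transpose, Matrix.det_apply]
  refine Finset.sum_eq_zero fun σ _ => ?_
  obtain ⟨i, hi⟩ := hσ σ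
  rw [Finset.prod_eq_zero (Finset.mem_univ i) (by simpa using hi), smul_zero]

/-- The integral vectors as rational vectors. -/
def castVec (w : Fin n → ℤ) : Fin n → ℚ := fun i => w i

/-- The additive span of the exterior products of integral vectors. -/
noncomputable def integralForms (n : ℕ) : AddSubgroup (ExteriorAlgebra ℚ (Fin n → ℚ)) :=
  AddSubgroup.closure (Set.range fun l : List (Fin n → ℤ) => wedge (l.map castVec))

theorem map_mem_of_mem_integralForms {A : Type*} [AddCommGroup A] [Module ℚ A]
    (f : ExteriorAlgebra ℚ (Fin n → ℚ) →ₗ[ℚ] A) (S : AddSubgroup A)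
    (h : ∀ l : List (Fin n → ℤ), f (wedge (l.map castVec)) ∈ S)
    {x : ExteriorAlgebra ℚ (Fin n → ℚ)} (hx : x ∈ integralForms n) : f x ∈ S := by
  have : integralForms n ≤ S.comap f.toAddMonoidHom := by
    rw [integralForms, AddSubgroup.closure_le]
    rintro _ ⟨l, rfl⟩
    exact h l
  exact this hx

theorem wedge_castVec_mem (l : List (Fin n → ℤ)) : wedge (l.map castVec) ∈ integralForms n :=
  AddSubgroup.subset_closure ⟨l, rfl⟩

theorem ι_mul_mem_integralForms (w : Fin n → ℤ) {x : ExteriorAlgebra ℚ (Fin n → ℚ)}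
    (hx : x ∈ integralForms n) : ExteriorAlgebra.ι ℚ (castVec w) * x ∈ integralForms n :=
  map_mem_of_mem_integralForms (LinearMap.mulLeft ℚ _) _
    (fun l => wedge_castVec_mem (w :: l)) hx

theorem wedge_castVec_mul_mem (l : List (Fin n → ℤ)) {x : ExteriorAlgebra ℚ (Fin n → ℚ)}
    (hx : x ∈ integralForms n) : wedge (l.map castVec) * x ∈ integralForms n := by
  induction l with
  | nil => simpa using hx
  | cons w l ih =>
    rw [List.map_cons, wedge_cons, mul_assoc]
    exact ι_mul_mem_integralForms w ih

theorem intCast_smul_mem_integralForms (m : ℤ) {x : ExteriorAlgebra ℚ (Fin n → ℚ)}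
    (hx : x ∈ integralForms n) : (m : ℚ) • x ∈ integralForms n := by
  rw [Int.cast_smul_eq_zsmul]
  exact zsmul_mem hx m

theorem contract_proj_mem_integralForms (i : Fin n) {x : ExteriorAlgebra ℚ (Fin n → ℚ)}
    (hx : x ∈ integralForms n) : contract (LinearMap.proj i) x ∈ integralForms n := by
  refine map_mem_of_mem_integralForms (contract (LinearMap.proj i)) _
    (fun l => ?_) hx
  induction l with
  | nil => simp [contract]
  | cons w l ih =>
    rw [List.map_cons, wedge_cons, contract_ι_mul]
    exact sub_mem (intCast_smul_mem_integralForms (w i) (wedge_castVec_mem l))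
      (ι_mul_mem_integralForms w ih)

theorem vol_mem_range_intCast {x : ExteriorAlgebra ℚ (Fin n → ℚ)} (hx : x ∈ integralForms n) :
    ∃ m : ℤ, vol n x = m := by
  suffices vol n x ∈ (Int.castAddHom ℚ).range by
    obtain ⟨m, hm⟩ := this
    exact ⟨m, hm.symm⟩
  refine map_mem_of_mem_integralForms (vol n) _ (fun l => ?_) hx
  by_cases hl : l.length = n
  · refine ⟨(Matrix.of fun i : Fin n => l[i]).det, ?_⟩
    rw [vol_wedge (by simpa using hl), Int.coe_castAddHom]
    refine (Int.cast_det _).trans ?_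
    congr 1
    ext i j
    simp [castVec]
  · refine ⟨0, ?_⟩
    rw [vol_wedge_of_ne (by simpa using hl), map_zero]

end Volume

section Simplices

variable {n : ℕ}

/-- The face of the standard simplex on which the coordinates in `s` vanish. -/
def faceOn (s : Set (Fin (n + 1))) : Set (Fin (n + 1) → ℝ) :=
  {z | z ∈ stdSimplex ℝ (Fin (n + 1)) ∧ ∀ i ∈ s, z i = 0}

theorem convex_faceOn (s : Set (Fin (n + 1))) : Convex ℝ (faceOn s) := by
  have : faceOn s = stdSimplex ℝ (Fin (n + 1)) ∩
      ⋂ i ∈ s, {z : Fin (n + 1) → ℝ | LinearMap.proj (R := ℝ) (φ := fun _ => ℝ) i z = 0} := by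
    ext z
    simp [faceOn]
  rw [this]
  exact (convex_stdSimplex ℝ _).inter
    (convex_iInter₂ fun i _ => convex_hyperplane (LinearMap.isLinear _) 0)

theorem dist_le_one_of_mem_faceOn {s : Set (Fin (n + 1))} {z w : Fin (n + 1) → ℝ}
    (hz : z ∈ faceOn s) (hw : w ∈ faceOn s) : dist z w ≤ 1 := by
  refine (dist_pi_le_iff zero_le_one).2 fun i => ?_
  have hzi := mem_Icc_of_mem_stdSimplex hz.1 i
  have hwi := mem_Icc_of_mem_stdSimplex hw.1 i
  rw [Real.dist_eq, abs_le]
  constructor <;> linarith [hzi.1, hzi.2, hwi.1, hwi.2]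

/-- A simplex with `k` vertices in `K`, of diameter at most `d`, that may occur in a barycentric
subdivision. -/
structure IsFine (K : Set (Fin (n + 1) → ℝ)) (k : ℕ) (d : ℝ) (l : List (Vertex (Fin (n + 1)))) :
    Prop where
  map_snd : l.map Prod.snd = (List.range k).reverse
  mem : ∀ x ∈ l, x.1 ∈ K
  dist_le : ∀ x ∈ l, ∀ y ∈ l, dist x.1 y.1 ≤ d
  dominates : l.Pairwise Dominates

theorem IsFine.length_eq {K : Set (Fin (n + 1) → ℝ)} {k : ℕ} {d : ℝ}
    {l : List (Vertex (Fin (n + 1)))} (h : IsFine K k d l) : l.length = k := by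
  simpa using congrArg List.length h.map_snd

/-- The factor by which barycentric subdivision shrinks diameters. -/
noncomputable def ratio (n : ℕ) : ℝ := 1 - ((n + 1 : ℕ) : ℝ)⁻¹

theorem ratio_nonneg (n : ℕ) : 0 ≤ ratio n :=
  sub_nonneg.2 (inv_le_one_of_one_le₀ (by exact_mod_cast Nat.le_add_left 1 n))

theorem ratio_lt_one (n : ℕ) : ratio n < 1 := sub_lt_self _ (by positivity)

theorem subdiv_mem {s : Set (Fin (n + 1))} {k : ℕ} (hk : k ≤ n + 1) {d : ℝ} (hd : 0 ≤ d)
    {l : List (Vertex (Fin (n + 1)))} (hl : l.length = k) (hK : ∀ x ∈ l, x.1 ∈ faceOn s)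
    (hdist : ∀ x ∈ l, ∀ y ∈ l, dist x.1 y.1 ≤ d) :
    subdiv bary k (of l) ∈ chainsOf (IsFine (faceOn s) k (ratio n * d)) :=
  chainsOf_mono (fun _ h => ⟨h.map_snd, fun x hx => convexHull_min
      (by rintro _ ⟨y, hy, rfl⟩; exact hK y hy) (convex_faceOn s) (h.mem_hull x hx),
      h.dist_le, h.dominates⟩)
    (subdiv_bary_mem hk hl (fun x hx i => (hK x hx).1.1 i) hd hdist)

/-- Iterated barycentric subdivision of chains of simplices with `k` vertices. -/
noncomputable def iterSubdiv (n k : ℕ) :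
    ℕ → Chain (Vertex (Fin (n + 1))) →+ Chain (Vertex (Fin (n + 1)))
  | 0 => AddMonoidHom.id _
  | m + 1 => (subdiv bary k).comp (iterSubdiv n k m)

theorem boundary_iterSubdiv (k m : ℕ) (c : Chain (Vertex (Fin (n + 1)))) :
    boundary (iterSubdiv n (k + 1) m c) = iterSubdiv n k m (boundary c) := by
  induction m with
  | zero => rfl
  | succ m ih => simp only [iterSubdiv, AddMonoidHom.comp_apply, boundary_subdiv, ih]

theorem iterSubdiv_zero (m : ℕ) (c : Chain (Vertex (Fin (n + 1)))) : iterSubdiv n 0 m c = c := by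
  induction m with
  | zero => rfl
  | succ m ih => simp [iterSubdiv, ih, subdiv]

theorem iterSubdiv_mem {s : Set (Fin (n + 1))} {k : ℕ} (hk : k ≤ n + 1)
    {l : List (Vertex (Fin (n + 1)))} (hl : l.length = k) (hK : ∀ x ∈ l, x.1 ∈ faceOn s) (m : ℕ) :
    iterSubdiv n k (m + 1) (of l) ∈ chainsOf (IsFine (faceOn s) k (ratio n ^ (m + 1))) := by
  induction m with
  | zero =>
    simpa [iterSubdiv] using subdiv_mem hk zero_le_one hl hK
      fun x hx y hy => dist_le_one_of_mem_faceOn (hK x hx) (hK y hy)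
  | succ m ih =>
    rw [iterSubdiv, AddMonoidHom.comp_apply, pow_succ']
    exact map_mem_of_mem_chainsOf _ _ (fun l' hl' => subdiv_mem hk
      (pow_nonneg (ratio_nonneg n) _) hl'.length_eq hl'.mem hl'.dist_le) ih

/-- The vertices of the standard simplex. -/
def corner (R : Type*) [Zero R] [One R] (n k : ℕ) : Fin (n + 1) → R :=
  fun i => if (i : ℕ) = k then 1 else 0

theorem corner_mem_faceOn {k : ℕ} (hk : k < n + 1) {s : Set (Fin (n + 1))}
    (hs : ∀ i ∈ s, (i : ℕ) ≠ k) : corner ℝ n k ∈ faceOn s := by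
  refine ⟨⟨fun i => ?_, ?_⟩, fun i hi => if_neg (hs i hi)⟩
  · unfold corner
    split_ifs <;> norm_num
  · rw [Fintype.sum_eq_single (⟨k, hk⟩ : Fin (n + 1))]
    · simp [corner]
    · exact fun i hi => if_neg fun h => hi (Fin.ext h)

/-- The simplex on the first `k` corners of the standard simplex, the last one coming first. -/
def corners (n : ℕ) : ℕ → List (Vertex (Fin (n + 1)))
  | 0 => []
  | k + 1 => (corner ℝ n k, 0) :: corners n k

theorem length_corners (k : ℕ) : (corners n k).length = k := by
  induction k with
  | zero => rfl
  | succ k ih => simp [corners, ih]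

theorem corners_mem {k : ℕ} (hk : k ≤ n + 1) :
    ∀ x ∈ corners n k, x.1 ∈ faceOn {i : Fin (n + 1) | k ≤ i} := by
  suffices ∀ j ≤ k, ∀ x ∈ corners n j, x.1 ∈ faceOn {i : Fin (n + 1) | k ≤ i} from this k le_rfl
  intro j hj
  induction j with
  | zero => simp [corners]
  | succ j ih =>
    intro x hx
    rcases List.mem_cons.1 hx with rfl | hx
    · exact corner_mem_faceOn (by lia) fun i (hi : k ≤ i) => by lia
    · exact ih (by lia) x hx

/-- A simplex with `m` vertices in a facet of the simplex on the first `k` corners, opposite to one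
of the first `j` of them. -/
def IsInFacet (n m j k : ℕ) (l : List (Vertex (Fin (n + 1)))) : Prop :=
  l.length = m ∧ ∃ i : Fin (n + 1), (i : ℕ) < j ∧
    ∀ x ∈ l, x.1 ∈ faceOn (insert i {i : Fin (n + 1) | k ≤ i})

theorem cone_faces_corners_mem {k : ℕ} (hk : k < n + 1) :
    cone (corner ℝ n k, 0) (faces (corners n k)) ∈ chainsOf (IsInFacet n k k (k + 1)) := by
  have hcone : ∀ k, k < n + 1 →
      faces (corners n k) ∈ chainsOf (fun l => IsInFacet n (k - 1) k k l ∧ 0 < k) →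
      cone (corner ℝ n k, 0) (faces (corners n k)) ∈ chainsOf (IsInFacet n k k (k + 1)) := by
    intro k hk h
    refine map_mem_of_mem_chainsOf _ _ ?_ h
    rintro l ⟨⟨hl, i, hi, hli⟩, hk0⟩
    rw [cone_of]
    refine of_mem_chainsOf ⟨by simp [hl]; lia, i, hi, fun x hx => ?_⟩
    rcases List.mem_cons.1 hx with rfl | hx
    · refine corner_mem_faceOn hk fun i' hi' => ?_
      rcases hi' with rfl | hi'
      · lia
      · have : k + 1 ≤ (i' : ℕ) := hi'
        lia
    · refine ⟨(hli x hx).1, fun i' hi' => (hli x hx).2 i' ?_⟩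
      exact hi'.imp_right fun (h : k + 1 ≤ (i' : ℕ)) => show k ≤ (i' : ℕ) by lia
  refine hcone k hk ?_
  induction k with
  | zero => exact zero_mem _
  | succ k ih =>
    refine sub_mem (of_mem_chainsOf ⟨⟨length_corners k, ⟨k, by lia⟩, by simp, fun x hx => ?_⟩,
      by lia⟩) (chainsOf_mono ?_ (hcone k (by lia) (ih (by lia))))
    · refine ⟨(corners_mem (by lia) x hx).1, fun i hi => (corners_mem (by lia) x hx).2 i ?_⟩
      rcases hi with rfl | hi
      · exact le_refl k
      · have : k + 1 ≤ (i : ℕ) := hi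
        exact (by lia : k ≤ (i : ℕ))
    · rintro l ⟨hl, i, hi, hli⟩
      exact ⟨⟨hl, i, by lia, hli⟩, by lia⟩

end Simplices

section Labels

variable {n : ℕ}

/-- Tile `i` goes to box `i`, except that the last tile goes to box `b`. -/
def box (b t : Fin (n + 1)) : Fin (n + 1) := if t = Fin.last n then b else t

open Classical in
/-- The boxes that hold no non-degenerate tile when the last tile is put into box `b`. -/
noncomputable def emptyBoxes (b : Fin (n + 1)) (z : Fin (n + 1) → ℝ) : Finset (Fin (n + 1)) :=
  {i | (i ≠ Fin.last n → z i = 0) ∧ (i = b → z (Fin.last n) = 0)}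

theorem mem_emptyBoxes {b i : Fin (n + 1)} {z : Fin (n + 1) → ℝ} :
    i ∈ emptyBoxes b z ↔ (i ≠ Fin.last n → z i = 0) ∧ (i = b → z (Fin.last n) = 0) := by
  simp [emptyBoxes]

theorem eq_zero_of_box_mem_emptyBoxes {b t : Fin (n + 1)} {z : Fin (n + 1) → ℝ}
    (h : box b t ∈ emptyBoxes b z) : z t = 0 := by
  rw [mem_emptyBoxes] at h
  unfold box at h
  split_ifs at h with ht
  · exact ht ▸ h.2 rfl
  · exact h.1 ht

open Classical in
/-- The box that an agent preferring tile `t` at the cut `z` asks for, as a vector: the box of `t`,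
or the average of all empty boxes if `t` is degenerate. -/
noncomputable def label (pref : Vertex (Fin (n + 1)) → Fin (n + 1)) (b : Fin (n + 1))
    (x : Vertex (Fin (n + 1))) : Fin (n + 1) → ℚ :=
  if x.1 (pref x) = 0 then
    fun i => if i ∈ emptyBoxes b x.1 then ((emptyBoxes b x.1).card : ℚ)⁻¹ else 0
  else Pi.single (box b (pref x)) 1

variable {pref : Vertex (Fin (n + 1)) → Fin (n + 1)} {b : Fin (n + 1)} {x : Vertex (Fin (n + 1))}

theorem emptyBoxes_nonempty {t : Fin (n + 1)} {z : Fin (n + 1) → ℝ} (h : z t = 0) :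
    (emptyBoxes b z).Nonempty := by
  by_cases hb : b = Fin.last n
  · exact ⟨t, mem_emptyBoxes.2 ⟨fun _ => h, fun htb => by rw [← hb, ← htb, h]⟩⟩
  · exact ⟨Fin.last n, mem_emptyBoxes.2 ⟨fun h => (h rfl).elim, fun h => (hb h.symm).elim⟩⟩

theorem sum_label : ∑ i, label pref b x i = 1 := by
  unfold label
  split_ifs with h
  · have := (emptyBoxes_nonempty (b := b) h).card_ne_zero
    simp [Finset.sum_ite_mem, this]
  · simp

theorem label_ne_zero {i : Fin (n + 1)} (h : label pref b x i ≠ 0) :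
    (x.1 (pref x) ≠ 0 ∧ box b (pref x) = i) ∨ (x.1 (pref x) = 0 ∧ i ∈ emptyBoxes b x.1) := by
  unfold label at h
  split_ifs at h with hx
  · exact Or.inr ⟨hx, by simpa using (ite_ne_right_iff.1 h).1⟩
  · refine Or.inl ⟨hx, ?_⟩
    by_contra hne
    exact h (Pi.single_eq_of_ne (Ne.symm hne) _)

theorem label_eq_of_last (h : x.1 (Fin.last n) = 0) (b b' : Fin (n + 1)) :
    label pref b x = label pref b' x := by
  have : emptyBoxes b x.1 = emptyBoxes b' x.1 := by
    ext i
    simp [mem_emptyBoxes, h]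
  unfold label
  rw [this]
  split_ifs with hx
  · rfl
  · have : pref x ≠ Fin.last n := fun hp => hx (hp ▸ h)
    simp [box, this]

theorem label_swap {k : Fin (n + 1)} (hk : k ≠ Fin.last n) (h : x.1 k = 0) :
    label pref (Fin.last n) x
      = fun i => label pref k x (Equiv.swap k (Fin.last n) i) := by
  have hmem : ∀ i, i ∈ emptyBoxes (Fin.last n) x.1 ↔
      Equiv.swap k (Fin.last n) i ∈ emptyBoxes k x.1 := by
    intro i
    simp only [mem_emptyBoxes]
    rcases eq_or_ne i k with rfl | hik
    · simp [h, hk, Ne.symm hk]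
    rcases eq_or_ne i (Fin.last n) with rfl | hil
    · simp [h, hk]
    · simp [Equiv.swap_apply_of_ne_of_ne hik hil, hik, hil]
  have hcard : (emptyBoxes (Fin.last n) x.1).card = (emptyBoxes k x.1).card :=
    Finset.card_equiv (Equiv.swap k (Fin.last n)) hmem
  unfold label
  split_ifs with hx
  · funext i
    simp only [hmem, hcard]
  · have hpk : pref x ≠ k := fun hp => hx (hp ▸ h)
    funext i
    simp only [Pi.single_apply]
    refine if_congr ?_ rfl rfl
    unfold box
    split_ifs with hp
    · rw [Equiv.swap_apply_eq_iff]; simp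
    · rw [Equiv.swap_apply_eq_iff, Equiv.swap_apply_of_ne_of_ne hpk hp]

theorem label_eq_label_last {k : Fin (n + 1)} (h : x.1 k = 0)
    (hb : (b ≠ Fin.last n ∧ b ≠ k) ∨ x.1 (Fin.last n) = 0) :
    label pref b x k = label pref b x (Fin.last n) := by
  unfold label
  split_ifs with hx
  · refine if_congr ?_ rfl rfl
    rcases hb with ⟨hbl, hbk⟩ | hb
    · simp [mem_emptyBoxes, h, hbl.symm, hbk.symm]
    · simp [mem_emptyBoxes, h, hb]
  · have hpk : pref x ≠ k := fun hp => hx (hp ▸ h)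
    have h1 : box b (pref x) ≠ k ∧ box b (pref x) ≠ Fin.last n := by
      unfold box
      split_ifs with hp
      · rcases hb with hb | hb
        · exact ⟨hb.2, hb.1⟩
        · exact (hx (hp ▸ hb)).elim
      · exact ⟨hpk, hp⟩
    rw [Pi.single_eq_of_ne h1.1.symm, Pi.single_eq_of_ne h1.2.symm]

theorem card_emptyBoxes_le (hx : x.1 ∈ stdSimplex ℝ (Fin (n + 1)))
    (h : x.1 (Fin.last n) = 0) : (emptyBoxes b x.1).card ≤ n := by
  have : emptyBoxes b x.1 ≠ Finset.univ := by
    intro huniv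
    have h0 : ∀ i, x.1 i = 0 := by
      intro i
      by_cases hi : i = Fin.last n
      · rw [hi, h]
      · exact (mem_emptyBoxes.1 (huniv ▸ Finset.mem_univ i)).1 hi
    have := hx.2
    simp [h0] at this
  have := Finset.card_lt_card (Finset.ssubset_univ_iff.2 this)
  rw [Finset.card_univ, Fintype.card_fin] at this
  lia

theorem emptyBoxes_subset {x y : Vertex (Fin (n + 1))} (h : Dominates x y) :
    emptyBoxes b x.1 ⊆ emptyBoxes b y.1 := fun i hi =>
  mem_emptyBoxes.2 ⟨fun hi' => h i ((mem_emptyBoxes.1 hi).1 hi'),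
    fun hi' => h _ ((mem_emptyBoxes.1 hi).2 hi')⟩

theorem factorial_div_smul_wedge_label_mem {l : List (Vertex (Fin (n + 1)))}
    (hl : ∀ x ∈ l, x.1 ∈ stdSimplex ℝ (Fin (n + 1)) ∧ x.1 (Fin.last n) = 0)
    (hdom : l.Pairwise Dominates) {a : ℕ} (ha : a ≤ n)
    (hcard : ∀ x ∈ l, x.1 (pref x) = 0 → a < (emptyBoxes b x.1).card) :
    ((n.factorial : ℚ) / a.factorial) • wedge (l.map (label pref b)) ∈ integralForms (n + 1) := by
  induction l generalizing a with
  | nil =>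
    have := intCast_smul_mem_integralForms ((n.factorial / a.factorial : ℕ) : ℤ)
      (wedge_castVec_mem ([] : List (Fin (n + 1) → ℤ)))
    rwa [Int.cast_natCast, Nat.cast_div (Nat.factorial_dvd_factorial ha)
      (by exact_mod_cast a.factorial_ne_zero)] at this
  | cons x l ih =>
    rw [List.pairwise_cons] at hdom
    have hl' := fun y hy => hl y (List.mem_cons_of_mem x hy)
    rw [List.map_cons, wedge_cons]
    by_cases hx : x.1 (pref x) = 0
    · by_cases hrep : label pref b x ∈ l.map (label pref b)
      · rw [ι_mul_wedge_of_mem hrep, smul_zero]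
        exact zero_mem _
      set c := (emptyBoxes b x.1).card with hc
      have hac : a < c := hcard x (by simp) hx
      have hcn : c ≤ n := card_emptyBoxes_le (hl x (by simp)).1 (hl x (by simp)).2
      have hmem := ih hl' hdom.2 hcn fun y hy hy0 => by
        refine Finset.card_lt_card (Finset.ssubset_iff_subset_ne.2
          ⟨emptyBoxes_subset (hdom.1 y hy), fun heq => hrep ?_⟩)
        refine List.mem_map.2 ⟨y, hy, ?_⟩
        simp only [label, hx, hy0, heq, if_true]
      classical
      have hlab : label pref b x
          = (c : ℚ)⁻¹ • castVec fun i => if i ∈ emptyBoxes b x.1 then 1 else 0 := by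
        funext i
        by_cases hi : i ∈ emptyBoxes b x.1 <;> simp [label, hx, castVec, hi, hc]
      have hdvd : a.factorial ∣ (c - 1).factorial := Nat.factorial_dvd_factorial (by lia)
      have hfac : (c : ℚ) * (c - 1).factorial = c.factorial := by
        exact_mod_cast Nat.mul_factorial_pred (by lia)
      have := intCast_smul_mem_integralForms (((c - 1).factorial / a.factorial : ℕ) : ℤ)
        (ι_mul_mem_integralForms (fun i => if i ∈ emptyBoxes b x.1 then 1 else 0) hmem)
      rw [Int.cast_natCast, Nat.cast_div hdvd (by exact_mod_cast a.factorial_ne_zero),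
        mul_smul_comm, smul_smul] at this
      rw [hlab, map_smul, smul_mul_assoc, smul_smul]
      convert this using 2
      have h1 : (c : ℚ) ≠ 0 := by exact_mod_cast (by lia : c ≠ 0)
      have h2 : ((c - 1).factorial : ℚ) ≠ 0 := by exact_mod_cast (c - 1).factorial_ne_zero
      rw [← hfac]
      field_simp
    · classical
      have hlab : label pref b x = castVec (Pi.single (box b (pref x)) 1) := by
        funext i
        simp [label, hx, castVec, Pi.single_apply]
      rw [hlab, ← mul_smul_comm]
      exact ι_mul_mem_integralForms _
        (ih hl' hdom.2 ha fun y hy => hcard y (List.mem_cons_of_mem x hy))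

theorem factorial_smul_wedge_label_mem {l : List (Vertex (Fin (n + 1)))}
    (hl : ∀ x ∈ l, x.1 ∈ stdSimplex ℝ (Fin (n + 1)) ∧ x.1 (Fin.last n) = 0)
    (hdom : l.Pairwise Dominates) :
    (n.factorial : ℚ) • wedge (l.map (label pref b)) ∈ integralForms (n + 1) := by
  simpa using factorial_div_smul_wedge_label_mem (pref := pref) (b := b) hl hdom n.zero_le
    fun x _ h => (emptyBoxes_nonempty h).card_pos

end Labels

section Degree

variable {n : ℕ}

theorem vol_wedge_map_of_sum_eq_one {α : Type*} {f : α → Fin (n + 1) → ℚ} (hf : ∀ a, ∑ i, f a i = 1)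
    {l : List α} (hl : l.length = n + 1) :
    ((n + 1 : ℕ) : ℚ) * vol (n + 1) (wedge (l.map f))
      = vol (n + 1) (ExteriorAlgebra.ι ℚ 1 * labelWedge f (faces l)) := by
  have h0 : ExteriorAlgebra.ι ℚ (1 : Fin (n + 1) → ℚ) * wedge (l.map f) = 0 := by
    rw [← wedge_cons]
    exact wedge_eq_zero_of_finrank_lt (by simp [hl])
  have h1 := congrArg (contract (∑ i, LinearMap.proj i)) h0
  rw [contract_ι_mul, contract_wedge_map (y := 0) (q := 0) fun a _ => by simpa using hf a, map_zero,
    zero_smul, sub_zero, sub_eq_zero] at h1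
  rw [← h1, map_smul, smul_eq_mul]
  simp

/-- The volume of the exterior product of `y` with the labels of the vertices of a chain. -/
noncomputable def labelVol {α : Type*} (y : ExteriorAlgebra ℚ (Fin (n + 1) → ℚ))
    (f : α → Fin (n + 1) → ℚ) : Chain α →+ ℚ :=
  (vol (n + 1)).toAddMonoidHom.comp ((AddMonoidHom.mulLeft y).comp (labelWedge f))

theorem labelVol_apply {α : Type*} (y : ExteriorAlgebra ℚ (Fin (n + 1) → ℚ))
    (f : α → Fin (n + 1) → ℚ) (c : Chain α) :
    labelVol y f c = vol (n + 1) (y * labelWedge f c) := rfl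

theorem labelVol_congr {α : Type*} {Q : List α → Prop} {y : ExteriorAlgebra ℚ (Fin (n + 1) → ℚ)}
    {f g : α → Fin (n + 1) → ℚ} (h : ∀ l, Q l → ∀ a ∈ l, f a = g a) {c : Chain α}
    (hc : c ∈ chainsOf Q) : labelVol y f c = labelVol y g c := by
  have := map_eq_zero_of_mem_chainsOf (labelVol y f - labelVol y g) (fun l hl => by
    rw [AddMonoidHom.sub_apply, labelVol_apply, labelVol_apply, labelWedge_of, labelWedge_of,
      List.map_congr_left (h l hl), sub_self]) hc
  exact sub_eq_zero.1 this

variable {pref : Vertex (Fin (n + 1)) → Fin (n + 1)} {b : Fin (n + 1)}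

theorem sum_vol_wedge_label_eq_zero {l : List (Vertex (Fin (n + 1)))} (hl : l.length = n)
    {k : Fin (n + 1)} (hk : k ≠ Fin.last n) (h : ∀ x ∈ l, x.1 k = 0) :
    ∑ b, vol (n + 1) (wedge (1 :: l.map (label pref b))) = 0 := by
  rw [Finset.sum_eq_add_of_mem k (Fin.last n) (Finset.mem_univ _) (Finset.mem_univ _) hk]
  · rw [vol_wedge_swap (l := 1 :: l.map (label pref k))
      (l' := 1 :: l.map (label pref (Fin.last n))) (by simp [hl]) hk, add_neg_cancel]
    rw [List.map_cons, List.map_map]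
    exact congrArg _ (List.map_congr_left fun x hx => label_swap hk (h x hx))
  · intro b _ hb
    refine vol_wedge_eq_zero_of_eq (by simp [hl]) hk fun v hv => ?_
    rcases List.mem_cons.1 hv with rfl | hv
    · rfl
    · obtain ⟨x, hx, rfl⟩ := List.mem_map.1 hv
      exact label_eq_label_last (h x hx) (Or.inl hb.symm)

/-- The corners of the standard simplex from the `k`-th one on, except for the last corner, which is
replaced by the all-one vector. -/
def testVectors (n k : ℕ) : List (Fin (n + 1) → ℤ) :=
  (List.range' k (n - k)).map (corner ℤ n) ++ [1]

theorem length_testVectors (k : ℕ) : (testVectors n k).length = n - k + 1 := by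
  simp [testVectors]

theorem testVectors_of_lt {k : ℕ} (hk : k < n) :
    testVectors n k = corner ℤ n k :: testVectors n (k + 1) := by
  rw [testVectors, testVectors, show n - k = n - (k + 1) + 1 by lia, List.range'_succ]
  rfl

theorem mem_testVectors {k : ℕ} {v : Fin (n + 1) → ℤ} (hv : v ∈ testVectors n k) :
    v = 1 ∨ ∃ i, k ≤ i ∧ i < n ∧ v = corner ℤ n i := by
  rcases List.mem_append.1 hv with hv | hv
  · obtain ⟨i, hi, rfl⟩ := List.mem_map.1 hv
    rw [List.mem_range'_1] at hi
    exact Or.inr ⟨i, hi.1, by lia, rfl⟩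
  · exact Or.inl (List.mem_singleton.1 hv)

theorem eq_last_of_mem_testVectors {k : ℕ} {v : Fin (n + 1) → ℤ} (hv : v ∈ testVectors n k)
    {i : Fin (n + 1)} (hi : (i : ℕ) < k) : v i = v (Fin.last n) := by
  rcases mem_testVectors hv with rfl | ⟨j, hj, hjn, rfl⟩
  · rfl
  · simp only [corner, Fin.val_last]
    rw [if_neg (by lia), if_neg (by lia)]

theorem vol_wedge_testVectors_zero : vol (n + 1) (wedge ((testVectors n 0).map castVec)) = 1 := by
  rw [vol_wedge (by simp [length_testVectors]), Matrix.det_of_isLowerTriangular]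
  · refine Finset.prod_eq_one fun i _ => ?_
    by_cases hi : (i : ℕ) < n
    · simp [testVectors, List.getElem_append, hi, castVec, corner]
    · simp [testVectors, List.getElem_append, hi, castVec]
  · intro i j hij
    have hij : (i : ℕ) < j := hij
    have hi : (i : ℕ) < n := by lia
    simp [testVectors, List.getElem_append, hi, castVec, corner]
    lia

theorem sub_sum_label_eq {k : ℕ} {x : Vertex (Fin (n + 1))}
    (hx : x.1 ∈ faceOn {i : Fin (n + 1) | k + 1 ≤ i}) (hk : k < n) :
    ∑ i ∈ {i : Fin (n + 1) | (i : ℕ) ≤ k}, (label pref b x i - label pref b x (Fin.last n))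
      = 1 - ((n + 1 : ℕ) : ℚ) * label pref b x (Fin.last n) := by
  have hlast : x.1 (Fin.last n) = 0 := hx.2 _ (by simpa using hk)
  rw [Finset.sum_filter_of_ne]
  · rw [Finset.sum_sub_distrib, sum_label]
    simp
  · intro i _ hi
    by_contra hik
    exact hi (sub_eq_zero.2 (label_eq_label_last (hx.2 i (by simpa using hik)) (Or.inr hlast)))

theorem factorial_mul_vol_testVectors_sub_mem {k : ℕ} (hk : k < n) {d : ℝ}
    {l : List (Vertex (Fin (n + 1)))}
    (hl : IsFine (faceOn {i : Fin (n + 1) | k + 1 ≤ i}) (k + 1) d l) :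
    (n.factorial : ℚ) *
        (labelVol (wedge ((testVectors n (k + 1)).map castVec)) (label pref b) (of l)
          - (-1) ^ (n - k) *
            labelVol (wedge ((testVectors n k).map castVec)) (label pref b) (faces l))
      ∈ AddSubgroup.zmultiples ((n + 1 : ℕ) : ℚ) := by
  set d : Module.Dual ℚ (Fin (n + 1) → ℚ) := ∑ i ∈ {i : Fin (n + 1) | (i : ℕ) ≤ k},
    (LinearMap.proj (R := ℚ) (φ := fun _ => ℚ) i - LinearMap.proj (Fin.last n)) with hd
  have hd_apply : ∀ v, d v = ∑ i ∈ {i : Fin (n + 1) | (i : ℕ) ≤ k}, (v i - v (Fin.last n)) := by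
    simp [hd]
  set w := wedge (l.map (label pref b)) with hw
  set t := wedge ((testVectors n k).map castVec) with ht
  set t' := wedge ((testVectors n (k + 1)).map castVec) with ht'
  have htt' : t = ExteriorAlgebra.ι ℚ (castVec (corner ℤ n k)) * t' := by
    rw [ht, testVectors_of_lt hk, List.map_cons, wedge_cons]
  have hdc : d (castVec (corner ℤ n k)) = 1 := by
    rw [hd_apply, Finset.sum_eq_single (⟨k, by lia⟩ : Fin (n + 1))]
    · simp [castVec, corner, hk.ne']
    · intro i _ hi
      have : (i : ℕ) ≠ k := fun h => hi (Fin.ext h)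
      simp [castVec, corner, this, hk.ne']
    · simp
  have hdt : ∀ v ∈ (testVectors n (k + 1)).map castVec, d v = 0 := by
    intro v hv
    obtain ⟨w, hw, rfl⟩ := List.mem_map.1 hv
    rw [hd_apply]
    refine Finset.sum_eq_zero fun i hi => ?_
    rw [Finset.mem_filter_univ] at hi
    rw [sub_eq_zero, castVec, eq_last_of_mem_testVectors hw (by lia), castVec]
  have h0 : t * w = 0 := by
    rw [ht, hw, ← wedge_append]
    refine wedge_eq_zero_of_finrank_lt ?_
    simp [length_testVectors, hl.length_eq]
    lia
  have hcw : contract d w = labelWedge (label pref b) (faces l)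
      - ((n + 1 : ℕ) : ℚ) • contract (LinearMap.proj (Fin.last n)) w :=
    contract_wedge_map fun x hx => by
      rw [hd_apply]
      exact sub_sum_label_eq (hl.mem x hx) hk
  have h1 := congrArg (contract d) h0
  rw [htt', mul_assoc, contract_ι_mul, contract_wedge_mul hdt, hdc, map_zero, one_smul,
    List.length_map, length_testVectors, mul_smul_comm, ← mul_assoc, ← htt', sub_eq_zero,
    show n - (k + 1) + 1 = n - k by lia, hcw, mul_sub, mul_smul_comm] at h1
  have hint : (n.factorial : ℚ) • w ∈ integralForms (n + 1) :=
    factorial_smul_wedge_label_mem (fun x hx =>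
      ⟨(hl.mem x hx).1, (hl.mem x hx).2 _ (by simpa using hk)⟩) hl.dominates
  obtain ⟨N, hN⟩ := vol_mem_range_intCast (wedge_castVec_mul_mem (testVectors n k)
    (contract_proj_mem_integralForms (Fin.last n) hint))
  rw [map_smul, mul_smul_comm, map_smul, smul_eq_mul] at hN
  refine ⟨-(-1) ^ (n - k) * N, ?_⟩
  rw [labelVol_apply, labelVol_apply, labelWedge_of, ← hw, h1]
  simp only [map_smul, map_sub, smul_eq_mul, zsmul_eq_mul]
  push_cast
  rw [← hN]
  ring

theorem labelVol_testVectors_cone_eq_zero {k : ℕ} (hk : k < n) (m : ℕ) :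
    labelVol (wedge ((testVectors n k).map castVec)) (label pref b)
      (iterSubdiv n k (m + 1) (cone (corner ℝ n k, 0) (faces (corners n k)))) = 0 := by
  rw [← AddMonoidHom.mem_ker]
  refine map_mem_of_mem_chainsOf (iterSubdiv n k (m + 1)) _ ?_ (cone_faces_corners_mem (by lia))
  rintro l ⟨hl, j, hj, hlj⟩
  rw [AddMonoidHom.mem_ker]
  refine map_eq_zero_of_mem_chainsOf (labelVol _ _) ?_ (iterSubdiv_mem (by lia) hl hlj m)
  intro l' hl'
  rw [labelVol_apply, labelWedge_of, ← wedge_append]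
  refine vol_wedge_eq_zero_of_eq (i := j) (j := Fin.last n) ?_ ?_ fun v hv => ?_
  · simp [length_testVectors, hl'.length_eq]
    lia
  · rintro rfl
    simp at hj
    lia
  · rcases List.mem_append.1 hv with hv | hv
    · obtain ⟨w, hw, rfl⟩ := List.mem_map.1 hv
      rw [castVec, eq_last_of_mem_testVectors hw hj, castVec]
    · obtain ⟨x, hx, rfl⟩ := List.mem_map.1 hv
      have hx := (hl'.mem x hx).2
      exact label_eq_label_last (hx j (Or.inl rfl)) (Or.inr (hx _ (Or.inr (by simpa using hk))))

theorem exists_factorial_mul_labelVol_sub_mem (m : ℕ) {k : ℕ} (hk : k ≤ n) : ∃ u : ℤˣ,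
    (n.factorial : ℚ) * (labelVol (wedge ((testVectors n k).map castVec)) (label pref b)
        (iterSubdiv n k (m + 1) (of (corners n k))) - u)
      ∈ AddSubgroup.zmultiples ((n + 1 : ℕ) : ℚ) := by
  induction k with
  | zero =>
    refine ⟨1, ?_⟩
    rw [iterSubdiv_zero, corners, labelVol_apply, labelWedge_of, List.map_nil, wedge_nil, mul_one,
      vol_wedge_testVectors_zero]
    simp
  | succ k ih =>
    obtain ⟨u, hu⟩ := ih (by lia)
    refine ⟨(-1) ^ (n - k) * u, ?_⟩
    set a := labelVol (wedge ((testVectors n k).map castVec)) (label pref b) with ha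
    set a' := labelVol (wedge ((testVectors n (k + 1)).map castVec)) (label pref b) with ha'
    set c := iterSubdiv n (k + 1) (m + 1) (of (corners n (k + 1))) with hc
    have hstep : (n.factorial : ℚ) * (a' c - (-1) ^ (n - k) * a (boundary c))
        ∈ AddSubgroup.zmultiples ((n + 1 : ℕ) : ℚ) := by
      refine map_mem_of_mem_chainsOf ((AddMonoidHom.mulLeft (n.factorial : ℚ)).comp
        (a' - (AddMonoidHom.mulLeft ((-1) ^ (n - k))).comp (a.comp boundary))) _ (fun l hl => ?_)
        (iterSubdiv_mem (by lia) (length_corners (k + 1)) (corners_mem (by lia)) m)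
      have := factorial_mul_vol_testVectors_sub_mem (pref := pref) (b := b) (by lia) hl
      simpa [mul_sub] using this
    have hac : a (boundary c) = a (iterSubdiv n k (m + 1) (of (corners n k))) := by
      rw [hc, boundary_iterSubdiv, boundary_of, corners, faces, map_sub, map_sub,
        labelVol_testVectors_cone_eq_zero (by lia), sub_zero]
    rw [hac] at hstep
    have := add_mem hstep (zsmul_mem hu ((-1) ^ (n - k)))
    convert this using 1
    rw [zsmul_eq_mul]
    push_cast
    ring

/-- For every fineness there are an arrangement of boxes and a small simplex whose labels are
linearly independent. -/
theorem exists_isFine_vol_ne_zero (hn : ¬ n + 1 ∣ n.factorial)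
    (pref : Vertex (Fin (n + 1)) → Fin (n + 1)) (m : ℕ) :
    ∃ b l, IsFine (faceOn ∅) (n + 1) (ratio n ^ (m + 1)) l ∧
      vol (n + 1) (wedge (l.map (label pref b))) ≠ 0 := by
  by_contra! h
  set a : Fin (n + 1) → Chain (Vertex (Fin (n + 1))) →+ ℚ :=
    fun b => labelVol (ExteriorAlgebra.ι ℚ 1) (label pref b) with ha
  set c := iterSubdiv n n (m + 1) (of (corners n n)) with hc
  have hbd : boundary (iterSubdiv n (n + 1) (m + 1) (of (corners n (n + 1))))
      = c - iterSubdiv n n (m + 1) (cone (corner ℝ n n, 0) (faces (corners n n))) := by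
    rw [boundary_iterSubdiv, boundary_of, corners, faces, map_sub]
  have h0 : ∀ b, a b (boundary (iterSubdiv n (n + 1) (m + 1) (of (corners n (n + 1))))) = 0 := by
    intro b
    refine map_eq_zero_of_mem_chainsOf ((a b).comp boundary) (fun l hl => ?_)
      (iterSubdiv_mem (s := ∅) le_rfl (length_corners (n + 1))
        (fun x hx => ⟨(corners_mem le_rfl x hx).1, by simp⟩) m)
    rw [AddMonoidHom.comp_apply, boundary_of, ha, labelVol_apply,
      ← vol_wedge_map_of_sum_eq_one (fun _ => sum_label) hl.length_eq, h b l hl, mul_zero]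
  have hcone : ∑ b, a b (iterSubdiv n n (m + 1)
      (cone (corner ℝ n n, 0) (faces (corners n n)))) = 0 := by
    rw [← AddMonoidHom.finsetSum_apply, ← AddMonoidHom.mem_ker]
    refine map_mem_of_mem_chainsOf (iterSubdiv n n (m + 1)) _ ?_ (cone_faces_corners_mem (by lia))
    rintro l ⟨hl, j, hj, hlj⟩
    rw [AddMonoidHom.mem_ker]
    refine map_eq_zero_of_mem_chainsOf (∑ b, a b) ?_ (iterSubdiv_mem (by lia) hl hlj m)
    intro l' hl'
    simp only [AddMonoidHom.finsetSum_apply, ha, labelVol_apply, labelWedge_of, ← wedge_cons]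
    exact sum_vol_wedge_label_eq_zero hl'.length_eq (by rintro rfl; simp at hj)
      fun x hx => (hl'.mem x hx).2 j (Or.inl rfl)
  have hcb : ∀ b, a b c = a (Fin.last n) c := fun b =>
    labelVol_congr (fun l hl x hx => label_eq_of_last ((hl.mem x hx).2 _ (by simp)) _ _)
      (iterSubdiv_mem (by lia) (length_corners n) (corners_mem (by lia)) m)
  have hlast : a (Fin.last n) c = 0 := by
    have : ∑ b, a b c = 0 := by
      rw [← hcone]
      refine Finset.sum_congr rfl fun b _ => ?_
      rw [← sub_eq_zero, ← map_sub, ← hbd, h0 b]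
    simp_rw [hcb] at this
    rw [Finset.sum_const, Finset.card_univ, Fintype.card_fin, nsmul_eq_mul] at this
    exact (mul_eq_zero.1 this).resolve_left (by positivity)
  obtain ⟨u, N, hN⟩ := exists_factorial_mul_labelVol_sub_mem (pref := pref) (b := Fin.last n) m
    (le_refl n)
  have htest : wedge ((testVectors n n).map castVec) = ExteriorAlgebra.ι ℚ 1 := by
    have : castVec (1 : Fin (n + 1) → ℤ) = 1 := by ext; simp [castVec]
    simp [testVectors, this]
  rw [htest, ← hc] at hN
  change _ = _ * (a (Fin.last n) c - _) at hN
  rw [hlast, zero_sub] at hN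
  refine hn ?_
  have hN' : N * ((n + 1 : ℕ) : ℤ) = (n.factorial : ℤ) * -(u : ℤ) := by
    have hN : (N : ℚ) * ((n + 1 : ℕ) : ℚ) = n.factorial * -(u : ℤ) := by
      simpa [mul_add] using hN
    exact_mod_cast hN
  rw [← Int.natCast_dvd_natCast]
  exact (IsUnit.dvd_mul_right (Units.isUnit u).neg).1 (Dvd.intro_left _ hN')

end Degree

section Limit

open Filter Topology

variable {n : ℕ}

theorem exists_perm_label_ne_zero (hn : ¬ n + 1 ∣ n.factorial)
    (pref : Vertex (Fin (n + 1)) → Fin (n + 1)) (m : ℕ) :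
    ∃ (b : Fin (n + 1)) (σ : Equiv.Perm (Fin (n + 1)))
      (p : Fin (n + 1) → stdSimplex ℝ (Fin (n + 1))),
      (∀ i j, dist (p i) (p j) ≤ ratio n ^ (m + 1)) ∧
      ∀ j : Fin (n + 1), label pref b (p j, j) (σ j) ≠ 0 := by
  obtain ⟨b, l, hl, hvol⟩ := exists_isFine_vol_ne_zero hn pref m
  have hlen := hl.length_eq
  obtain ⟨σ, hσ⟩ := exists_perm_of_vol_ne_zero (by simpa using hlen) hvol
  refine ⟨b, Fin.revPerm.trans σ, fun j => ⟨l[j.rev].1, (hl.mem _ (List.getElem_mem _)).1⟩,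
    fun i j => hl.dist_le _ (List.getElem_mem _) _ (List.getElem_mem _), fun j => ?_⟩
  have hsnd : l[j.rev].2 = j := by
    have h : (l.map Prod.snd)[j.rev]'(by simp [hlen]) = j := by
      simp only [hl.map_snd]
      simp
      lia
    simpa using h
  have := hσ j.rev
  simp only [Fin.getElem_fin, List.getElem_map] at this
  simp only [Fin.getElem_fin] at hsnd
  rw [← hsnd]
  exact this

/-- For a suitable box `b` of the last tile, the agents can be matched with the boxes such that
every agent likes a tile in its box, or likes a degenerate tile and its box is empty. -/
theorem exists_perm_box_eq (hn : ¬ n + 1 ∣ n.factorial)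
    {A : Fin (n + 1) → Fin (n + 1) → Set (stdSimplex ℝ (Fin (n + 1)))}
    (hclosed : ∀ i j, IsClosed (A i j)) (hcov : ∀ j, (⋃ i, A i j) = Set.univ) :
    ∃ (z : stdSimplex ℝ (Fin (n + 1))) (b : Fin (n + 1)) (σ : Equiv.Perm (Fin (n + 1)))
      (t : Fin (n + 1) → Fin (n + 1)), ∀ j, z ∈ A (t j) j ∧
        (box b (t j) = σ j ∨ (z (t j) = 0 ∧ σ j ∈ emptyBoxes b z)) := by
  classical
  choose t ht using fun z j => Set.mem_iUnion.1 ((hcov j).symm ▸ Set.mem_univ z)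
  obtain ⟨pref, hpref⟩ : ∃ pref : Vertex (Fin (n + 1)) → Fin (n + 1),
      ∀ (z : stdSimplex ℝ (Fin (n + 1))) (j : Fin (n + 1)), z ∈ A (pref (z, j)) j := by
    refine ⟨fun x => if h : x.1 ∈ stdSimplex ℝ (Fin (n + 1)) ∧ x.2 < n + 1 then
      t ⟨x.1, h.1⟩ ⟨x.2, h.2⟩ else 0, fun z j => ?_⟩
    dsimp only
    rw [dif_pos ⟨z.2, j.2⟩]
    exact ht z j
  choose b σ p hdist hp using exists_perm_label_ne_zero hn pref
  let U : Ultrafilter ℕ := hyperfilter ℕ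
  obtain ⟨⟨b₀, σ₀, t₀⟩, hdata⟩ : ∃ D, ∀ᶠ m in U,
      (b m, σ m, fun j : Fin (n + 1) => pref (p m j, j)) = D := by
    obtain ⟨D, hD⟩ := (U.map fun m =>
      (b m, σ m, fun j : Fin (n + 1) => pref (p m j, j))).eq_pure_of_finite
    exact ⟨D, show {D} ∈ U.map _ from hD ▸ Set.mem_singleton D⟩
  obtain ⟨z, -, hz⟩ := (isCompact_univ (X := stdSimplex ℝ (Fin (n + 1)))).ultrafilter_le_nhds
    (U.map fun m => p m 0) (by simp)
  have hz : Tendsto (fun m => p m 0) U (𝓝 z) := hz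
  have hpz : ∀ j, Tendsto (fun m => p m j) U (𝓝 z) := by
    intro j
    refine hz.congr_dist ?_
    have : Tendsto (fun m : ℕ => ratio n ^ (m + 1)) U (𝓝 0) :=
      ((tendsto_pow_atTop_nhds_zero_of_lt_one (ratio_nonneg n) (ratio_lt_one n)).comp
        (tendsto_add_atTop_nat 1)).mono_left Nat.hyperfilter_le_atTop
    exact squeeze_zero (fun _ => dist_nonneg) (fun m => hdist m 0 j) this
  have hzero : ∀ i j, (∀ᶠ m in U, p m j i = 0) → z i = 0 := fun i j h =>
    tendsto_nhds_unique_of_eventuallyEq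
      (((continuous_apply i).comp continuous_subtype_val).continuousAt.tendsto.comp (hpz j))
      tendsto_const_nhds h
  refine ⟨z, b₀, σ₀, t₀, fun j => ⟨?_, ?_⟩⟩
  · refine (hclosed _ _).mem_of_tendsto (hpz j) (hdata.mono fun m hm => ?_)
    simp only [Prod.mk.injEq] at hm
    rw [← hm.2.2]
    exact hpref _ _
  · have : ∀ᶠ m in U, box b₀ (t₀ j) = σ₀ j ∨
        (p m j (t₀ j) = 0 ∧ σ₀ j ∈ emptyBoxes b₀ (p m j)) := by
      refine hdata.mono fun m hm => ?_
      simp only [Prod.mk.injEq] at hm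
      rw [← hm.1, ← hm.2.1, ← hm.2.2]
      exact (label_ne_zero (hp m j)).imp_left And.right
    rcases Ultrafilter.eventually_or.1 this with h | h
    · exact Or.inl h.exists.choose_spec
    · refine Or.inr ⟨hzero _ j (h.mono fun _ => And.left),
        mem_emptyBoxes.2 ⟨fun hi => ?_, fun hi => ?_⟩⟩
      · exact hzero _ j (h.mono fun _ h => (mem_emptyBoxes.1 h.2).1 hi)
      · exact hzero _ j (h.mono fun _ h => (mem_emptyBoxes.1 h.2).2 hi)

theorem eq_or_eq_of_box_eq {b s t : Fin (n + 1)} (h : box b s = box b t) (hst : s ≠ t) :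
    (s = Fin.last n ∧ t = b) ∨ (s = b ∧ t = Fin.last n) := by
  unfold box at h
  split_ifs at h with hs ht ht
  · exact (hst (hs.trans ht.symm)).elim
  · exact Or.inl ⟨hs, h.symm⟩
  · exact Or.inr ⟨h, ht⟩
  · exact (hst h).elim

theorem exists_envy_free_of_not_dvd (hn : ¬ n + 1 ∣ n.factorial)
    {A : Fin (n + 1) → Fin (n + 1) → Set (stdSimplex ℝ (Fin (n + 1)))}
    (hclosed : ∀ i j, IsClosed (A i j)) (hcov : ∀ j, (⋃ i, A i j) = Set.univ) :
    ∃ (z : stdSimplex ℝ (Fin (n + 1))) (π : Fin (n + 1) → Fin (n + 1)),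
      (∀ j, z ∈ A (π j) j) ∧ Set.InjOn π {j | 0 < z (π j)} ∧
      {i | 0 < z i ∧ i ∉ π '' Set.univ}.Subsingleton := by
  obtain ⟨z, b, σ, t, h⟩ := exists_perm_box_eq hn hclosed hcov
  refine ⟨z, t, fun j => (h j).1, fun i hi j hj hij => ?_, ?_⟩
  · have hbox : ∀ j, 0 < z (t j) → box b (t j) = σ j := fun j hj =>
      (h j).2.resolve_right fun h' => hj.ne' h'.1
    exact σ.injective (by rw [← hbox i hi, ← hbox j hj, hij])
  · have hdrop : ∀ i, 0 < z i → i ∉ t '' Set.univ →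
        ∃ j, (t j = Fin.last n ∧ i = b) ∨ (t j = b ∧ i = Fin.last n) := by
      intro i hi hit
      refine ⟨σ.symm (box b i), eq_or_eq_of_box_eq ?_ fun h => hit ⟨_, Set.mem_univ _, h⟩⟩
      rcases (h (σ.symm (box b i))).2 with h | ⟨-, h⟩
      · rw [h, Equiv.apply_symm_apply]
      · rw [Equiv.apply_symm_apply] at h
        exact (hi.ne' (eq_zero_of_box_mem_emptyBoxes h)).elim
    rintro i ⟨hi, hit⟩ i' ⟨hi', hit'⟩
    obtain ⟨j, ⟨hj, rfl⟩ | ⟨hj, rfl⟩⟩ := hdrop i hi hit <;>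
      obtain ⟨j', ⟨hj', rfl⟩ | ⟨hj', rfl⟩⟩ := hdrop i' hi' hit'
    · rfl
    · exact (hit' ⟨j, Set.mem_univ _, hj⟩).elim
    · exact (hit' ⟨j, Set.mem_univ _, hj⟩).elim
    · rfl

theorem not_dvd_factorial_pred {r : ℕ} (hr : r.Prime ∨ r = 4) : ¬ r ∣ (r - 1).factorial := by
  rcases hr with hr | rfl
  · rw [hr.dvd_factorial]
    have := hr.pos
    lia
  · decide

end Limit

end EnvyFreeDivision

/-- Envy-free division dropping at most one tile, for `r` prime or `r = 4`:
closed covering `P_dte` preferences such that a short non-degenerate last tile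
is never preferred admit an envy-free division in which at most one
non-degenerate tile is dropped.  Here `ilast` is the index of the last tile. -/
theorem envy_free_drop_at_most_one (r : ℕ) (hr : r.Prime ∨ r = 4)
    (ilast : Fin r) (hilast : (ilast : ℕ) = r - 1)
    (A : Fin r → Fin r → Set (stdSimplex ℝ (Fin r)))
    (hclosed : ∀ i j, IsClosed (A i j))
    (hcov : ∀ j, (⋃ i, A i j) = Set.univ)
    (hdte : ∀ (j : Fin r) (z : stdSimplex ℝ (Fin r)) (i i' : Fin r),
      (z : Fin r → ℝ) i = 0 → (z : Fin r → ℝ) i' = 0 →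
      (z ∈ A i j ↔ z ∈ A i' j))
    (hshort : ∃ ε > (0 : ℝ), ∀ (j : Fin r) (z : stdSimplex ℝ (Fin r)),
      0 < (z : Fin r → ℝ) ilast → (z : Fin r → ℝ) ilast < ε → z ∉ A ilast j) :
    ∃ (z : stdSimplex ℝ (Fin r)) (π : Fin r → Fin r),
      (∀ j, z ∈ A (π j) j) ∧
      Set.InjOn π {j | 0 < (z : Fin r → ℝ) (π j)} ∧
      {i | 0 < (z : Fin r → ℝ) i ∧ i ∉ π '' Set.univ}.Subsingleton := by
  obtain ⟨n, rfl⟩ : ∃ n, r = n + 1 := Nat.exists_eq_succ_of_ne_zero (Fin.pos ilast).ne'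
  exact EnvyFreeDivision.exists_envy_free_of_not_dvd
    (by simpa using EnvyFreeDivision.not_dvd_factorial_pred hr) hclosed hcov
end

section
/- (Envy-free division on the chessboard configuration space Δ_{r,2r-1}.) Let r be a prime power. Let C : Fin r → Fin r → Set C₂ be a new-style preference matrix on the configuration space C₂ that is closed, covering, and equivariant. Then there exists an envy-free division: ⋂ i, C i i is nonempty. In other words, there is a cut of [0,1] into 2r−1 tiles of which at least r−1 are degenerate, and an admissible allocation of the non-degenerate tiles into r boxes with at most one tile per box, such that player j prefers the content of box j for every j. -/
/-- The configuration space `C₂`, the geometric realization of the chessboard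
complex `Δ_{r,2r-1}`: matrices with nonnegative entries summing to `1`,
at most one nonzero entry in each row, and at most one nonzero entry in each
column. -/
def ConfC2 (r : ℕ) : Set (Fin r → Fin (2 * r - 1) → ℝ) :=
  {M | (∀ b t, 0 ≤ M b t) ∧ (∑ b, ∑ t, M b t) = 1 ∧
    (∀ b t t', M b t ≠ 0 → M b t' ≠ 0 → t = t') ∧
    (∀ t b b', M b t ≠ 0 → M b' t ≠ 0 → b = b')}

/-- The action of `σ ∈ S_r` on configuration spaces of matrices,
permuting the rows (boxes). -/
def rowPerm {r m : ℕ} (σ : Equiv.Perm (Fin r)) (M : Fin r → Fin m → ℝ) :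
    Fin r → Fin m → ℝ :=
  fun b t => M (σ⁻¹ b) t

namespace Chessboard

section OrderedChains

variable (R : Type*) [CommRing R] {E E' : Type*}

/-- Prepending a vertex to every word of an ordered chain. -/
noncomputable def consL (v : E) : (List E →₀ R) →ₗ[R] (List E →₀ R) :=
  Finsupp.lmapDomain R R (List.cons v)

/-- The augmented boundary of a word. -/
noncomputable def bdWord : List E → (List E →₀ R)
  | [] => 0
  | v :: l => Finsupp.single l 1 - consL R v (bdWord l)

/-- The augmented boundary of an ordered chain. -/
noncomputable def bd : (List E →₀ R) →ₗ[R] (List E →₀ R) :=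
  Finsupp.linearCombination R (bdWord R)

/-- The map induced on ordered chains by a map of vertices. -/
noncomputable def mapL (f : E → E') : (List E →₀ R) →ₗ[R] (List E' →₀ R) :=
  Finsupp.lmapDomain R R (List.map f)

/-- The prism between the images of a word under two maps. -/
noncomputable def prismWord (f g : E → E') : List E → (List E' →₀ R)
  | [] => 0
  | v :: l => consL R (f v) (consL R (g v) (Finsupp.single (l.map g) 1)) -
      consL R (f v) (prismWord f g l)

/-- The prism operator between two maps of vertices. -/
noncomputable def prism (f g : E → E') : (List E →₀ R) →ₗ[R] (List E' →₀ R) :=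
  Finsupp.linearCombination R (prismWord R f g)

variable {R}

@[simp] lemma consL_single (v : E) (l : List E) (a : R) :
    consL R v (Finsupp.single l a) = Finsupp.single (v :: l) a := by
  simp [consL]

@[simp] lemma mapL_single (f : E → E') (l : List E) (a : R) :
    mapL R f (Finsupp.single l a) = Finsupp.single (l.map f) a := by
  simp [mapL]

@[simp] lemma bd_single (l : List E) : bd R (Finsupp.single l 1) = bdWord R l := by
  simp [bd]

@[simp] lemma prism_single (f g : E → E') (l : List E) :
    prism R f g (Finsupp.single l 1) = prismWord R f g l := by
  simp [prism]

lemma bd_consL (v : E) (x : List E →₀ R) : bd R (consL R v x) = x - consL R v (bd R x) := by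
  have : bd R ∘ₗ consL R v = LinearMap.id - consL R v ∘ₗ bd R := by
    ext l : 2
    simp [bdWord]
  exact LinearMap.congr_fun this x

lemma prism_consL (f g : E → E') (v : E) (x : List E →₀ R) :
    prism R f g (consL R v x) =
      consL R (f v) (consL R (g v) (mapL R g x)) - consL R (f v) (prism R f g x) := by
  have : prism R f g ∘ₗ consL R v = consL R (f v) ∘ₗ consL R (g v) ∘ₗ mapL R g -
      consL R (f v) ∘ₗ prism R f g := by
    ext l : 2
    simp [prismWord]
  exact LinearMap.congr_fun this x

lemma mapL_consL (f : E → E') (v : E) (x : List E →₀ R) :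
    mapL R f (consL R v x) = consL R (f v) (mapL R f x) := by
  have : mapL R f ∘ₗ consL R v = consL R (f v) ∘ₗ mapL R f := by
    ext l : 2
    simp
  exact LinearMap.congr_fun this x

lemma bd_mapL (f : E → E') (x : List E →₀ R) : bd R (mapL R f x) = mapL R f (bd R x) := by
  have : bd R ∘ₗ mapL R f = mapL R f ∘ₗ bd R := by
    ext l : 2
    simp only [LinearMap.comp_apply, Finsupp.lsingle_apply, mapL_single, bd_single]
    induction l with
    | nil => simp [bdWord]
    | cons v l ih => simp [bdWord, ih, mapL_consL]
  exact LinearMap.congr_fun this x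

lemma bd_prism (f g : E → E') (x : List E →₀ R) :
    bd R (prism R f g x) = mapL R g x - mapL R f x - prism R f g (bd R x) := by
  have : bd R ∘ₗ prism R f g = mapL R g - mapL R f - prism R f g ∘ₗ bd R := by
    ext l : 2
    simp only [LinearMap.comp_apply, LinearMap.sub_apply, Finsupp.lsingle_apply, mapL_single,
      bd_single, prism_single]
    induction l with
    | nil => simp [bdWord, prismWord]
    | cons v l ih =>
      have h : mapL R g (bdWord R l) = bdWord R (l.map g) := by
        rw [← bd_single, ← bd_mapL, mapL_single, bd_single]
      simp only [prismWord, bdWord, map_sub, bd_consL, prism_consL, ih, prism_single, h,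
        consL_single, bd_single, List.map_cons]
      abel
  exact LinearMap.congr_fun this x

end OrderedChains

section SmallChains

/-- The words with letters in `A` at pairwise distance at most `δ`. -/
def smallWords {E : Type*} [PseudoMetricSpace E] (A : Set E) (δ : ℝ) : Set (List E) :=
  {l | (∀ x ∈ l, x ∈ A) ∧ ∀ x ∈ l, ∀ y ∈ l, dist x y ≤ δ}

lemma smallWords_mono {E : Type*} [PseudoMetricSpace E] {A A' : Set E} {δ δ' : ℝ}
    (hA : A ⊆ A') (hδ : δ ≤ δ') :
    smallWords A δ ⊆ smallWords A' δ' :=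
  fun _ hl => ⟨fun x hx => hA (hl.1 x hx), fun x hx y hy => (hl.2 x hx y hy).trans hδ⟩

variable {R : Type*} [CommRing R] {E : Type*} [NormedAddCommGroup E] [NormedSpace ℝ E]

lemma consL_mem_supported {E : Type*} {v : E} {S T : Set (List E)} (h : ∀ l ∈ S, v :: l ∈ T)
    {x : List E →₀ R} (hx : x ∈ Finsupp.supported R R S) :
    consL R v x ∈ Finsupp.supported R R T := by
  classical
  rw [Finsupp.mem_supported] at hx ⊢
  intro w hw
  obtain ⟨l, hl, rfl⟩ := Finset.mem_image.1 (Finsupp.mapDomain_support hw)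
  exact h l (hx hl)

lemma prismWord_mem_supported {E E' : Type*} (f g : E → E') (l : List E) :
    prismWord R f g l ∈
      Finsupp.supported R R {w : List E' | ∀ y ∈ w, ∃ x ∈ l, y = f x ∨ y = g x} := by
  induction l with
  | nil => simp [prismWord]
  | cons v l ih =>
    refine Submodule.sub_mem _ ?_ (consL_mem_supported ?_ ih)
    · rw [consL_single, consL_single]
      refine Finsupp.single_mem_supported R _ ?_
      intro y hy
      simp only [List.mem_cons, List.mem_map] at hy
      grind
    · intro w hw y hy
      simp only [Set.mem_ofPred_eq, List.mem_cons] at *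
      grind

lemma linearCombination_mem_supported {ι κ : Type*} {S : Set ι} {T : Set κ} {F : ι → κ →₀ R}
    (h : ∀ i ∈ S, F i ∈ Finsupp.supported R R T) {x : ι →₀ R}
    (hx : x ∈ Finsupp.supported R R S) :
    Finsupp.linearCombination R F x ∈ Finsupp.supported R R T := by
  rw [Finsupp.linearCombination_apply]
  exact Submodule.sum_mem _ fun i hi => Submodule.smul_mem _ _ (h i (hx hi))

lemma exists_small_filling {A : Set E} (hA : Convex ℝ A) (hne : A.Nonempty)
    (hb : Bornology.IsBounded A) {δ η : ℝ} (hδ : 0 ≤ δ) (hη : 0 < η) {z : List E →₀ R}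
    (hz : z ∈ Finsupp.supported R R (smallWords A δ)) (hbd : bd R z = 0) :
    ∃ c ∈ Finsupp.supported R R (smallWords A (δ + η)), bd R c = z := by
  obtain ⟨p, hp⟩ := hne
  obtain ⟨D, hD⟩ := Metric.isBounded_iff.1 hb
  have hD0 : 0 ≤ D := by simpa using hD hp hp
  obtain ⟨M, hM⟩ := exists_nat_gt (D / η)
  have hM0 : (0 : ℝ) < M := (div_nonneg hD0 hη.le).trans_lt hM
  have hDM : D / M < η := by
    rw [div_lt_iff₀ hη] at hM
    rw [div_lt_iff₀ hM0]; linarith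
  set h : ℕ → E → E := fun k => AffineMap.homothety p (1 - (k / M : ℝ)) with hh
  have h0 : h 0 = id := by
    ext x; simp [hh]
  have hlast : ∀ x, h M x = p := by
    intro x; simp [hh, div_self hM0.ne']
  have hmem : ∀ k ≤ M, ∀ x ∈ A, h k x ∈ A := by
    intro k hk x hx
    have h1 : (k / M : ℝ) ≤ 1 := by rw [div_le_one hM0]; exact_mod_cast hk
    have h2 : (0 : ℝ) ≤ k / M := by positivity
    simp only [hh, AffineMap.homothety_eq_lineMap]
    exact hA.lineMap_mem hp hx ⟨by linarith, by linarith⟩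
  have hdist : ∀ k ≤ M, ∀ x y, dist (h k x) (h k y) ≤ dist x y := by
    intro k hk x y
    have h1 : (k / M : ℝ) ≤ 1 := by rw [div_le_one hM0]; exact_mod_cast hk
    have h2 : (0 : ℝ) ≤ k / M := by positivity
    have e : h k x - h k y = (1 - (k / M : ℝ)) • (x - y) := by
      simp only [hh, AffineMap.homothety_apply, vsub_eq_sub, vadd_eq_add]; module
    rw [dist_eq_norm, e, norm_smul, Real.norm_of_nonneg (by linarith), ← dist_eq_norm]
    exact mul_le_of_le_one_left dist_nonneg (by linarith)
  have hstep : ∀ k, ∀ x ∈ A, dist (h k x) (h (k + 1) x) ≤ η := by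
    intro k x hx
    have e : h k x - h (k + 1) x = (1 / M : ℝ) • (x - p) := by
      simp only [hh, AffineMap.homothety_apply, vsub_eq_sub, vadd_eq_add]
      push_cast
      rw [add_div]; module
    rw [dist_eq_norm, e, norm_smul, Real.norm_of_nonneg (by positivity), ← dist_eq_norm]
    have := hD hx hp
    calc 1 / M * dist x p ≤ 1 / M * D := by gcongr
      _ = D / M := by ring
      _ ≤ η := hDM.le
  refine ⟨consL R p (mapL R (h M) z) - ∑ k ∈ Finset.range M, prism R (h k) (h (k + 1)) z, ?_, ?_⟩
  · refine Submodule.sub_mem _ ?_ (Submodule.sum_mem _ fun k hk => ?_)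
    · classical
      rw [Finsupp.mem_supported]
      intro w hw
      obtain ⟨w, hw', rfl⟩ := Finset.mem_image.1 (Finsupp.mapDomain_support hw)
      obtain ⟨w, -, rfl⟩ := Finset.mem_image.1 (Finsupp.mapDomain_support hw')
      have : ∀ x ∈ p :: w.map (h M), x = p := by
        intro x hx
        simp only [List.mem_cons, List.mem_map, hlast] at hx
        grind
      refine ⟨fun x hx => this x hx ▸ hp, fun x hx y hy => ?_⟩
      rw [this x hx, this y hy, dist_self]; positivity
    · have hk := Finset.mem_range.1 hk
      refine linearCombination_mem_supported (fun l hl => ?_) hz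
      refine Finsupp.supported_mono ?_ (prismWord_mem_supported _ _ l)
      intro w hw
      have hcross : ∀ x ∈ l, ∀ y ∈ l, dist (h k x) (h (k + 1) y) ≤ δ + η := fun x hx y hy =>
        (dist_triangle _ (h k y) _).trans
          (add_le_add ((hdist k hk.le x y).trans (hl.2 x hx y hy)) (hstep k y (hl.1 y hy)))
      have hsame : ∀ j ≤ M, ∀ x ∈ l, ∀ y ∈ l, dist (h j x) (h j y) ≤ δ + η :=
        fun j hj x hx y hy => (hdist j hj x y).trans ((hl.2 x hx y hy).trans (by linarith))
      refine ⟨fun y hy => ?_, fun y hy y' hy' => ?_⟩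
      · obtain ⟨x, hx, rfl | rfl⟩ := hw y hy
        exacts [hmem k hk.le x (hl.1 x hx), hmem (k + 1) hk x (hl.1 x hx)]
      · obtain ⟨x, hx, rfl | rfl⟩ := hw y hy <;> obtain ⟨x', hx', rfl | rfl⟩ := hw y' hy'
        · exact hsame k hk.le x hx x' hx'
        · exact hcross x hx x' hx'
        · rw [dist_comm]; exact hcross x' hx' x hx
        · exact hsame (k + 1) hk x hx x' hx'
  · have hid : mapL R (h 0) z = z := by
      rw [h0]; simp [mapL]
    simp only [map_sub, map_sum, bd_consL, bd_mapL, bd_prism, hbd, map_zero, sub_zero]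
    rw [Finset.sum_range_sub (fun k => mapL R (h k) z), hid]
    abel

end SmallChains

section SubsetChains

variable (R : Type*) [CommRing R] {V : Type*} [LinearOrder V]

/-- The sign of the position of `t` in the ordered set `B`. -/
def posSign (t : V) (B : Finset V) : R := (-1) ^ (B.filter (· < t)).card

/-- The augmented boundary of a simplex, given by its set of vertices. -/
noncomputable def faceSum (B : Finset V) : Finset V →₀ R :=
  ∑ t ∈ B, posSign R t B • Finsupp.single (B.erase t) 1

/-- The augmented boundary of chains indexed by vertex sets. -/
noncomputable def face : (Finset V →₀ R) →ₗ[R] (Finset V →₀ R) :=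
  Finsupp.linearCombination R (faceSum R)

/-- The exterior product with a vertex, on basis elements. -/
noncomputable def coneSet (t : V) (B : Finset V) : Finset V →₀ R :=
  if t ∈ B then 0 else posSign R t B • Finsupp.single (insert t B) 1

/-- The exterior product with a vertex. -/
noncomputable def cone (t : V) : (Finset V →₀ R) →ₗ[R] (Finset V →₀ R) :=
  Finsupp.linearCombination R (coneSet R t)

/-- The exterior product of the letters of a word. -/
noncomputable def wedgeWord : List V → (Finset V →₀ R)
  | [] => Finsupp.single ∅ 1
  | t :: l => cone R t (wedgeWord l)

/-- The exterior product of letters, as a map on ordered chains. -/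
noncomputable def wedge : (List V →₀ R) →ₗ[R] (Finset V →₀ R) :=
  Finsupp.linearCombination R (wedgeWord R)

variable {R}

@[simp] lemma face_single (B : Finset V) : face R (Finsupp.single B 1) = faceSum R B := by
  simp [face]

@[simp] lemma cone_single (t : V) (B : Finset V) :
    cone R t (Finsupp.single B 1) = coneSet R t B := by
  simp [cone]

@[simp] lemma wedge_single (l : List V) : wedge R (Finsupp.single l 1) = wedgeWord R l := by
  simp [wedge]

lemma posSign_mul_self (t : V) (B : Finset V) : posSign R t B * posSign R t B = 1 := by
  rw [posSign, ← pow_add, ← two_mul, pow_mul]; simp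

lemma posSign_erase_of_le {t u : V} (h : t ≤ u) (B : Finset V) :
    posSign R t (B.erase u) = posSign R t B := by
  unfold posSign
  congr 2
  ext v
  simp only [Finset.mem_filter, Finset.mem_erase]
  grind

lemma posSign_erase_of_lt {t u : V} (h : u < t) {B : Finset V} (hu : u ∈ B) :
    posSign R t (B.erase u) = -posSign R t B := by
  unfold posSign
  have : B.filter (· < t) = insert u ((B.erase u).filter (· < t)) := by
    ext v
    simp only [Finset.mem_filter, Finset.mem_erase, Finset.mem_insert]
    grind
  rw [this, Finset.card_insert_of_notMem (by simp), pow_succ]; ring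

lemma face_cone (t : V) (x : Finset V →₀ R) :
    face R (cone R t x) = x - cone R t (face R x) := by
  have : face R ∘ₗ cone R t = LinearMap.id - cone R t ∘ₗ face R := by
    ext B : 2
    simp only [LinearMap.comp_apply, LinearMap.sub_apply, Finsupp.lsingle_apply, face_single,
      cone_single, LinearMap.id_apply]
    by_cases ht : t ∈ B
    · have h1 : coneSet R t B = 0 := by simp [coneSet, ht]
      have h2 : cone R t (faceSum R B) = Finsupp.single B 1 := by
        simp only [faceSum, map_sum, map_smul, cone_single]
        rw [Finset.sum_eq_single_of_mem t ht]
        · simp only [coneSet, Finset.notMem_erase, if_false, posSign_erase_of_le le_rfl,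
            smul_smul, posSign_mul_self, one_smul, Finset.insert_erase ht]
        · intro u hu hut
          simp [coneSet, ht, hut.symm]
      rw [h1, h2]; simp
    · have h1 : coneSet R t B = posSign R t B • Finsupp.single (insert t B) 1 := by
        simp [coneSet, ht]
      have h3 : posSign R t (insert t B) = posSign R t B := by
        rw [← posSign_erase_of_le le_rfl (insert t B), Finset.erase_insert ht]
      rw [h1, map_smul, face_single, faceSum, Finset.sum_insert ht, Finset.erase_insert ht,
        smul_add, smul_smul, h3, posSign_mul_self, one_smul, sub_eq_add_neg, add_right_inj]
      simp only [faceSum, map_sum, map_smul, cone_single, Finset.smul_sum, smul_smul,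
        ← Finset.sum_neg_distrib]
      refine Finset.sum_congr rfl fun u hu => ?_
      have hne : t ≠ u := by rintro rfl; exact ht hu
      have h4 : t ∉ B.erase u := fun h => ht (Finset.mem_of_mem_erase h)
      rw [coneSet, if_neg h4, Finset.erase_insert_of_ne hne, smul_smul, ← neg_smul]
      congr 1
      have h5 : posSign R u B = posSign R u ((insert t B).erase t) := by
        rw [Finset.erase_insert ht]
      rcases lt_or_gt_of_ne hne with h | h
      · rw [h5, posSign_erase_of_lt h (Finset.mem_insert_self t B), posSign_erase_of_le h.le]
        ring
      · rw [h5, posSign_erase_of_le h.le, posSign_erase_of_lt h hu]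
        ring
  exact LinearMap.congr_fun this x

lemma face_face (x : Finset V →₀ R) : face R (face R x) = 0 := by
  have : face R ∘ₗ face (V := V) R = 0 := by
    ext B : 2
    simp only [LinearMap.comp_apply, LinearMap.zero_apply, Finsupp.lsingle_apply]
    induction B using Finset.induction_on with
    | empty => simp [faceSum]
    | insert t B ht ih =>
      have h : (Finsupp.single (insert t B) 1 : Finset V →₀ R) =
          posSign R t B • cone R t (Finsupp.single B 1) := by
        rw [cone_single, coneSet, if_neg ht, smul_smul, posSign_mul_self, one_smul]
      rw [h, map_smul, map_smul, face_cone, map_sub, face_cone, ih]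
      simp
  exact LinearMap.congr_fun this x

lemma face_wedge (x : List V →₀ R) : face R (wedge R x) = wedge R (bd R x) := by
  have hw : ∀ (v : V) (y : List V →₀ R), wedge R (consL R v y) = cone R v (wedge R y) := by
    intro v y
    have : wedge R ∘ₗ consL R v = cone R v ∘ₗ wedge R := by
      ext l : 2
      simp [wedgeWord]
    exact LinearMap.congr_fun this y
  have : face R ∘ₗ wedge R = wedge R ∘ₗ bd (E := V) R := by
    ext l : 2
    simp only [LinearMap.comp_apply, Finsupp.lsingle_apply, wedge_single, bd_single]
    induction l with
    | nil => simp [wedgeWord, bdWord, faceSum]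
    | cons v l ih => simp [wedgeWord, bdWord, face_cone, ih, hw]
  exact LinearMap.congr_fun this x

lemma wedgeWord_eq_smul (l : List V) :
    ∃ a : R, wedgeWord R l = a • Finsupp.single l.toFinset 1 := by
  induction l with
  | nil => exact ⟨1, by simp [wedgeWord]⟩
  | cons t l ih =>
    obtain ⟨a, ha⟩ := ih
    rw [wedgeWord, ha, map_smul, cone_single, coneSet]
    split_ifs with h
    · exact ⟨0, by simp⟩
    · exact ⟨a * posSign R t l.toFinset, by rw [smul_smul, List.toFinset_cons]⟩

lemma toFinset_eq_of_wedgeWord_apply_ne_zero {l : List V} {B : Finset V}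
    (h : wedgeWord R l B ≠ 0) : l.toFinset = B := by
  obtain ⟨a, ha⟩ := wedgeWord_eq_smul (R := R) l
  by_contra hne
  rw [ha] at h
  simp [hne] at h

end SubsetChains

section Supertrace

variable {R : Type*} [CommRing R] {V : Type*} [LinearOrder V]

/-- The parity operator. -/
noncomputable def parity : (Finset V →₀ R) →ₗ[R] (Finset V →₀ R) :=
  Finsupp.linearCombination R fun B => (-1 : R) ^ B.card • Finsupp.single B 1

/-- The projection onto chains with vertices in `Q`. -/
noncomputable def restrictTo (Q : Finset V) : (Finset V →₀ R) →ₗ[R] (Finset V →₀ R) :=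
  Finsupp.linearCombination R fun B => if B ⊆ Q then Finsupp.single B 1 else 0

lemma parity_face : (parity : (Finset V →₀ R) →ₗ[R] _) ∘ₗ face R = -(face R ∘ₗ parity) := by
  ext B : 2
  simp only [LinearMap.comp_apply, LinearMap.neg_apply, Finsupp.lsingle_apply, face_single, parity,
    Finsupp.linearCombination_single, one_smul, map_smul, faceSum, map_sum, Finset.smul_sum,
    ← Finset.sum_neg_distrib]
  refine Finset.sum_congr rfl fun t ht => ?_
  rw [← Finset.card_erase_add_one ht, pow_succ]
  module

lemma parity_apply (x : Finset V →₀ R) (B : Finset V) :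
    parity x B = (-1) ^ B.card * x B := by
  have : Finsupp.lapply B ∘ₗ parity = (-1 : R) ^ B.card • Finsupp.lapply (R := R) B := by
    ext A : 2
    by_cases h : A = B <;> simp [parity, h]
  exact LinearMap.congr_fun this x

lemma restrictTo_comp_parity (Q : Finset V) :
    (restrictTo Q : (Finset V →₀ R) →ₗ[R] _) ∘ₗ parity = parity ∘ₗ restrictTo Q := by
  ext B : 2
  simp only [LinearMap.comp_apply, Finsupp.lsingle_apply, parity, restrictTo,
    Finsupp.linearCombination_single, one_smul, map_smul]
  split_ifs <;> simp

lemma restrictTo_apply_of_mem {Q : Finset V} {x : Finset V →₀ R}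
    (hx : x ∈ Finsupp.supported R R {B | B ⊆ Q}) : restrictTo Q x = x := by
  rw [restrictTo, Finsupp.linearCombination_apply]
  conv_rhs => rw [← Finsupp.sum_single x]
  refine Finsupp.sum_congr fun B hB => ?_
  have : B ⊆ Q := hx hB
  simp [this]

lemma face_mem_supported {Q : Finset V} {x : Finset V →₀ R}
    (hx : x ∈ Finsupp.supported R R {B | B ⊆ Q}) :
    face R x ∈ Finsupp.supported R R {B | B ⊆ Q} := by
  refine linearCombination_mem_supported (fun B hB => ?_) hx
  exact Submodule.sum_mem _ fun t _ => Submodule.smul_mem _ _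
    (Finsupp.single_mem_supported R _ ((Finset.erase_subset _ _).trans hB))

lemma cone_mem_supported {Q : Finset V} {q : V} (hq : q ∈ Q) {x : Finset V →₀ R}
    (hx : x ∈ Finsupp.supported R R {B | B ⊆ Q}) :
    cone R q x ∈ Finsupp.supported R R {B | B ⊆ Q} := by
  refine linearCombination_mem_supported (fun B hB => ?_) hx
  rw [coneSet]
  split_ifs
  · exact Submodule.zero_mem _
  · exact Submodule.smul_mem _ _
      (Finsupp.single_mem_supported R _ (Finset.insert_subset hq hB))

lemma restrictTo_mem_supported (Q : Finset V) (x : Finset V →₀ R) :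
    restrictTo Q x ∈ Finsupp.supported R R {B | B ⊆ Q} := by
  rw [restrictTo, Finsupp.linearCombination_apply]
  refine Submodule.sum_mem _ fun B _ => Submodule.smul_mem _ _ ?_
  split_ifs with h
  exacts [Finsupp.single_mem_supported R _ h, Submodule.zero_mem _]

/-- The Lefschetz number of an augmented chain endomorphism of a nonempty simplex vanishes. -/
lemma supertrace_eq_zero [Fintype V] {Q : Finset V} (hQ : Q.Nonempty)
    {F : Finset V → (Finset V →₀ R)}
    (hF : ∀ B ⊆ Q, F B ∈ Finsupp.supported R R {B | B ⊆ Q})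
    (hface : ∀ B ⊆ Q, face R (F B) = ∑ t ∈ B, posSign R t B • F (B.erase t)) :
    ∑ B ∈ Q.powerset, (-1 : R) ^ B.card * F B B = 0 := by
  obtain ⟨q, hq⟩ := hQ
  set π : (Finset V →₀ R) →ₗ[R] (Finset V →₀ R) := restrictTo Q with hπ
  set G : (Finset V →₀ R) →ₗ[R] (Finset V →₀ R) := Finsupp.linearCombination R F ∘ₗ π with hG
  have hGmem : ∀ x, G x ∈ Finsupp.supported R R {B | B ⊆ Q} := fun x =>
    linearCombination_mem_supported hF (restrictTo_mem_supported Q x)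
  have hπid : ∀ x ∈ Finsupp.supported R R {B | B ⊆ Q}, π x = x :=
    fun x hx => restrictTo_apply_of_mem hx
  have hπm : ∀ x, π x ∈ Finsupp.supported R R {B | B ⊆ Q} := restrictTo_mem_supported Q
  have hGπ : ∀ x, G (π x) = G x := fun x => by
    simp only [hG, LinearMap.comp_apply, hπid _ (hπm x)]
  have hGF : ∀ B ⊆ Q, G (Finsupp.single B 1) = F B := fun B hB => by
    simp only [hG, LinearMap.comp_apply, hπid _ (Finsupp.single_mem_supported R _ hB)]
    simp
  have hG0 : ∀ B, ¬B ⊆ Q → G (Finsupp.single B 1) = 0 := fun B hB => by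
    simp [hG, hπ, restrictTo, hB]
  have hchain : face R ∘ₗ G = G ∘ₗ face R ∘ₗ π := by
    ext B : 2
    simp only [hG, LinearMap.comp_apply, Finsupp.lsingle_apply]
    rw [hπid _ (face_mem_supported (hπm _))]
    by_cases hB : B ⊆ Q
    · rw [hπid _ (Finsupp.single_mem_supported R _ hB)]
      simp [faceSum, hface B hB]
    · have : π (Finsupp.single B 1) = 0 := by simp [hπ, restrictTo, hB]
      rw [this]; simp
  have h1 : parity ∘ₗ G = parity ∘ₗ face R ∘ₗ G ∘ₗ cone R q ∘ₗ π +
      (parity ∘ₗ G ∘ₗ cone R q) ∘ₗ (face R ∘ₗ π) := by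
    refine LinearMap.ext fun x => ?_
    have e := face_cone q (π x)
    have e2 : face R (G (cone R q (π x))) = G (face R (cone R q (π x))) := by
      have := LinearMap.congr_fun hchain (cone R q (π x))
      simp only [LinearMap.comp_apply] at this
      rwa [hπid _ (cone_mem_supported hq (hπm x))] at this
    simp only [LinearMap.comp_apply, LinearMap.add_apply]
    rw [e2, e, ← map_add, ← map_add, sub_add_cancel, hGπ]
  clear_value G π
  have h2 : LinearMap.trace R _ ((parity ∘ₗ G ∘ₗ cone R q) ∘ₗ (face R ∘ₗ π)) =
      -LinearMap.trace R _ (parity ∘ₗ face R ∘ₗ G ∘ₗ cone R q ∘ₗ π) := by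
    rw [LinearMap.trace_comp_comm', ← map_neg]
    have e1 : (face R ∘ₗ π) ∘ₗ (parity ∘ₗ G ∘ₗ cone R q) =
        π ∘ₗ (face R ∘ₗ parity ∘ₗ G ∘ₗ cone R q) := by
      refine LinearMap.ext fun x => ?_
      have hm : parity (G (cone R q x)) ∈ Finsupp.supported R R {B | B ⊆ Q} := by
        rw [← hπid _ (hGmem _)]
        have := LinearMap.congr_fun (restrictTo_comp_parity (R := R) Q) (G (cone R q x))
        simp only [LinearMap.comp_apply] at this
        rw [hπ, ← this, ← hπ]
        exact hπm _
      simp only [LinearMap.comp_apply]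
      rw [hπid _ hm, hπid _ (face_mem_supported hm)]
    rw [e1, LinearMap.trace_comp_comm']
    refine congrArg _ (LinearMap.ext fun x => ?_)
    have := LinearMap.congr_fun (parity_face (R := R)) (G (cone R q (π x)))
    simp only [LinearMap.comp_apply, LinearMap.neg_apply] at this ⊢
    rw [this, neg_neg]
  have h3 : LinearMap.trace R _ (parity ∘ₗ G) = 0 := by
    rw [h1, map_add, h2, add_neg_cancel]
  rw [LinearMap.trace_eq_matrix_trace R (Finsupp.basisSingleOne (R := R)), Matrix.trace] at h3
  rw [← h3, ← Finset.sum_subset (Finset.subset_univ Q.powerset)]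
  · refine Finset.sum_congr rfl fun B hB => ?_
    simp [LinearMap.toMatrix_apply, parity_apply, hGF B (Finset.mem_powerset.1 hB)]
  · intro B _ hB
    simp [LinearMap.toMatrix_apply, hG0 B (fun h => hB (Finset.mem_powerset.2 h))]

end Supertrace

section FineChains

variable {V : Type*} [Fintype V]

/-- The face of the standard simplex spanned by the vertices in `B`. -/
def simplexFace (B : Finset V) : Set (V → ℝ) :=
  {x | (∀ t, 0 ≤ x t) ∧ ∑ t, x t = 1 ∧ ∀ t, t ∉ B → x t = 0}

lemma simplexFace_mono {B Q : Finset V} (h : B ⊆ Q) : simplexFace B ⊆ simplexFace Q :=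
  fun _ hx => ⟨hx.1, hx.2.1, fun t ht => hx.2.2 t (fun hB => ht (h hB))⟩

lemma simplexFace_subset_stdSimplex (B : Finset V) : simplexFace B ⊆ stdSimplex ℝ V :=
  fun _ hx => ⟨hx.1, hx.2.1⟩

lemma convex_simplexFace (B : Finset V) : Convex ℝ (simplexFace B) := by
  intro x hx y hy a b ha hb hab
  have h := convex_stdSimplex ℝ V (simplexFace_subset_stdSimplex B hx)
    (simplexFace_subset_stdSimplex B hy) ha hb hab
  refine ⟨h.1, h.2, fun t ht => ?_⟩
  simp [hx.2.2 t ht, hy.2.2 t ht]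

lemma simplexFace_nonempty {B : Finset V} (hB : B.Nonempty) : (simplexFace B).Nonempty := by
  classical
  obtain ⟨t, ht⟩ := hB
  refine ⟨Pi.single t 1, fun u => ?_, by simp, fun u hu => ?_⟩
  · by_cases h : u = t
    · subst h; simp
    · simp [h]
  · exact Pi.single_eq_of_ne (by rintro rfl; exact hu ht) _

variable (R : Type*) [CommRing R] [LinearOrder V]

lemma exists_fine_chain_map {δ : ℝ} (hδ : 0 < δ) :
    ∃ c : Finset V → (List (V → ℝ) →₀ R), c ∅ = Finsupp.single [] 1 ∧
      (∀ B, bd R (c B) = ∑ t ∈ B, posSign R t B • c (B.erase t)) ∧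
      ∀ B, c B ∈ Finsupp.supported R R (smallWords (simplexFace B) δ) := by
  set η : ℝ := δ / (Fintype.card V + 1) with hη
  have hη0 : 0 < η := by positivity
  suffices H : ∀ n : ℕ, ∃ c : Finset V → (List (V → ℝ) →₀ R), c ∅ = Finsupp.single [] 1 ∧
      ∀ B : Finset V, B.card ≤ n → bd R (c B) = ∑ t ∈ B, posSign R t B • c (B.erase t) ∧
        c B ∈ Finsupp.supported R R (smallWords (simplexFace B) (n * η)) by
    obtain ⟨c, h0, hc⟩ := H (Fintype.card V)
    refine ⟨c, h0, fun B => (hc B B.card_le_univ).1, fun B => ?_⟩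
    refine Finsupp.supported_mono (smallWords_mono subset_rfl ?_) (hc B B.card_le_univ).2
    rw [hη, mul_div_assoc', div_le_iff₀ (by positivity)]
    nlinarith
  intro n
  induction n with
  | zero =>
    refine ⟨fun _ => Finsupp.single [] 1, rfl, fun B hB => ?_⟩
    obtain rfl : B = ∅ := by simpa using hB
    refine ⟨by simp [bdWord], Finsupp.single_mem_supported R _ ?_⟩
    simp [smallWords]
  | succ n ih =>
    obtain ⟨c, h0, hc⟩ := ih
    have hfill : ∀ B : Finset V, B.card = n + 1 → ∃ y ∈ Finsupp.supported R R
        (smallWords (simplexFace B) (n * η + η)),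
        bd R y = ∑ t ∈ B, posSign R t B • c (B.erase t) := by
      intro B hB
      have hcard : ∀ t ∈ B, (B.erase t).card ≤ n := fun t ht => by
        rw [Finset.card_erase_of_mem ht, hB]; simp
      refine exists_small_filling (convex_simplexFace B)
        (simplexFace_nonempty (Finset.card_pos.1 (by omega)))
        ((bounded_stdSimplex V).subset (simplexFace_subset_stdSimplex B)) (by positivity) hη0 ?_ ?_
      · refine Submodule.sum_mem _ fun t ht => Submodule.smul_mem _ _ ?_
        exact Finsupp.supported_mono
          (smallWords_mono (simplexFace_mono (Finset.erase_subset _ _)) le_rfl)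
          (hc _ (hcard t ht)).2
      · have h : ∀ t ∈ B, bd R (c (B.erase t)) =
            Finsupp.linearCombination R c (face R (Finsupp.single (B.erase t) 1)) := by
          intro t ht
          rw [(hc _ (hcard t ht)).1]
          simp [faceSum]
        have h2 : bd R (∑ t ∈ B, posSign R t B • c (B.erase t)) =
            Finsupp.linearCombination R c (face R (face R (Finsupp.single B 1))) := by
          rw [face_single B, faceSum]
          simp only [map_sum, map_smul]
          exact Finset.sum_congr rfl fun t ht => by rw [h t ht]
        rw [h2, face_face, map_zero]
    choose y hy hbd using hfill
    refine ⟨fun B => if h : B.card = n + 1 then y B h else c B, by simp [h0], fun B hB => ?_⟩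
    have herase : ∑ t ∈ B, posSign R t B •
        (if h : (B.erase t).card = n + 1 then y _ h else c (B.erase t)) =
        ∑ t ∈ B, posSign R t B • c (B.erase t) := by
      refine Finset.sum_congr rfl fun t ht => ?_
      rw [dif_neg]
      have := Finset.card_erase_add_one ht
      omega
    rw [herase]
    have hn : ((n + 1 : ℕ) : ℝ) * η = n * η + η := by push_cast; ring
    rw [hn]
    by_cases h : B.card = n + 1
    · simp only [h, dif_pos]
      exact ⟨hbd B h, hy B h⟩
    · simp only [h, dif_neg, not_false_eq_true]
      have := hc B (by omega)
      exact ⟨this.1, Finsupp.supported_mono (smallWords_mono subset_rfl (by linarith)) this.2⟩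

end FineChains

section Counting

lemma prime_dvd_choose_pow_sub_one_add {p n j : ℕ} (hp : p.Prime) (hj : 0 < j) (hjn : j < p ^ n) :
    p ∣ (p ^ n - 1 + j).choose j := by
  obtain ⟨i, rfl⟩ : ∃ i, j = i + 1 := ⟨j - 1, by omega⟩
  have h := Nat.choose_succ_right_eq (p ^ n - 1 + (i + 1)) i
  have e : p ^ n - 1 + (i + 1) - i = p ^ n := by omega
  rw [e] at h
  by_contra hnd
  have hcop : Nat.Coprime (p ^ n) ((p ^ n - 1 + (i + 1)).choose (i + 1)) :=
    Nat.Coprime.pow_left n ((Nat.Prime.coprime_iff_not_dvd hp).2 hnd)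
  have : p ^ n ∣ i + 1 := hcop.dvd_of_dvd_mul_left (h ▸ Dvd.intro_left _ rfl)
  exact absurd (Nat.le_of_dvd (by omega) this) (by omega)

lemma choose_two_mul_prime_pow_sub_one {p n : ℕ} (hp : p.Prime) :
    ((2 * p ^ n - 1).choose (p ^ n) : ZMod p) = 1 := by
  have hpos : 0 < p ^ n := pow_pos hp.pos n
  have h : 2 * p ^ n - 1 = p ^ n + (p ^ n - 1) := by omega
  rw [h, Nat.add_choose_eq, Nat.cast_sum, Finset.sum_eq_single (p ^ n, 0)]
  · simp
  · rintro ⟨i, j⟩ hij hne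
    have hij : i + j = p ^ n := by simpa using hij
    rw [ZMod.natCast_eq_zero_iff]
    rcases Nat.eq_zero_or_pos i with rfl | hi
    · have : j = p ^ n := by omega
      rw [this, Nat.choose_eq_zero_of_lt (by omega : p ^ n - 1 < p ^ n)]
      simp
    · refine Dvd.dvd.mul_right (hp.dvd_choose_pow hi.ne' ?_) _
      rintro rfl
      exact hne (by simp; omega)
  · simp

lemma card_filter_superset {V : Type*} [Fintype V] [DecidableEq V] (B : Finset V) {r : ℕ}
    (hB : B.card ≤ r) :
    ((Finset.powersetCard r Finset.univ).filter (B ⊆ ·)).card =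
      (Fintype.card V - B.card).choose (r - B.card) := by
  rw [← Finset.card_compl, ← Finset.card_powersetCard]
  refine Finset.card_nbij' (· \ B) (· ∪ B) ?_ ?_ ?_ ?_
  · intro Q hQ
    simp only [Finset.coe_filter, Finset.mem_powersetCard, Finset.subset_univ, true_and,
      Set.mem_ofPred_eq] at hQ
    simp only [Finset.mem_coe, Finset.mem_powersetCard]
    refine ⟨fun t ht => ?_, ?_⟩
    · simp only [Finset.mem_sdiff] at ht; simpa using ht.2
    · rw [Finset.card_sdiff_of_subset hQ.2, hQ.1]
  · intro A hA
    simp only [Finset.mem_coe, Finset.mem_powersetCard] at hA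
    simp only [Finset.coe_filter, Finset.mem_powersetCard, Finset.subset_univ, true_and,
      Set.mem_ofPred_eq]
    refine ⟨?_, Finset.subset_union_right⟩
    rw [Finset.card_union_of_disjoint, hA.2]
    · omega
    · exact Finset.disjoint_left.2 fun t ht => by simpa using hA.1 ht
  · intro Q hQ
    simp only [Finset.coe_filter, Set.mem_ofPred_eq] at hQ
    exact Finset.sdiff_union_of_subset hQ.2
  · intro A hA
    simp only [Finset.mem_coe, Finset.mem_powersetCard] at hA
    refine Finset.union_sdiff_cancel_right ?_
    exact Finset.disjoint_left.2 fun t ht => by simpa using hA.1 ht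

lemma exists_sum_ssubsets_ne_zero {p n r : ℕ} (hp : p.Prime) (hr : r = p ^ n)
    {a : Finset (Fin (2 * r - 1)) → ZMod p} (h0 : a ∅ = 1) :
    ∃ Q : Finset (Fin (2 * r - 1)), Q.card = r ∧
      ∑ B ∈ Q.ssubsets, (-1) ^ B.card * a B ≠ 0 := by
  have : Fact p.Prime := ⟨hp⟩
  have hpos : 0 < r := hr ▸ pow_pos hp.pos n
  by_contra! h
  have h1 : ∑ Q ∈ Finset.powersetCard r (Finset.univ : Finset (Fin (2 * r - 1))),
      ∑ B ∈ Q.ssubsets, (-1) ^ B.card * a B = 0 :=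
    Finset.sum_eq_zero fun Q hQ => h Q (Finset.mem_powersetCard.1 hQ).2
  have h2 : ∑ Q ∈ Finset.powersetCard r (Finset.univ : Finset (Fin (2 * r - 1))),
      ∑ B ∈ Q.ssubsets, (-1) ^ B.card * a B =
      ∑ B ∈ Finset.univ.filter (fun B : Finset (Fin (2 * r - 1)) => B.card < r),
        ∑ Q ∈ (Finset.powersetCard r Finset.univ).filter (B ⊆ ·), (-1) ^ B.card * a B := by
    refine Finset.sum_comm' fun Q B => ?_
    simp only [Finset.mem_powersetCard, Finset.subset_univ, true_and, Finset.mem_ssubsets,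
      Finset.mem_filter, Finset.mem_univ]
    constructor
    · rintro ⟨hQ, hB⟩
      exact ⟨⟨hQ, hB.subset⟩, (Finset.card_lt_card hB).trans_eq hQ⟩
    · rintro ⟨⟨hQ, hB⟩, hlt⟩
      refine ⟨hQ, hB.ssubset_of_ne ?_⟩
      rintro rfl
      omega
  rw [h2, Finset.sum_eq_single ∅] at h1
  · rw [Finset.sum_const, card_filter_superset _ (by simp)] at h1
    have := choose_two_mul_prime_pow_sub_one (n := n) hp
    rw [← hr] at this
    simp [h0, this] at h1
  · intro B hB hne
    have hB : B.card < r := by simpa using hB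
    have hBpos : 0 < B.card := Finset.card_pos.2 (Finset.nonempty_iff_ne_empty.2 hne)
    rw [Finset.sum_const, card_filter_superset _ hB.le, nsmul_eq_mul]
    have e : Fintype.card (Fin (2 * r - 1)) - B.card = p ^ n - 1 + (r - B.card) := by
      rw [Fintype.card_fin]; omega
    rw [e, (ZMod.natCast_eq_zero_iff _ _).2
      (prime_dvd_choose_pow_sub_one_add hp (by omega) (by omega)), zero_mul]
  · intro hB
    exact absurd hB (by simp [hpos])

end Counting

section Labelling

variable {R : Type*} [CommRing R] {V E : Type*} [LinearOrder V]

lemma wedge_mapL_apply (f : E → V) (z : List E →₀ R) (B : Finset V) :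
    wedge R (mapL R f z) B = z.sum fun w b => b * wedgeWord R (w.map f) B := by
  have : wedge R ∘ₗ mapL R f = Finsupp.linearCombination R fun w => wedgeWord R (w.map f) := by
    ext l : 2
    simp
  rw [← LinearMap.comp_apply, this, Finsupp.linearCombination_apply, Finsupp.sum,
    Finsupp.finsetSum_apply]
  simp [Finsupp.sum]

lemma wedge_mapL_mem_supported {f : E → V} {S : Set (List E)} {Q : Finset V}
    (h : ∀ w ∈ S, ∀ x ∈ w, f x ∈ Q) {z : List E →₀ R} (hz : z ∈ Finsupp.supported R R S) :
    wedge R (mapL R f z) ∈ Finsupp.supported R R {B | B ⊆ Q} := by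
  rw [Finsupp.mem_supported]
  intro B hB t ht
  rw [Finset.mem_coe, Finsupp.mem_support_iff, wedge_mapL_apply] at hB
  obtain ⟨w, hw, hne⟩ := Finset.exists_ne_zero_of_sum_ne_zero hB
  have := toFinset_eq_of_wedgeWord_apply_ne_zero (right_ne_zero_of_mul hne)
  rw [← this] at ht
  simp only [List.mem_toFinset, List.mem_map] at ht
  obtain ⟨x, hx, rfl⟩ := ht
  exact h w (hz hw) x hx

/-- Labellings of the `r`-element faces of a simplex with `2r - 1` vertices which agree on
the words witnessing lower-dimensional faces must have a fully labelled small word. -/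
theorem exists_full_word {p n r : ℕ} (hp : p.Prime) (hr : r = p ^ n) {δ : ℝ} (hδ : 0 < δ)
    {lab : Finset (Fin (2 * r - 1)) → (Fin (2 * r - 1) → ℝ) → Fin (2 * r - 1)}
    (hmem : ∀ Q, Q.card = r → ∀ x ∈ simplexFace Q, lab Q x ∈ Q)
    (hcompat : ∀ B Q Q', Q.card = r → Q'.card = r → B ⊂ Q → B ⊂ Q' →
      ∀ w ∈ smallWords (simplexFace B) δ, (w.map (lab Q)).toFinset = B →
        w.map (lab Q') = w.map (lab Q)) :
    ∃ Q, Q.card = r ∧ ∃ w ∈ smallWords (simplexFace Q) δ, (w.map (lab Q)).toFinset = Q := by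
  by_contra! hfull
  have : Fact p.Prime := ⟨hp⟩
  have hpos : 0 < r := hr ▸ pow_pos hp.pos n
  obtain ⟨c, hc0, hcbd, hcs⟩ :=
    exists_fine_chain_map (V := Fin (2 * r - 1)) (ZMod p) hδ
  set F : Finset (Fin (2 * r - 1)) → Finset (Fin (2 * r - 1)) →
    (Finset (Fin (2 * r - 1)) →₀ ZMod p) := fun Q B => wedge _ (mapL _ (lab Q) (c B)) with hF
  have hindep : ∀ B Q Q', Q.card = r → Q'.card = r → B ⊂ Q → B ⊂ Q' →
      F Q B B = F Q' B B := by
    intro B Q Q' hQ hQ' hBQ hBQ'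
    simp only [hF, wedge_mapL_apply]
    refine Finset.sum_congr rfl fun w hw => ?_
    have hw := hcs B hw
    refine congrArg (c B w * ·) ?_
    by_contra hne
    by_cases h : wedgeWord (ZMod p) (w.map (lab Q)) B = 0
    · rw [h] at hne
      have := hcompat B Q' Q hQ' hQ hBQ' hBQ w hw
        (toFinset_eq_of_wedgeWord_apply_ne_zero (Ne.symm hne))
      rw [this] at h
      exact hne h.symm
    · exact hne (by rw [hcompat B Q Q' hQ hQ' hBQ hBQ' w hw
        (toFinset_eq_of_wedgeWord_apply_ne_zero h)])
  classical
  set a : Finset (Fin (2 * r - 1)) → ZMod p := fun B =>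
    if h : ∃ Q, Q.card = r ∧ B ⊂ Q then F h.choose B B else 0 with ha
  have haF : ∀ B Q, Q.card = r → B ⊂ Q → a B = F Q B B := by
    intro B Q hQ hBQ
    have h : ∃ Q, Q.card = r ∧ B ⊂ Q := ⟨Q, hQ, hBQ⟩
    simp only [ha, dif_pos h]
    exact hindep B _ Q h.choose_spec.1 hQ h.choose_spec.2 hBQ
  have ha0 : a ∅ = 1 := by
    obtain ⟨Q, -, hQ⟩ := Finset.exists_subset_card_eq
      (s := (Finset.univ : Finset (Fin (2 * r - 1)))) (n := r)
      (by rw [Finset.card_univ, Fintype.card_fin]; omega)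
    rw [haF ∅ Q hQ (Finset.empty_ssubset.2 (Finset.card_pos.1 (by omega)))]
    simp [hF, hc0, wedgeWord]
  obtain ⟨Q, hQ, hne⟩ := exists_sum_ssubsets_ne_zero hp hr ha0
  refine hne ?_
  have hstr := supertrace_eq_zero (R := ZMod p) (Q := Q) (F := F Q)
    (Finset.card_pos.1 (by omega)) ?_ ?_
  · rw [← Finset.insert_erase (Finset.mem_powerset_self Q), Finset.sum_insert (by simp)] at hstr
    have hQQ : F Q Q Q = 0 := by
      simp only [hF, wedge_mapL_apply]
      refine Finset.sum_eq_zero fun w hw => ?_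
      by_contra h
      exact hfull Q hQ w (hcs Q hw)
        (toFinset_eq_of_wedgeWord_apply_ne_zero (right_ne_zero_of_mul h))
    rw [hQQ, mul_zero, zero_add] at hstr
    rw [← hstr]
    refine Finset.sum_congr rfl fun B hB => ?_
    rw [haF B Q hQ (Finset.mem_ssubsets.1 hB)]
  · intro B hB
    exact wedge_mapL_mem_supported
      (fun w hw x hx => hmem Q hQ x (simplexFace_mono hB (hw.1 x hx))) (hcs B)
  · intro B _
    simp only [hF, face_wedge, bd_mapL, hcbd, map_sum, map_smul]

end Labelling

section Configurations

lemma isCompact_ConfC2 (r : ℕ) : IsCompact (ConfC2 r) := by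
  have hclosed : IsClosed (ConfC2 r) := by
    have e : ConfC2 r = {M | (∀ b t, 0 ≤ M b t) ∧ (∑ b, ∑ t, M b t) = 1 ∧
        (∀ b t t', t ≠ t' → M b t * M b t' = 0) ∧
        (∀ t b b', b ≠ b' → M b t * M b' t = 0)} := by
      ext M
      refine and_congr_right fun _ => and_congr_right fun _ => and_congr ?_ ?_
      · refine forall_congr' fun b => forall_congr' fun t => forall_congr' fun t' => ?_
        rw [mul_eq_zero]; tauto
      · refine forall_congr' fun b => forall_congr' fun t => forall_congr' fun t' => ?_
        rw [mul_eq_zero]; tauto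
    rw [e]
    simp only [Set.ofPred_and, Set.ofPred_forall]
    refine IsClosed.inter ?_ (IsClosed.inter ?_ (IsClosed.inter ?_ ?_))
    · exact isClosed_iInter fun b => isClosed_iInter fun t =>
        isClosed_le continuous_const (by fun_prop)
    · exact isClosed_eq (by fun_prop) continuous_const
    · exact isClosed_iInter fun b => isClosed_iInter fun t => isClosed_iInter fun t' =>
        isClosed_iInter fun _ => isClosed_eq (by fun_prop) continuous_const
    · exact isClosed_iInter fun b => isClosed_iInter fun t => isClosed_iInter fun t' =>
        isClosed_iInter fun _ => isClosed_eq (by fun_prop) continuous_const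
  refine (isCompact_univ_pi fun _ => isCompact_univ_pi fun _ =>
    isCompact_Icc (a := (0 : ℝ)) (b := 1)).of_isClosed_subset hclosed ?_
  intro M hM b _ t _
  refine ⟨hM.1 b t, ?_⟩
  rw [← hM.2.1]
  calc M b t ≤ ∑ t, M b t :=
        Finset.single_le_sum (f := fun t => M b t) (fun t _ => hM.1 b t) (Finset.mem_univ t)
    _ ≤ ∑ b, ∑ t, M b t := Finset.single_le_sum (f := fun b => ∑ t, M b t)
        (fun b _ => Finset.sum_nonneg fun t _ => hM.1 b t) (Finset.mem_univ b)

lemma rowPerm_apply_apply {r m : ℕ} (σ : Equiv.Perm (Fin r)) (M : Fin r → Fin m → ℝ) (b : Fin r) :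
    rowPerm σ M (σ b) = M b := by
  funext t
  exact congrArg (fun c => M c t) (σ.symm_apply_apply b)

lemma rowPerm_mem_ConfC2 {r : ℕ} (σ : Equiv.Perm (Fin r)) {M : Fin r → Fin (2 * r - 1) → ℝ}
    (hM : M ∈ ConfC2 r) : rowPerm σ M ∈ ConfC2 r := by
  refine ⟨fun b t => hM.1 _ t, ?_, fun b t t' => hM.2.2.1 _ t t', fun t b b' h h' => ?_⟩
  · rw [← hM.2.1]
    exact Equiv.sum_comp σ⁻¹ fun b => ∑ t, M b t
  · exact σ⁻¹.injective (hM.2.2.2 t _ _ h h')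

/-- The allocation of the tiles of lengths `x` placing tile `j b` into box `b`. -/
def allocate {r m : ℕ} (j : Fin r → Fin m) (x : Fin m → ℝ) : Fin r → Fin m → ℝ :=
  fun b t => if t = j b then x t else 0

lemma dist_allocate_le {r m : ℕ} (j : Fin r → Fin m) (x y : Fin m → ℝ) :
    dist (allocate j x) (allocate j y) ≤ dist x y := by
  refine (dist_pi_le_iff dist_nonneg).2 fun b => (dist_pi_le_iff dist_nonneg).2 fun t => ?_
  unfold allocate
  split_ifs
  · exact dist_le_pi_dist x y t
  · simp

lemma allocate_mem_ConfC2 {r : ℕ} {j : Fin r → Fin (2 * r - 1)} (hj : Function.Injective j)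
    {x : Fin (2 * r - 1) → ℝ} (hx : x ∈ simplexFace (Finset.univ.image j)) :
    allocate j x ∈ ConfC2 r := by
  refine ⟨fun b t => ?_, ?_, fun b t t' h h' => ?_, fun t b b' h h' => ?_⟩
  · unfold allocate
    split_ifs
    exacts [hx.1 t, le_rfl]
  · have h : ∀ b, ∑ t, allocate j x b t = x (j b) := fun b => by simp [allocate]
    simp only [h]
    rw [← Finset.sum_image (s := Finset.univ) (g := j) (f := x) hj.injOn, ← hx.2.1]
    exact Finset.sum_subset (Finset.subset_univ _) fun t _ ht => hx.2.2 t ht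
  · simp only [allocate, ne_eq, ite_eq_right_iff, not_forall] at h h'
    exact h.1.trans h'.1.symm
  · simp only [allocate, ne_eq, ite_eq_right_iff, not_forall] at h h'
    exact hj (h.1.symm.trans h'.1)

lemma exists_rowPerm_allocate {r m : ℕ} {j j' : Fin r → Fin m} (hj : Function.Injective j)
    (hj' : Function.Injective j') {x : Fin m → ℝ} (hx : ∀ t, x t ≠ 0 → ∃ b, j b = t)
    (hx' : ∀ t, x t ≠ 0 → ∃ b, j' b = t) :
    ∃ σ : Equiv.Perm (Fin r), (∀ b, x (j b) ≠ 0 → j' (σ b) = j b) ∧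
      allocate j' x = rowPerm σ (allocate j x) := by
  obtain ⟨g, hg⟩ := Finset.exists_equiv_extend_of_card_eq (α := Fin r)
    (t := Finset.univ.image j') (by rw [Finset.card_image_of_injective _ hj']; simp)
    (s := Finset.univ.filter fun b => x (j b) ≠ 0) (f := j)
    (by
      intro t ht
      simp only [Finset.mem_image, Finset.mem_filter, Finset.mem_univ, true_and] at ht ⊢
      obtain ⟨b, hb, rfl⟩ := ht
      exact hx' _ hb) hj.injOn
  have hs : ∀ b, ∃ b', j' b' = g b := fun b => by
    obtain ⟨b', -, h⟩ := Finset.mem_image.1 (g b).2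
    exact ⟨b', h⟩
  choose s hs using hs
  have hinj : Function.Injective s := fun b b' h =>
    g.injective (Subtype.ext (by rw [← hs b, ← hs b', h]))
  have hσ : ∀ b, x (j b) ≠ 0 → j' (s b) = j b := fun b hb => by
    rw [hs b, hg b (by simp [hb])]
  refine ⟨Equiv.ofBijective s (Finite.injective_iff_bijective.1 hinj), hσ, ?_⟩
  set σ := Equiv.ofBijective s (Finite.injective_iff_bijective.1 hinj) with hσ'
  ext b t
  obtain ⟨c, rfl⟩ := σ.surjective b
  rw [rowPerm_apply_apply]
  simp only [hσ', allocate, Equiv.ofBijective_apply]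
  by_cases ht : x t = 0
  · simp [ht]
  · obtain ⟨c', rfl⟩ := hx t ht
    have e : j c' = j' (s c) ↔ j c' = j c := by
      rw [← hσ c' ht, hj'.eq_iff, hinj.eq_iff, hσ c' ht, hj.eq_iff]
    simp only [e]

end Configurations

section Balanced

variable {r : ℕ}

/-- The box `b` receives the largest value of `φ` at `M`. -/
def IsTop {X : Type*} (φ : X → Fin r → ℝ) (M : X) (b : Fin r) : Prop := ∀ i, φ M i ≤ φ M b

lemma exists_scale_not_all_top {X : Type*} [PseudoMetricSpace X] {K : Set X} (hK : IsCompact K)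
    (hr : 0 < r) {φ : X → Fin r → ℝ} (hφ : ContinuousOn φ K)
    (hne : ∀ M ∈ K, ∃ i i', φ M i ≠ φ M i') :
    ∃ δ > 0, ∀ M : Fin r → X, (∀ b, M b ∈ K) → (∀ b b', dist (M b) (M b') ≤ δ) →
      ¬∀ b, IsTop φ (M b) b := by
  have hosc : ContinuousOn (fun M => ∑ i, ∑ i', |φ M i - φ M i'|) K := by
    have : ∀ i, ContinuousOn (fun M => φ M i) K := fun i => continuousOn_pi.1 hφ i
    fun_prop
  obtain ⟨η, hη, hmin⟩ := hK.exists_forall_le' hosc (a := 0) (by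
    intro M hM
    obtain ⟨i, i', h⟩ := hne M hM
    refine Finset.sum_pos' (fun _ _ => Finset.sum_nonneg fun _ _ => abs_nonneg _)
      ⟨i, Finset.mem_univ _, Finset.sum_pos' (fun _ _ => abs_nonneg _)
        ⟨i', Finset.mem_univ _, abs_pos.2 (sub_ne_zero.2 h)⟩⟩)
  have hr' : (0 : ℝ) < r := by exact_mod_cast hr
  set ε : ℝ := η / (4 * r ^ 2) with hε
  have hε0 : 0 < ε := by positivity
  obtain ⟨δ, hδ, hunif⟩ := Metric.uniformContinuousOn_iff.1
    (hK.uniformContinuousOn_of_continuous hφ) ε hε0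
  refine ⟨δ / 2, by positivity, fun M hMK hd htop => ?_⟩
  have hclose : ∀ b b' i, |φ (M b) i - φ (M b') i| ≤ ε := fun b b' i => by
    rw [← Real.dist_eq]
    exact (dist_le_pi_dist _ _ i).trans
      (hunif _ (hMK b) _ (hMK b') ((hd b b').trans_lt (by linarith))).le
  set b₀ : Fin r := ⟨0, hr⟩
  have hle : ∀ i i', φ (M b₀) i' - φ (M b₀) i ≤ 2 * ε := fun i i' => by
    have h1 := abs_le.1 (hclose b₀ i i')
    have h2 := abs_le.1 (hclose i b₀ i)
    have h3 := htop i i'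
    linarith [h1.2, h2.2]
  have hsum : ∑ i, ∑ i', |φ (M b₀) i - φ (M b₀) i'| ≤ ∑ _i : Fin r, ∑ _i' : Fin r, 2 * ε :=
    Finset.sum_le_sum fun i _ => Finset.sum_le_sum fun i' _ =>
      abs_le.2 ⟨by linarith [hle i i'], hle i' i⟩
  have h1 := (hmin _ (hMK b₀)).trans hsum
  have h2 : ∑ _i : Fin r, ∑ _i' : Fin r, 2 * ε = η / 2 := by
    simp [hε]; field_simp; norm_num
  linarith

/-- An equivariant continuous map from `Δ_{r,2r-1}` to `ℝʳ` meets the diagonal. -/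
theorem exists_balanced (hr : IsPrimePow r)
    {φ : (Fin r → Fin (2 * r - 1) → ℝ) → Fin r → ℝ} (hφ : ContinuousOn φ (ConfC2 r))
    (hequi : ∀ σ : Equiv.Perm (Fin r), ∀ M ∈ ConfC2 r, ∀ i, φ (rowPerm σ M) (σ i) = φ M i) :
    ∃ M ∈ ConfC2 r, ∀ i i', φ M i = φ M i' := by
  classical
  by_contra! hne
  have hr0 : 0 < r := hr.pos
  obtain ⟨p, n, hp, -, hpn⟩ := (isPrimePow_nat_iff r).1 hr
  obtain ⟨δ, hδ, hfull⟩ := exists_scale_not_all_top (isCompact_ConfC2 r) hr0 hφ hne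
  have hj : ∀ Q : Finset (Fin (2 * r - 1)), ∃ j : Fin r → Fin (2 * r - 1),
      Q.card = r → Function.Injective j ∧ Finset.univ.image j = Q := fun Q => by
    by_cases h : Q.card = r
    · refine ⟨Q.orderEmbOfFin h, fun _ => ⟨(Q.orderEmbOfFin h).injective, ?_⟩⟩
      ext t
      simp
    · exact ⟨fun _ => ⟨0, by omega⟩, fun h' => absurd h' h⟩
  choose j hj using hj
  have hrange : ∀ Q, Q.card = r → ∀ x ∈ simplexFace Q, ∀ t, x t ≠ 0 → ∃ b, j Q b = t := by
    intro Q hQ x hx t ht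
    have : t ∈ Finset.univ.image (j Q) := by
      rw [(hj Q hQ).2]; by_contra h; exact ht (hx.2.2 t h)
    simpa using this
  have hconf : ∀ Q, Q.card = r → ∀ x ∈ simplexFace Q, allocate (j Q) x ∈ ConfC2 r :=
    fun Q hQ x hx => allocate_mem_ConfC2 (hj Q hQ).1 (by rwa [(hj Q hQ).2])
  have hnotall : ∀ Q, Q.card = r → ∀ w ∈ smallWords (simplexFace Q) δ,
      ¬∀ b, ∃ x ∈ w, IsTop φ (allocate (j Q) x) b := by
    intro Q hQ w hw h
    choose x hxw hx using h
    exact hfull (fun b => allocate (j Q) (x b)) (fun b => hconf Q hQ _ (hw.1 _ (hxw b)))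
      (fun b b' => (dist_allocate_le _ _ _).trans (hw.2 _ (hxw b) _ (hxw b'))) hx
  have hexists : ∀ M, ∃ b, IsTop φ M b := fun M => by
    have : Nonempty (Fin r) := ⟨⟨0, hr0⟩⟩
    exact Finite.exists_max (φ M)
  choose top htop using hexists
  set P : (Fin (2 * r - 1) → ℝ) → Fin (2 * r - 1) → Prop := fun x t =>
    x t ≠ 0 ∧ ∃ Q, Q.card = r ∧ x ∈ simplexFace Q ∧
      ∃ b, j Q b = t ∧ IsTop φ (allocate (j Q) x) b with hP
  have hPtop : ∀ Q, Q.card = r → ∀ x ∈ simplexFace Q, ∀ t, P x t →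
      ∃ b, j Q b = t ∧ IsTop φ (allocate (j Q) x) b := by
    rintro Q hQ x hx t ⟨ht, Q', hQ', hx', b, rfl, hb⟩
    obtain ⟨σ, hσ, he⟩ := exists_rowPerm_allocate (hj Q' hQ').1 (hj Q hQ).1
      (hrange Q' hQ' x hx') (hrange Q hQ x hx)
    refine ⟨σ b, hσ b ht, fun i => ?_⟩
    obtain ⟨i, rfl⟩ := σ.surjective i
    rw [he, hequi σ _ (hconf Q' hQ' x hx'), hequi σ _ (hconf Q' hQ' x hx')]
    exact hb i
  have hempty : ∀ Q, Q.card = r → ∀ x ∈ simplexFace Q, (¬∃ t, P x t) →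
      ∀ b, x (j Q b) = 0 → IsTop φ (allocate (j Q) x) b := by
    intro Q hQ x hx hno b hb
    set b₀ := top (allocate (j Q) x) with hb₀
    have h0 : x (j Q b₀) = 0 := by
      by_contra h
      exact hno ⟨_, h, Q, hQ, hx, b₀, rfl, htop _⟩
    have he : rowPerm (Equiv.swap b b₀) (allocate (j Q) x) = allocate (j Q) x := by
      ext c t
      obtain ⟨c, rfl⟩ := (Equiv.swap b b₀).surjective c
      rw [rowPerm_apply_apply]
      simp only [allocate]
      rcases eq_or_ne c b with rfl | h1
      · rw [Equiv.swap_apply_left]; grind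
      rcases eq_or_ne c b₀ with h2 | h2
      · rw [h2, Equiv.swap_apply_right]; grind
      · rw [Equiv.swap_apply_of_ne_of_ne h1 h2]
    have := hequi (Equiv.swap b b₀) _ (hconf Q hQ x hx) b
    rw [he, Equiv.swap_apply_left] at this
    exact fun i => (htop _ i).trans this.le
  set lab : Finset (Fin (2 * r - 1)) → (Fin (2 * r - 1) → ℝ) → Fin (2 * r - 1) := fun Q x =>
    if h : ∃ t, P x t then h.choose else j Q (top (allocate (j Q) x)) with hlab
  have hlabtop : ∀ Q, Q.card = r → ∀ x ∈ simplexFace Q,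
      ∃ b, j Q b = lab Q x ∧ IsTop φ (allocate (j Q) x) b := by
    intro Q hQ x hx
    by_cases h : ∃ t, P x t
    · simp only [hlab, dif_pos h]
      exact hPtop Q hQ x hx _ h.choose_spec
    · simp only [hlab, dif_neg h]
      exact ⟨_, rfl, htop _⟩
  have htoplab : ∀ Q, Q.card = r → ∀ x ∈ simplexFace Q, ∀ b, lab Q x = j Q b →
      IsTop φ (allocate (j Q) x) b := by
    intro Q hQ x hx b hb
    obtain ⟨b', h, h'⟩ := hlabtop Q hQ x hx
    rwa [(hj Q hQ).1 (h.trans hb)] at h'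
  obtain ⟨Q, hQ, w, hw, hlabw⟩ := exists_full_word hp hpn.symm hδ (lab := lab)
    (by
      intro Q hQ x hx
      obtain ⟨b, hb, -⟩ := hlabtop Q hQ x hx
      have : j Q b ∈ Finset.univ.image (j Q) := Finset.mem_image_of_mem _ (Finset.mem_univ b)
      rwa [(hj Q hQ).2, hb] at this)
    (by
      intro B Q Q' hQ hQ' hBQ hBQ' w hw hlabw
      refine List.map_congr_left fun x hx => ?_
      by_cases h : ∃ t, P x t
      · simp only [hlab, dif_pos h]
      · refine absurd ?_ (hnotall Q hQ w
          (smallWords_mono (simplexFace_mono hBQ.subset) le_rfl hw))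
        intro b
        by_cases hb : j Q b ∈ B
        · rw [← hlabw] at hb
          simp only [List.mem_toFinset, List.mem_map] at hb
          obtain ⟨y, hy, hyb⟩ := hb
          exact ⟨y, hy, htoplab Q hQ y (simplexFace_mono hBQ.subset (hw.1 y hy)) b hyb⟩
        · exact ⟨x, hx, hempty Q hQ x (simplexFace_mono hBQ.subset (hw.1 x hx)) h b
            ((hw.1 x hx).2.2 _ hb)⟩)
  refine hnotall Q hQ w hw fun b => ?_
  have hb : j Q b ∈ (w.map (lab Q)).toFinset := by
    have := Finset.mem_image_of_mem (j Q) (Finset.mem_univ b)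
    rw [(hj Q hQ).2] at this
    rwa [hlabw]
  simp only [List.mem_toFinset, List.mem_map] at hb
  obtain ⟨y, hy, hyb⟩ := hb
  exact ⟨y, hy, htoplab Q hQ y (hw.1 y hy) b hyb⟩

end Balanced

section Preferences

variable {r : ℕ}

lemma isometry_rowPerm {m : ℕ} (σ : Equiv.Perm (Fin r)) :
    Isometry (rowPerm σ : (Fin r → Fin m → ℝ) → Fin r → Fin m → ℝ) := by
  refine Isometry.of_dist_eq fun M N => le_antisymm ?_ ?_
  · exact (dist_pi_le_iff dist_nonneg).2 fun b => dist_le_pi_dist M N (σ⁻¹ b)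
  · refine (dist_pi_le_iff dist_nonneg).2 fun b => ?_
    have := dist_le_pi_dist (rowPerm σ M) (rowPerm σ N) (σ b)
    rwa [rowPerm_apply_apply, rowPerm_apply_apply] at this

lemma rowPerm_rowPerm_inv {m : ℕ} (σ : Equiv.Perm (Fin r)) (M : Fin r → Fin m → ℝ) :
    rowPerm σ (rowPerm σ⁻¹ M) = M := by
  funext b
  obtain ⟨b, rfl⟩ := σ.surjective b
  rw [rowPerm_apply_apply]
  obtain ⟨c, rfl⟩ := σ⁻¹.surjective b
  rw [rowPerm_apply_apply]
  exact congrArg M (σ.apply_symm_apply c).symm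

lemma image_rowPerm_eq {A B : Set (Fin r → Fin (2 * r - 1) → ℝ)} (hA : A ⊆ ConfC2 r)
    (hB : B ⊆ ConfC2 r) (σ : Equiv.Perm (Fin r))
    (h : ∀ M ∈ ConfC2 r, (M ∈ A ↔ rowPerm σ M ∈ B)) : rowPerm σ '' A = B := by
  ext M
  constructor
  · rintro ⟨N, hN, rfl⟩
    exact (h N (hA hN)).1 hN
  · intro hM
    refine ⟨rowPerm σ⁻¹ M, ?_, rowPerm_rowPerm_inv σ M⟩
    rw [h _ (rowPerm_mem_ConfC2 _ (hB hM)), rowPerm_rowPerm_inv]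
    exact hM

/-- A nonnegative square matrix with unit row and column sums has a positive transversal. -/
lemma exists_perm_forall_pos {n : Type*} [Fintype n] [DecidableEq n] {A : Matrix n n ℝ}
    (hA : A ∈ doublyStochastic ℝ n) : ∃ π : Equiv.Perm n, ∀ i, 0 < A i (π i) := by
  obtain ⟨w, hw, hsum, rfl⟩ := exists_eq_sum_perm_of_mem_doublyStochastic hA
  obtain ⟨π, -, hπ⟩ := Finset.exists_ne_zero_of_sum_ne_zero (hsum.trans_ne one_ne_zero)
  refine ⟨π, fun i => ?_⟩
  rw [Matrix.sum_apply]
  refine Finset.sum_pos' (fun τ _ => ?_) ⟨π, Finset.mem_univ _, ?_⟩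
  · simp only [Matrix.smul_apply, Equiv.Perm.permMatrix, PEquiv.toMatrix_apply, smul_eq_mul]
    split_ifs <;> simp [hw]
  · simpa [Equiv.Perm.permMatrix, PEquiv.toMatrix_apply] using (hw π).lt_of_ne' hπ

/-- Approximate envy-free divisions exist. -/
lemma exists_forall_infDist_lt (hr : IsPrimePow r)
    {C : Fin r → Fin r → Set (Fin r → Fin (2 * r - 1) → ℝ)}
    (hsub : ∀ i j, C i j ⊆ ConfC2 r)
    (hcov : ∀ j, ∀ M ∈ ConfC2 r, ∃ i, M ∈ C i j)
    (hequi : ∀ (σ : Equiv.Perm (Fin r)) (i j : Fin r), ∀ M ∈ ConfC2 r,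
      (M ∈ C i j ↔ rowPerm σ M ∈ C (σ i) j)) {ε : ℝ} (hε : 0 < ε) :
    ∃ M ∈ ConfC2 r, ∀ j, Metric.infDist M (C j j) < ε := by
  set u : Fin r → Fin r → (Fin r → Fin (2 * r - 1) → ℝ) → ℝ := fun i j M =>
    max 0 (ε - Metric.infDist M (C i j)) with hu
  have hinf : ∀ σ : Equiv.Perm (Fin r), ∀ i j M,
      Metric.infDist (rowPerm σ M) (C (σ i) j) = Metric.infDist M (C i j) := fun σ i j M => by
    rw [← image_rowPerm_eq (hsub i j) (hsub (σ i) j) σ (hequi σ i j),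
      Metric.infDist_image (isometry_rowPerm σ)]
  have hu0 : ∀ i j M, 0 ≤ u i j M := fun i j M => le_max_left _ _
  have hucont : ∀ i j, Continuous (u i j) := fun i j =>
    continuous_const.max (continuous_const.sub (Metric.continuous_infDist_pt _))
  have hsum : ∀ j, ∀ M ∈ ConfC2 r, 0 < ∑ i, u i j M := fun j M hM => by
    obtain ⟨i, hi⟩ := hcov j M hM
    refine Finset.sum_pos' (fun i _ => hu0 i j M) ⟨i, Finset.mem_univ _, ?_⟩
    simp [hu, Metric.infDist_zero_of_mem hi, hε]
  have hueq : ∀ σ : Equiv.Perm (Fin r), ∀ i j M, u (σ i) j (rowPerm σ M) = u i j M :=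
    fun σ i j M => by simp only [hu, hinf]
  have hsumeq : ∀ σ : Equiv.Perm (Fin r), ∀ j M, ∑ i, u i j (rowPerm σ M) = ∑ i, u i j M :=
    fun σ j M => by
      rw [← Equiv.sum_comp σ]
      exact Finset.sum_congr rfl fun i _ => hueq σ i j M
  obtain ⟨M, hM, hbal⟩ := exists_balanced hr
    (φ := fun M i => ∑ j, u i j M / ∑ i', u i' j M)
    (continuousOn_pi.2 fun i => continuousOn_finsetSum _ fun j _ =>
      (hucont i j).continuousOn.div
        (continuous_finsetSum _ fun i' _ => hucont i' j).continuousOn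
        fun M hM => (hsum j M hM).ne')
    (fun σ M _ i => Finset.sum_congr rfl fun j _ => by rw [hueq, hsumeq])
  have hcol : ∀ j, ∑ i, u i j M / ∑ i', u i' j M = 1 := fun j => by
    rw [← Finset.sum_div, div_self (hsum j M hM).ne']
  have hrow : ∀ i, ∑ j, u i j M / ∑ i', u i' j M = 1 := fun i => by
    have h : ∑ i', ∑ j, u i' j M / ∑ i'', u i'' j M = r := by
      rw [Finset.sum_comm]; simp [hcol]
    rw [Finset.sum_congr rfl fun i' _ => hbal i' i] at h
    have hr0 : (r : ℝ) ≠ 0 := by exact_mod_cast hr.pos.ne'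
    rw [Finset.sum_const, Finset.card_univ, Fintype.card_fin, nsmul_eq_mul] at h
    exact mul_left_cancel₀ hr0 (h.trans (mul_one _).symm)
  obtain ⟨π, hπ⟩ := exists_perm_forall_pos (A := Matrix.of fun i j => u i j M / ∑ i', u i' j M)
    (mem_doublyStochastic_iff_sum.2
      ⟨fun i j => div_nonneg (hu0 i j M) (hsum j M hM).le, hrow, hcol⟩)
  refine ⟨rowPerm π M, rowPerm_mem_ConfC2 π hM, fun j => ?_⟩
  obtain ⟨i, rfl⟩ := π.surjective j
  rw [hinf]
  have h : 0 < u i (π i) M := (div_pos_iff_of_pos_right (hsum (π i) M hM)).1 (hπ i)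
  simp only [hu, lt_max_iff, lt_irrefl, false_or, sub_pos] at h
  exact h

end Preferences

end Chessboard

/-- Envy-free division on the chessboard configuration space `Δ_{r,2r-1}`:
for `r` a prime power, closed covering equivariant new-style preferences
on `C₂` admit an envy-free division. -/
theorem envy_free_chessboard (r : ℕ) (hr : IsPrimePow r)
    (C : Fin r → Fin r → Set (Fin r → Fin (2 * r - 1) → ℝ))
    (hsub : ∀ i j, C i j ⊆ ConfC2 r)
    (hclosed : ∀ i j, IsClosed {x : ConfC2 r | (x : Fin r → Fin (2 * r - 1) → ℝ) ∈ C i j})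
    (hcov : ∀ j, ∀ M ∈ ConfC2 r, ∃ i, M ∈ C i j)
    (hequi : ∀ (σ : Equiv.Perm (Fin r)) (i j : Fin r), ∀ M ∈ ConfC2 r,
      (M ∈ C i j ↔ rowPerm σ M ∈ C (σ i) j)) :
    (⋂ i, C i i).Nonempty := by
  have hcompact := Chessboard.isCompact_ConfC2 r
  have happrox := fun {ε : ℝ} (hε : 0 < ε) =>
    Chessboard.exists_forall_infDist_lt hr hsub hcov hequi hε
  obtain ⟨M₀, hM₀, -⟩ := happrox one_pos
  have hne : ∀ j, (C j j).Nonempty := fun j => by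
    obtain ⟨i, hi⟩ := hcov j M₀ hM₀
    have := (hequi (Equiv.swap i j) i j M₀ hM₀).1 hi
    rw [Equiv.swap_apply_left] at this
    exact ⟨_, this⟩
  have hcl : ∀ j, IsClosed (C j j) := fun j => by
    convert (hclosed j j).trans hcompact.isClosed using 1
    ext M
    constructor
    · exact fun h => ⟨⟨M, hsub j j h⟩, h, rfl⟩
    · rintro ⟨N, hN, rfl⟩
      exact hN
  have hcont : Continuous fun M => ∑ j, Metric.infDist M (C j j) :=
    continuous_finsetSum _ fun j _ => Metric.continuous_infDist_pt _
  obtain ⟨M, -, hmin⟩ := hcompact.exists_isMinOn ⟨M₀, hM₀⟩ hcont.continuousOn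
  refine ⟨M, Set.mem_iInter.2 fun j => ((hcl j).mem_iff_infDist_zero (hne j)).2 ?_⟩
  refine le_antisymm (le_of_forall_pos_le_add fun ε hε => ?_) Metric.infDist_nonneg
  have hr0 : (0 : ℝ) < r := by exact_mod_cast hr.pos
  obtain ⟨N, hN, hlt⟩ := happrox (div_pos hε hr0)
  calc Metric.infDist M (C j j) ≤ ∑ j, Metric.infDist M (C j j) :=
        Finset.single_le_sum (f := fun j => Metric.infDist M (C j j))
          (fun _ _ => Metric.infDist_nonneg) (Finset.mem_univ j)
    _ ≤ ∑ j, Metric.infDist N (C j j) := hmin hN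
    _ ≤ ∑ _j : Fin r, ε / r := Finset.sum_le_sum fun j _ => (hlt j).le
    _ = 0 + ε := by simp; field_simp
end

section
/- (Envy-free division with unrestricted allocations.) Let r be a prime power. Let D : Fin r → Fin r → Set C₃ be a new-style preference matrix on the configuration space C₃ that is closed, covering, and equivariant. Then there exists an envy-free division: ⋂ i, D i i is nonempty. In other words, there is a cut of [0,1] into r tiles and an allocation of the non-degenerate tiles to r boxes without any restriction (a box may be empty or contain several tiles) such that player j prefers the content of box j for every j. -/
/-- The configuration space `C₃`, the geometric realization of the `r`-fold
join `[r]^{*r}`: matrices with nonnegative entries summing to `1` and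
at most one nonzero entry in each column (no restriction on rows). -/
def ConfC3 (r : ℕ) : Set (Fin r → Fin r → ℝ) :=
  {M | (∀ b t, 0 ≤ M b t) ∧ (∑ b, ∑ t, M b t) = 1 ∧
    (∀ t b b', M b t ≠ 0 → M b' t ≠ 0 → b = b')}

section Chains

variable (R : Type*) [CommRing R] {E : Type*}

/-- Prepend a point to every list of a chain. -/
noncomputable def chainCons (a : E) : (List E →₀ R) →ₗ[R] (List E →₀ R) :=
  Finsupp.lmapDomain R R (List.cons a)

/-- The augmented simplicial boundary of a list of points. -/
noncomputable def listBd : List E → (List E →₀ R)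
  | [] => 0
  | a :: l => Finsupp.single l 1 - chainCons R a (listBd l)

/-- The augmented simplicial boundary of a chain. -/
noncomputable def chainBd : (List E →₀ R) →ₗ[R] (List E →₀ R) :=
  Finsupp.linearCombination R (listBd R)

@[simp] lemma chainCons_single (a : E) (l : List E) (c : R) :
    chainCons R a (Finsupp.single l c) = Finsupp.single (a :: l) c := by
  simp [chainCons]

@[simp] lemma chainBd_single (l : List E) :
    chainBd R (Finsupp.single l 1) = listBd R l := by
  simp [chainBd]

lemma chainBd_cons (a : E) (c : List E →₀ R) :
    chainBd R (chainCons R a c) = c - chainCons R a (chainBd R c) := by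
  have : (chainBd R) ∘ₗ (chainCons R a)
      = LinearMap.id - (chainCons R a) ∘ₗ (chainBd R) := by
    ext l : 2
    simp [listBd]
  exact LinearMap.congr_fun this c

lemma chainBd_listBd (l : List E) : chainBd R (listBd R l) = 0 := by
  induction l with
  | nil => simp [listBd]
  | cons a l ih => simp [listBd, chainBd_cons, ih]

lemma listBd_eq_sum (l : List E) :
    listBd R l = ∑ i ∈ Finset.range l.length,
      (-1 : R) ^ i • Finsupp.single (l.eraseIdx i) (1 : R) := by
  induction l with
  | nil => simp [listBd]
  | cons a l ih =>
    rw [listBd, ih, List.length_cons, Finset.sum_range_succ', add_comm]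
    simp only [map_sum, map_smul, chainCons_single, List.eraseIdx_cons_succ, pow_succ,
      List.eraseIdx_cons_zero, pow_zero, one_smul, mul_neg, mul_one, neg_smul,
      Finset.sum_neg_distrib, sub_eq_add_neg]

/-- Chains all of whose lists have length `n` and entries in `K` at pairwise distance at
most `d`. -/
def smallChains [PseudoMetricSpace E] (n : ℕ) (K : Set E) (d : ℝ) : Submodule R (List E →₀ R) :=
  Finsupp.supported R R
    {l | l.length = n ∧ (∀ x ∈ l, x ∈ K) ∧ ∀ x ∈ l, ∀ y ∈ l, dist x y ≤ d}

/-- Chains all of whose lists have length `n` and entries in `K`. -/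
def chainsIn (n : ℕ) (K : Set E) : Submodule R (List E →₀ R) :=
  Finsupp.supported R R {l | l.length = n ∧ ∀ x ∈ l, x ∈ K}

variable {R}

lemma linearMap_mem_of_supported {M : Type*} [AddCommGroup M] [Module R M] {S : Set (List E)}
    {N : Submodule R M} (f : (List E →₀ R) →ₗ[R] M)
    (hf : ∀ l ∈ S, f (Finsupp.single l 1) ∈ N) {c : List E →₀ R}
    (hc : c ∈ Finsupp.supported R R S) : f c ∈ N := by
  rw [Finsupp.supported_eq_span_single] at hc
  have : Submodule.span R ((fun i => Finsupp.single i (1 : R)) '' S) ≤ N.comap f := by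
    rw [Submodule.span_le]
    rintro _ ⟨l, hl, rfl⟩
    exact hf l hl
  exact this hc

lemma listBd_mem_chainsIn {n : ℕ} {l : List E} (hl : l.length = n + 1) :
    listBd R l ∈ chainsIn R n {x | x ∈ l} := by
  rw [listBd_eq_sum]
  refine Submodule.sum_mem _ fun i hi => Submodule.smul_mem _ _ ?_
  refine Finsupp.single_mem_supported R _ ⟨?_, fun x hx => List.mem_of_mem_eraseIdx hx⟩
  rw [List.length_eraseIdx_of_lt (Finset.mem_range.1 hi), hl, Nat.add_sub_cancel]

lemma chainsIn_mono {n : ℕ} {K L : Set E} (h : K ⊆ L) : chainsIn R n K ≤ chainsIn R n L :=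
  Finsupp.supported_mono fun _ hl => ⟨hl.1, fun x hx => h (hl.2 x hx)⟩

lemma chainCons_mem_chainsIn {n : ℕ} {K : Set E} {c : List E →₀ R} {a : E} (ha : a ∈ K)
    (hc : c ∈ chainsIn R n K) : chainCons R a c ∈ chainsIn R (n + 1) K := by
  refine linearMap_mem_of_supported _ (fun l hl => ?_) hc
  rw [chainCons_single]
  exact Finsupp.single_mem_supported R _ ⟨by simp [hl.1], by simpa [ha] using hl.2⟩

lemma smallChains_mono [PseudoMetricSpace E] {n : ℕ} {K L : Set E} {d d' : ℝ} (h : K ⊆ L)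
    (hd : d ≤ d') : smallChains R n K d ≤ smallChains R n L d' :=
  Finsupp.supported_mono fun _ hl => ⟨hl.1, fun x hx => h (hl.2.1 x hx),
    fun x hx y hy => (hl.2.2 x hx y hy).trans hd⟩

lemma smallChains_le_chainsIn [PseudoMetricSpace E] {n : ℕ} {K : Set E} {d : ℝ} :
    smallChains R n K d ≤ chainsIn R n K :=
  Finsupp.supported_mono fun _ hl => ⟨hl.1, hl.2.1⟩

section Subdivision

variable [NormedAddCommGroup E] [NormedSpace ℝ E]

/-- The barycenter of a list of points. -/
noncomputable def barycenter (l : List E) : E := (l.length : ℝ)⁻¹ • l.sum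

variable (R)

/-- Barycentric subdivision of lists of length `n`. -/
noncomputable def subdiv : ℕ → ((List E →₀ R) →ₗ[R] (List E →₀ R))
  | 0 => LinearMap.id
  | n + 1 => Finsupp.linearCombination R
      fun l => chainCons R (barycenter l) (subdiv n (listBd R l))

/-- The chain homotopy from the identity to barycentric subdivision. -/
noncomputable def subdivHomotopy : ℕ → ((List E →₀ R) →ₗ[R] (List E →₀ R))
  | 0 => 0
  | n + 1 => Finsupp.linearCombination R
      fun l => chainCons R (barycenter l) (Finsupp.single l 1 - subdivHomotopy n (listBd R l))

variable {R}

lemma subdiv_succ_single (n : ℕ) (l : List E) : subdiv R (n + 1) (Finsupp.single l 1) =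
    chainCons R (barycenter l) (subdiv R n (listBd R l)) := by
  simp [subdiv]

lemma subdivHomotopy_succ_single (n : ℕ) (l : List E) :
    subdivHomotopy R (n + 1) (Finsupp.single l 1) =
    chainCons R (barycenter l) (Finsupp.single l 1 - subdivHomotopy R n (listBd R l)) := by
  simp [subdivHomotopy]

lemma chainBd_subdiv (n : ℕ) (c : List E →₀ R) :
    chainBd R (subdiv R (n + 1) c) = subdiv R n (chainBd R c) := by
  suffices (chainBd R) ∘ₗ (subdiv R (n + 1)) = (subdiv R n (E := E)) ∘ₗ (chainBd R) from
    LinearMap.congr_fun this c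
  induction n with
  | zero =>
    ext l : 2
    simp only [LinearMap.comp_apply, Finsupp.lsingle_apply, subdiv_succ_single, chainBd_single,
      chainBd_cons]
    simp [subdiv, chainBd_listBd]
  | succ n ih =>
    ext l : 2
    have := LinearMap.congr_fun ih (listBd R l)
    simp only [LinearMap.comp_apply] at this
    simp only [LinearMap.comp_apply, Finsupp.lsingle_apply, subdiv_succ_single (n + 1),
      chainBd_single, chainBd_cons, this, chainBd_listBd, map_zero, sub_zero]

lemma chainBd_subdivHomotopy (n : ℕ) (c : List E →₀ R) :
    chainBd R (subdivHomotopy R (n + 1) c) =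
      c - subdivHomotopy R n (chainBd R c) - subdiv R (n + 1) c := by
  suffices (chainBd R) ∘ₗ (subdivHomotopy R (n + 1)) = LinearMap.id -
      (subdivHomotopy R n (E := E)) ∘ₗ (chainBd R) - subdiv R (n + 1) from
    LinearMap.congr_fun this c
  induction n with
  | zero =>
    ext l : 2
    simp only [LinearMap.comp_apply, Finsupp.lsingle_apply, LinearMap.sub_apply,
      subdivHomotopy_succ_single, subdiv_succ_single, chainBd_single, chainBd_cons]
    simp [subdiv, subdivHomotopy]
  | succ n ih =>
    ext l : 2
    have := LinearMap.congr_fun ih (listBd R l)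
    simp only [LinearMap.comp_apply, LinearMap.sub_apply, LinearMap.id_apply, chainBd_listBd,
      map_zero, sub_zero] at this
    simp only [LinearMap.comp_apply, Finsupp.lsingle_apply, LinearMap.sub_apply,
      subdivHomotopy_succ_single (n + 1), subdiv_succ_single (n + 1), chainBd_single,
      chainBd_cons, LinearMap.id_apply, map_sub, this]
    abel_nf

lemma barycenter_mem {K : Set E} (hK : Convex ℝ K) {l : List E} (hl : l ≠ [])
    (h : ∀ x ∈ l, x ∈ K) : barycenter l ∈ K := by
  have hpos : 0 < l.length := List.length_pos_iff.2 hl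
  have key : barycenter l = ∑ i : Fin l.length, (l.length : ℝ)⁻¹ • l.get i := by
    rw [barycenter, ← Finset.smul_sum]
    congr 1
    conv_lhs => rw [← List.ofFn_get l, List.sum_ofFn]
  rw [key]
  refine hK.sum_mem (fun _ _ => by positivity) ?_ (fun i _ => h _ (List.get_mem _ _))
  simp [hpos.ne']

lemma dist_barycenter_le {l : List E} {n : ℕ} {d : ℝ} (hl : l.length = n + 1)
    (h : ∀ x ∈ l, ∀ y ∈ l, dist x y ≤ d) {y : E} (hy : y ∈ convexHull ℝ {x | x ∈ l}) :
    dist (barycenter l) y ≤ n / (n + 1) * d := by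
  suffices {x | x ∈ l} ⊆ Metric.closedBall (barycenter l) (n / (n + 1) * d) by
    have := convexHull_min this (convex_closedBall _ _) hy
    rwa [Metric.mem_closedBall, dist_comm] at this
  intro x hx
  obtain ⟨i, rfl⟩ := List.mem_iff_get.1 hx
  rw [Metric.mem_closedBall, dist_comm, dist_eq_norm]
  have hl' : (l.length : ℝ) = n + 1 := by rw [hl]; push_cast; rfl
  have key : barycenter l - l.get i =
      ((n : ℝ) + 1)⁻¹ • ∑ j : Fin l.length, (l.get j - l.get i) := by
    rw [Finset.sum_sub_distrib, smul_sub, barycenter, hl']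
    congr 1
    · congr 1
      conv_lhs => rw [← List.ofFn_get l, List.sum_ofFn]
    · simp only [Finset.sum_const, Finset.card_univ, Fintype.card_fin]
      rw [← Nat.cast_smul_eq_nsmul ℝ, smul_smul, hl',
        inv_mul_cancel₀ (by positivity), one_smul]
  have hbd : ‖∑ j : Fin l.length, (l.get j - l.get i)‖ ≤ n * d := by
    rw [← Finset.add_sum_erase _ _ (Finset.mem_univ i), sub_self, zero_add]
    refine (norm_sum_le_of_le _ (f := fun j => l.get j - l.get i) (n := fun _ => d)
      (fun j _ => ?_)).trans ?_
    · rw [← dist_eq_norm]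
      exact h _ (List.get_mem _ _) _ (List.get_mem _ _)
    · rw [Finset.sum_const, Finset.card_erase_of_mem (Finset.mem_univ _), Finset.card_univ,
        Fintype.card_fin, hl]
      simp
  rw [key, norm_smul, Real.norm_eq_abs, abs_of_pos (by positivity), div_mul_eq_mul_div,
    inv_mul_eq_div]
  gcongr

lemma subdiv_mem_chainsIn {K : Set E} (hK : Convex ℝ K) (n : ℕ) {c : List E →₀ R}
    (hc : c ∈ chainsIn R n K) : subdiv R n c ∈ chainsIn R n K := by
  induction n generalizing c with
  | zero => exact hc
  | succ n ih =>
    refine linearMap_mem_of_supported _ (fun l hl => ?_) hc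
    rw [subdiv_succ_single]
    refine chainCons_mem_chainsIn (barycenter_mem hK ?_ hl.2)
      (ih (chainsIn_mono hl.2 (listBd_mem_chainsIn hl.1)))
    rintro rfl
    simp at hl

lemma subdivHomotopy_mem_chainsIn {K : Set E} (hK : Convex ℝ K) (n : ℕ) {c : List E →₀ R}
    (hc : c ∈ chainsIn R n K) : subdivHomotopy R n c ∈ chainsIn R (n + 1) K := by
  induction n generalizing c with
  | zero => exact Submodule.zero_mem _
  | succ n ih =>
    refine linearMap_mem_of_supported _ (fun l hl => ?_) hc
    rw [subdivHomotopy_succ_single]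
    refine chainCons_mem_chainsIn (barycenter_mem hK ?_ hl.2)
      (Submodule.sub_mem _ (Finsupp.single_mem_supported R _ hl)
        (ih (chainsIn_mono hl.2 (listBd_mem_chainsIn hl.1))))
    rintro rfl
    simp at hl

lemma subdiv_single_mem_smallChains (n : ℕ) {d : ℝ} (hd : 0 ≤ d) {l : List E} (hl : l.length = n)
    (h : ∀ x ∈ l, ∀ y ∈ l, dist x y ≤ d) :
    subdiv R n (Finsupp.single l 1) ∈
      smallChains R n (convexHull ℝ {x | x ∈ l}) ((n - 1) / n * d) := by
  induction n generalizing l with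
  | zero =>
    refine Finsupp.single_mem_supported R _ ⟨hl, ?_, ?_⟩ <;>
    simp [List.length_eq_zero_iff.1 hl]
  | succ n ih =>
    rw [subdiv_succ_single]
    have hsub : ∀ {x}, x ∈ l → x ∈ convexHull ℝ {x | x ∈ l} := fun hx => subset_convexHull ℝ _ hx
    have hb : barycenter l ∈ convexHull ℝ {x | x ∈ l} :=
      barycenter_mem (convex_convexHull ℝ _) (by rintro rfl; simp at hl) fun x hx => hsub hx
    have key : subdiv R n (listBd R l) ∈
        smallChains R n (convexHull ℝ {x | x ∈ l}) (n / (n + 1) * d) := by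
      refine linearMap_mem_of_supported _ (fun l' hl' => ?_) (listBd_mem_chainsIn hl)
      refine smallChains_mono (convexHull_mono hl'.2) ?_
        (ih hl'.1 fun x hx y hy => h x (hl'.2 x hx) y (hl'.2 y hy))
      gcongr ?_ * d
      rcases Nat.eq_zero_or_pos n with rfl | hn
      · simp
      · rw [div_le_div_iff₀ (by positivity) (by positivity)]
        nlinarith
    refine linearMap_mem_of_supported _ (fun m hm => ?_) key
    rw [chainCons_single]
    have e : ((n + 1 : ℕ) - 1 : ℝ) / (n + 1 : ℕ) * d = n / (n + 1) * d := by push_cast; simp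
    refine Finsupp.single_mem_supported R _ ⟨by simp [hm.1], ?_, ?_⟩
    · simpa [hb] using hm.2.1
    · rw [e]
      intro x hx y hy
      rcases List.mem_cons.1 hx with rfl | hx <;> rcases List.mem_cons.1 hy with rfl | hy
      · rw [dist_self]; positivity
      · exact dist_barycenter_le hl h (hm.2.1 y hy)
      · rw [dist_comm]
        exact dist_barycenter_le hl h (hm.2.1 x hx)
      · exact hm.2.2 x hx y hy

lemma subdiv_mem_smallChains {n : ℕ} {K : Set E} (hK : Convex ℝ K) {d : ℝ} (hd : 0 ≤ d)
    {c : List E →₀ R} (hc : c ∈ smallChains R n K d) :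
    subdiv R n c ∈ smallChains R n K ((n - 1) / n * d) :=
  linearMap_mem_of_supported _ (fun _ hl => smallChains_mono (convexHull_min hl.2.1 hK) le_rfl
    (subdiv_single_mem_smallChains n hd hl.1 hl.2.2)) hc

/-- A list of points in a bounded convex set is, up to boundaries and chains depending only on its
own boundary, a combination of arbitrarily small lists. -/
theorem exists_small_subdivision (n : ℕ) {K : Set E} (hK : Convex ℝ K) {d : ℝ}
    {l : List E} (hl : l.length = n + 1) (hlK : ∀ x ∈ l, x ∈ K)
    (hd : ∀ x ∈ l, ∀ y ∈ l, dist x y ≤ d) {ε : ℝ} (hε : 0 < ε) :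
    ∃ s ∈ smallChains R (n + 1) K ε, ∃ T : (List E →₀ R) →ₗ[R] (List E →₀ R),
      ∃ w ∈ chainsIn R (n + 2) K,
        (∀ L : Set E, Convex ℝ L → ∀ c ∈ chainsIn R n L, T c ∈ chainsIn R (n + 1) L) ∧
        Finsupp.single l 1 = s + T (listBd R l) + chainBd R w := by
  obtain ⟨x, hx⟩ := List.exists_mem_of_length_pos (l := l) (by omega)
  have hd0 : 0 ≤ d := dist_nonneg.trans (hd x hx x hx)
  have hρ0 : (0 : ℝ) ≤ n / (n + 1) := by positivity
  have hρ1 : (n / (n + 1) : ℝ) < 1 := by rw [div_lt_one (by positivity)]; linarith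
  have main : ∀ N : ℕ, ∃ s ∈ smallChains R (n + 1) K ((n / (n + 1) : ℝ) ^ N * d),
      ∃ T U : (List E →₀ R) →ₗ[R] (List E →₀ R), ∃ w ∈ chainsIn R (n + 2) K,
        (∀ L : Set E, Convex ℝ L → ∀ c ∈ chainsIn R n L, T c ∈ chainsIn R (n + 1) L) ∧
        (∀ L : Set E, Convex ℝ L → ∀ c ∈ chainsIn R n L, U c ∈ chainsIn R n L) ∧
        chainBd R s = U (listBd R l) ∧
        Finsupp.single l 1 = s + T (listBd R l) + chainBd R w := by
    intro N
    induction N with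
    | zero =>
      refine ⟨Finsupp.single l 1, Finsupp.single_mem_supported R _ ⟨hl, hlK, by simpa using hd⟩,
        0, LinearMap.id, 0, Submodule.zero_mem _, fun _ _ _ _ => Submodule.zero_mem _,
        fun _ _ _ h => h, ?_, ?_⟩ <;> simp
    | succ N ih =>
      obtain ⟨s, hs, T, U, w, hw, hT, hU, hsU, he⟩ := ih
      refine ⟨subdiv R (n + 1) s, ?_, T + subdivHomotopy R n ∘ₗ U, subdiv R n ∘ₗ U,
        w + subdivHomotopy R (n + 1) s, ?_, ?_, ?_, ?_, ?_⟩
      · refine smallChains_mono subset_rfl ?_ (subdiv_mem_smallChains hK (by positivity) hs)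
        push_cast
        rw [pow_succ']
        simp [mul_assoc]
      · exact Submodule.add_mem _ hw
          (subdivHomotopy_mem_chainsIn hK _ (smallChains_le_chainsIn hs))
      · exact fun L hL c hc => Submodule.add_mem _ (hT L hL c hc)
          (subdivHomotopy_mem_chainsIn hL _ (hU L hL c hc))
      · exact fun L hL c hc => subdiv_mem_chainsIn hL _ (hU L hL c hc)
      · rw [chainBd_subdiv, hsU, LinearMap.comp_apply]
      · rw [map_add, chainBd_subdivHomotopy, hsU, he]
        simp only [LinearMap.add_apply, LinearMap.comp_apply]
        abel
  obtain ⟨N, hN⟩ := (((tendsto_pow_atTop_nhds_zero_of_lt_one hρ0 hρ1).mul_const d).eventually_lt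
    tendsto_const_nhds (by simpa using hε)).exists
  obtain ⟨s, hs, T, U, w, hw, hT, -, -, he⟩ := main N
  exact ⟨s, smallChains_mono subset_rfl hN.le hs, T, w, hw, hT, he⟩

end Subdivision

end Chains

section Vandermonde

variable {F : Type*} [Field F]

open Finset Polynomial

lemma sum_prod_inv_sub [DecidableEq F] {s : Finset F} {a : F} (ha : a ∉ s) (hs : s.Nonempty) :
    ∑ x ∈ s, (x - a)⁻¹ * ∏ y ∈ s.erase x, (y - x)⁻¹ = ∏ y ∈ s, (y - a)⁻¹ := by
  have hne : ∀ x ∈ s, x - a ≠ 0 := fun x hx h => ha (by rwa [← sub_eq_zero.1 h])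
  have h1 := congrArg (Polynomial.eval a)
    (Lagrange.sum_basis (s := s) (v := id) (Set.injOn_id _) hs)
  rw [Polynomial.eval_finsetSum, Polynomial.eval_one] at h1
  rw [← mul_one (∏ y ∈ s, (y - a)⁻¹), ← h1, mul_sum]
  refine sum_congr rfl fun x hx => ?_
  rw [← mul_prod_erase s _ hx, mul_assoc, Lagrange.basis, Polynomial.eval_prod, ← prod_mul_distrib]
  congr 1
  refine prod_congr rfl fun y hy => ?_
  have h2 := hne y (mem_of_mem_erase hy)
  have h3 : y - x ≠ 0 := sub_ne_zero.2 (ne_of_mem_erase hy)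
  have h4 : x - y ≠ 0 := sub_ne_zero.2 (ne_of_mem_erase hy).symm
  simp only [Lagrange.basisDivisor, id, eval_mul, eval_C, eval_sub, eval_X]
  field_simp
  ring

open Classical in
/-- The sum over all orderings of a finite set of the inverse products of consecutive differences,
starting from a fixed point. -/
lemma sum_orderings_prod_inv_sub [Fintype F] (m : ℕ) (s : Finset F) (hs : s.card = m) (a : F)
    (ha : a ∉ s) :
    ∑ x : Fin m → F, (if Function.Injective x ∧ ∀ i, x i ∈ s then
      ∏ i : Fin m, (x i - (Fin.cons a x : Fin (m + 1) → F) i.castSucc)⁻¹ else 0) =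
    ∏ y ∈ s, (y - a)⁻¹ := by
  induction m generalizing s a with
  | zero =>
    rw [card_eq_zero] at hs
    subst hs
    simp [Function.injective_of_subsingleton]
  | succ m ih =>
    rw [← (Fin.consEquiv fun _ => F).sum_comp, Fintype.sum_prod_type,
      ← sum_prod_inv_sub ha (card_pos.1 (by omega))]
    rw [← sum_subset (subset_univ s)]
    · refine sum_congr rfl fun b hb => ?_
      rw [← ih (s.erase b) (by rw [card_erase_of_mem hb, hs]; rfl) b (notMem_erase b s), mul_sum]
      refine sum_congr rfl fun x _ => ?_
      have hiff : (Function.Injective (Fin.cons b x : Fin (m + 1) → F) ∧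
          ∀ i, (Fin.cons b x : Fin (m + 1) → F) i ∈ s) ↔
          (Function.Injective x ∧ ∀ i, x i ∈ s.erase b) := by
        rw [Fin.cons_injective_iff, Fin.forall_fin_succ]
        simp only [Fin.cons_zero, Fin.cons_succ, mem_erase, Set.mem_range]
        grind
      simp only [Fin.consEquiv, Equiv.coe_fn_mk, hiff]
      split_ifs
      · rw [Fin.prod_univ_succ]
        simp only [Fin.cons_zero, Fin.cons_succ, Fin.castSucc_zero, ← Fin.succ_castSucc]
      · simp
    · intro b _ hb
      refine sum_eq_zero fun x _ => if_neg fun h => hb ?_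
      simpa using h.2 0

/-- The pairs `i < j` in `Fin n` which are not consecutive. -/
def nonconsecutive (n : ℕ) : Finset (Fin n × Fin n) :=
  {e | (e.1 : ℕ) + 1 < e.2}

/-- The product of the differences of nonconsecutive entries. -/
def nonconsecutiveProd {n : ℕ} (g : Fin n → F) : F :=
  ∏ e ∈ nonconsecutive n, (g e.2 - g e.1)

lemma det_vandermonde_eq_nonconsecutiveProd {n : ℕ} (g : Fin (n + 1) → F) :
    (Matrix.vandermonde g).det =
      nonconsecutiveProd g * ∏ i : Fin n, (g i.succ - g i.castSucc) := by
  have h1 : (Matrix.vandermonde g).det =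
      ∏ e ∈ ({e | e.1 < e.2} : Finset (Fin (n + 1) × Fin (n + 1))), (g e.2 - g e.1) := by
    rw [Matrix.det_vandermonde, prod_filter, Fintype.prod_prod_type]
    refine prod_congr rfl fun i _ => ?_
    rw [← prod_filter]
    refine prod_congr ?_ fun _ _ => rfl
    ext j
    simp
  rw [h1, ← prod_filter_mul_prod_filter_not _ (fun e => (e.1 : ℕ) + 1 < e.2)]
  congr 1
  · refine prod_congr ?_ fun _ _ => rfl
    ext e
    simp only [nonconsecutive, mem_filter, mem_univ, true_and, Fin.lt_def]
    omega
  · symm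
    refine prod_bij' (fun i _ => (i.castSucc, i.succ))
      (fun e _ => if h : (e.1 : ℕ) < n then ⟨e.1, h⟩ else ⟨0, by grind⟩) ?_ ?_ ?_ ?_ ?_
    · simp
    · simp
    · simp
    · rintro ⟨⟨a, ha⟩, ⟨b, hb⟩⟩ h
      simp only [mem_filter, mem_univ, true_and, Fin.lt_def] at h
      have : a < n := by omega
      simp only [this, dif_pos, Fin.castSucc_mk, Fin.succ_mk, Prod.mk.injEq, Fin.mk.injEq, true_and]
      omega
    · simp

lemma sum_nonconsecutiveProd_update [Fintype F] {n : ℕ} (hn : 1 ≤ n)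
    (hF : Fintype.card F = n + 1) (g : Fin (n + 1) → F) (i : Fin (n + 1)) :
    ∑ a : F, nonconsecutiveProd (Function.update g i a) = 0 := by
  classical
  let P : F[X] := ∏ e ∈ nonconsecutive (n + 1),
    (Function.update (fun k => C (g k)) i X e.2 - Function.update (fun k => C (g k)) i X e.1)
  have hev : ∀ a, P.eval a = nonconsecutiveProd (Function.update g i a) := by
    intro a
    have : ∀ k, (Function.update (fun k => C (g k)) i X k).eval a = Function.update g i a k := by
      intro k
      by_cases hk : k = i
      · subst hk; simp
      · simp [hk]
    simp [P, nonconsecutiveProd, Polynomial.eval_prod, this]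
  have hdeg : P.natDegree < n := by
    have hnb : ∃ k : Fin (n + 1), k ≠ i ∧ ((k : ℕ) + 1 = i ∨ (i : ℕ) + 1 = k) := by
      by_cases hi : (i : ℕ) = 0
      · exact ⟨⟨1, by omega⟩, fun h => by have := congrArg Fin.val h; grind,
          Or.inr (by simpa using hi)⟩
      · exact ⟨⟨i - 1, by omega⟩, fun h => by have := congrArg Fin.val h; grind, Or.inl (by grind)⟩
    obtain ⟨k, hki, hk⟩ := hnb
    calc P.natDegree ≤ ∑ e ∈ nonconsecutive (n + 1), if e.1 = i ∨ e.2 = i then 1 else 0 := by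
          refine (natDegree_prod_le _ _).trans (sum_le_sum fun e he => ?_)
          split_ifs with h
          · refine (natDegree_sub_le _ _).trans (max_le ?_ ?_) <;>
            · rw [Function.update_apply]; split_ifs <;> simp
          · rw [not_or] at h
            rw [Function.update_of_ne h.1, Function.update_of_ne h.2, ← C_sub, natDegree_C]
      _ = (({e ∈ nonconsecutive (n + 1) | e.1 = i ∨ e.2 = i} : Finset _)).card := by
          rw [card_filter]
      _ ≤ ((univ.erase i).erase k).card := by
          refine card_le_card_of_injOn (fun e => if e.1 = i then e.2 else e.1) ?_ ?_
          · rintro ⟨a, b⟩ h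
            simp only [nonconsecutive, coe_filter, mem_filter, mem_univ, true_and,
              Set.mem_ofPred_eq] at h
            simp only [coe_erase, Set.mem_sdiff, true_and,
              Set.mem_singleton_iff, coe_univ, Set.mem_univ, Fin.ext_iff] at h hk ⊢
            split_ifs <;> omega
          · rintro ⟨a, b⟩ h ⟨a', b'⟩ h' hh
            simp only [nonconsecutive, coe_filter, mem_filter, mem_univ, true_and,
              Set.mem_ofPred_eq, Fin.ext_iff, Prod.mk.injEq, apply_ite] at h h' hh ⊢
            split_ifs at hh <;> omega
      _ < n := by
          rw [card_erase_of_mem (by simp [hki]), card_erase_of_mem (mem_univ _), card_univ,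
            Fintype.card_fin]
          omega
  simp_rw [← hev, eval_eq_sum_range]
  rw [sum_comm]
  refine sum_eq_zero fun j hj => ?_
  rw [← mul_sum, FiniteField.sum_pow_lt_card_sub_one, mul_zero]
  rw [mem_range] at hj
  omega

lemma sum_filter_eq_zero_comm [Fintype F] [DecidableEq F] {n : ℕ} (f : (Fin n → F) → F)
    (hf : ∀ g a, f (fun k => g k + a) = f g) (i j : Fin n) :
    ∑ g with g i = 0, f g = ∑ g with g j = 0, f g := by
  refine sum_bij' (fun g _ k => g k + -g j) (fun g _ k => g k + -g i) ?_ ?_ ?_ ?_ ?_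
  · simp
  · simp
  · intro g hg
    simp at hg
    ext k; simp [hg]
  · intro g hg
    simp at hg
    ext k; simp [hg]
  · intro g _
    exact (hf g _).symm

lemma nonconsecutiveProd_add {n : ℕ} (g : Fin n → F) (a : F) :
    nonconsecutiveProd (fun k => g k + a) = nonconsecutiveProd g := by
  simp [nonconsecutiveProd]

lemma sum_nonconsecutiveProd_mul_eq_zero [Fintype F] [DecidableEq F] {n : ℕ} (hn : 1 ≤ n)
    (hF : Fintype.card F = n + 1) (c : (Fin (n + 1) → F) → F)
    (hc : ∀ g a, c (fun k => g k + a) = c g) (i : Fin (n + 1))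
    (hi : ∀ g a, c (Function.update g i a) = c g) :
    ∑ g with g 0 = 0, nonconsecutiveProd g * c g = 0 := by
  obtain ⟨j, hj⟩ : ∃ j, j ≠ i := by
    have : Nontrivial (Fin (n + 1)) := Fin.nontrivial_iff_two_le.2 (by omega)
    exact exists_ne i
  rw [sum_filter_eq_zero_comm _ (fun g a => by rw [hc, nonconsecutiveProd_add]) 0 j, sum_filter,
    ← (Fin.insertNthEquiv (fun _ => F) i).sum_comp, Fintype.sum_prod_type, sum_comm]
  refine sum_eq_zero fun g _ => ?_
  obtain ⟨j, rfl⟩ := Fin.exists_succAbove_eq hj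
  have h1 : ∀ a, (Fin.insertNthEquiv (fun _ => F) i) (a, g) =
      Function.update (i.insertNth 0 g : Fin (n + 1) → F) i a := by
    intro a
    rw [Fin.update_insertNth]; rfl
  simp only [h1, hi]
  simp only [Function.update_of_ne hj, Fin.insertNth_apply_succAbove]
  split_ifs
  · rw [← sum_mul, sum_nonconsecutiveProd_update hn hF, zero_mul]
  · simp

lemma sum_nonconsecutiveProd_mul_vandermonde_ne_zero [Fintype F] [DecidableEq F] {n : ℕ}
    (hF : Fintype.card F = n + 1) :
    ∑ g with g 0 = 0,
      nonconsecutiveProd g * (Matrix.vandermonde (g : Fin (n + 1) → F)).det ≠ 0 := by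
  let e : Fin (n + 1) ≃ F := (Fintype.equivFinOfCardEq hF).symm
  set κ := (Matrix.vandermonde e).det ^ 2 with hκ
  have hκ0 : κ ≠ 0 := pow_ne_zero _ (Matrix.det_vandermonde_ne_zero_iff.2 e.injective)
  have hsq : ∀ g : Fin (n + 1) → F, Function.Injective g → (Matrix.vandermonde g).det ^ 2 = κ := by
    intro g hg
    have hb := (Fintype.bijective_iff_injective_and_card g).2 ⟨hg, by simp [hF]⟩
    let τ : Equiv.Perm (Fin (n + 1)) := (Equiv.ofBijective g hb).trans e.symm
    have : Matrix.vandermonde g = (Matrix.vandermonde e).submatrix τ id := by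
      ext a b
      simp [Matrix.vandermonde, τ]
    rw [this, Matrix.det_permute, mul_pow]
    rcases Int.units_eq_one_or (Equiv.Perm.sign τ) with h | h <;> simp [h, hκ]
  have hterm : ∀ g : Fin (n + 1) → F, nonconsecutiveProd g * (Matrix.vandermonde g).det =
      if Function.Injective g then κ * ∏ i : Fin n, (g i.succ - g i.castSucc)⁻¹ else 0 := by
    intro g
    split_ifs with hg
    · have h0 : ∏ i : Fin n, (g i.succ - g i.castSucc) ≠ 0 :=
        prod_ne_zero_iff.2 fun i _ => sub_ne_zero.2 (hg.ne (by simp [Fin.ext_iff]))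
      rw [← hsq g hg, prod_inv_distrib, sq, eq_mul_inv_iff_mul_eq₀ h0, mul_right_comm,
        ← det_vandermonde_eq_nonconsecutiveProd]
    · rw [← Matrix.det_vandermonde_ne_zero_iff, not_not] at hg
      rw [hg, mul_zero]
  have key := sum_orderings_prod_inv_sub n (univ.erase (0 : F))
    (by rw [card_erase_of_mem (mem_univ _), card_univ, hF]; rfl) 0 (notMem_erase _ _)
  have : ∑ g with g 0 = 0, nonconsecutiveProd g * (Matrix.vandermonde (g : Fin (n + 1) → F)).det
      = κ * ∏ y ∈ univ.erase (0 : F), (y - 0)⁻¹ := by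
    rw [← key, sum_filter, ← (Fin.consEquiv fun _ => F).sum_comp, Fintype.sum_prod_type,
      Fintype.sum_eq_single 0, mul_sum]
    · refine sum_congr rfl fun x _ => ?_
      simp only [Fin.consEquiv, Equiv.coe_fn_mk, Fin.cons_zero, if_true, hterm,
        Fin.cons_injective_iff, Fin.cons_succ, mul_ite, mul_zero]
      refine if_congr ?_ rfl rfl
      simp only [Set.mem_range, mem_erase, mem_univ, and_true]
      grind
    · intro b hb
      refine sum_eq_zero fun x _ => if_neg ?_
      simpa [Fin.consEquiv] using hb
  rw [this]
  refine mul_ne_zero hκ0 (prod_ne_zero_iff.2 fun y hy => ?_)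
  simpa using ne_of_mem_erase hy

/-- Over a finite field with `n + 1` elements the Vandermonde determinant in `n + 1` variables is
not a sum of translation invariant functions, the `i`-th one not depending on the `i`-th
variable. -/
theorem exists_vandermonde_ne_sum [Finite F] {n : ℕ} (hn : 1 ≤ n) (hF : Nat.card F = n + 1)
    (c : Fin (n + 1) → (Fin (n + 1) → F) → F) (hc : ∀ i g a, c i (fun k => g k + a) = c i g)
    (hi : ∀ i g a, c i (Function.update g i a) = c i g) :
    ∃ g : Fin (n + 1) → F, (Matrix.vandermonde g).det ≠ ∑ i, c i g := by
  classical
  have := Fintype.ofFinite F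
  rw [Nat.card_eq_fintype_card] at hF
  by_contra! h
  refine sum_nonconsecutiveProd_mul_vandermonde_ne_zero hF ?_
  simp only [h, mul_sum]
  rw [sum_comm]
  exact sum_eq_zero fun i _ => sum_nonconsecutiveProd_mul_eq_zero hn hF (c i) (hc i) i (hi i)

end Vandermonde

section Labels

variable {F : Type*} [Field F]

lemma eraseIdx_ofFn {α : Type*} {n : ℕ} (f : Fin (n + 1) → α) (i : Fin (n + 1)) :
    (List.ofFn f).eraseIdx i = List.ofFn (f ∘ i.succAbove) := by
  apply List.ext_getElem
  · rw [List.length_eraseIdx_of_lt (by rw [List.length_ofFn]; exact i.2), List.length_ofFn,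
      List.length_ofFn, Nat.add_sub_cancel]
  · intro j h1 h2
    rw [List.getElem_eraseIdx]
    simp only [List.length_ofFn] at h2
    split_ifs with h
    · simp only [List.getElem_ofFn, Function.comp]
      congr 1
      rw [Fin.succAbove_of_castSucc_lt _ _ (by simpa [Fin.lt_def] using h)]
      rfl
    · simp only [List.getElem_ofFn, Function.comp]
      congr 1
      rw [Fin.succAbove_of_le_castSucc _ _ (by simpa [Fin.le_def] using h)]
      rfl

/-- The Vandermonde determinant of a list. -/
def listVandermonde : List F → F
  | [] => 1
  | a :: l => (l.map fun x => x - a).prod * listVandermonde l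

lemma listVandermonde_ofFn {n : ℕ} (g : Fin n → F) :
    listVandermonde (List.ofFn g) = (Matrix.vandermonde g).det := by
  induction n with
  | zero => simp [listVandermonde]
  | succ n ih =>
    rw [List.ofFn_succ, listVandermonde, ih, Matrix.det_vandermonde, Matrix.det_vandermonde,
      Fin.prod_univ_succ]
    congr 1
    · rw [List.map_ofFn, List.prod_ofFn, Fin.prod_Ioi_zero]
      rfl
    · exact Finset.prod_congr rfl fun i _ =>
        (Fin.prod_Ioi_succ (fun j => g j - g i.succ) i).symm

lemma listVandermonde_add (l : List F) (a : F) :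
    listVandermonde (l.map (· + a)) = listVandermonde l := by
  induction l with
  | nil => rfl
  | cons b l ih =>
    rw [List.map_cons, listVandermonde, listVandermonde, ih, List.map_map]
    congr 3
    ext x
    simp

lemma nodup_of_listVandermonde_ne_zero {l : List F} (h : listVandermonde l ≠ 0) : l.Nodup := by
  induction l with
  | nil => exact List.nodup_nil
  | cons a l ih =>
    rw [listVandermonde] at h
    refine List.nodup_cons.2 ⟨fun ha => left_ne_zero_of_mul h ?_, ih (right_ne_zero_of_mul h)⟩
    exact List.prod_eq_zero (List.mem_map.2 ⟨a, ha, sub_self a⟩)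

lemma sum_listVandermonde_eraseIdx (l : List F) (hl : 2 ≤ l.length) :
    ∑ i ∈ Finset.range l.length, (-1) ^ i * listVandermonde (l.eraseIdx i) = 0 := by
  obtain ⟨m, g, rfl⟩ : ∃ m, ∃ g : Fin (m + 2) → F, l = List.ofFn g := by
    obtain ⟨m, hm⟩ := Nat.exists_eq_add_of_le' hl
    exact ⟨m, fun i => l.get (i.cast hm.symm), List.ext_getElem (by rw [List.length_ofFn, hm])
      fun i _ _ => by simp only [List.getElem_ofFn]; rfl⟩
  let A : Matrix (Fin (m + 2)) (Fin (m + 2)) F :=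
    Matrix.of fun i => Fin.cons 1 fun j : Fin (m + 1) => g i ^ (j : ℕ)
  have hA : A.det = 0 := Matrix.det_zero_of_column_eq (i := 0) (j := 1) (by simp) fun k => by
    simp only [A, Matrix.of_apply, Fin.cons_zero, ← Fin.succ_zero_eq_one, Fin.cons_succ]
    simp
  rw [← hA, Matrix.det_succ_column_zero, List.length_ofFn, Finset.sum_range]
  refine Finset.sum_congr rfl fun i _ => ?_
  rw [eraseIdx_ofFn, listVandermonde_ofFn]
  simp only [A, Matrix.of_apply, Fin.cons_zero, mul_one]
  congr 1

section Cochain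

variable {E : Type*}

/-- The cochain assigning to a list of points the Vandermonde determinant of its labels. -/
noncomputable def labelCochain (f : E → F) : (List E →₀ F) →ₗ[F] F :=
  Finsupp.linearCombination F fun l => listVandermonde (l.map f)

@[simp] lemma labelCochain_single (f : E → F) (l : List E) :
    labelCochain f (Finsupp.single l 1) = listVandermonde (l.map f) := by
  simp [labelCochain]

lemma labelCochain_listBd (f : E → F) (l : List E) : labelCochain f (listBd F l) =
    ∑ i ∈ Finset.range l.length, (-1) ^ i * listVandermonde ((l.map f).eraseIdx i) := by
  simp only [listBd_eq_sum, List.eraseIdx_map, map_sum, map_smul, labelCochain_single, smul_eq_mul]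

lemma labelCochain_chainBd (f : E → F) {n : ℕ} {K : Set E} {w : List E →₀ F}
    (hw : w ∈ chainsIn F (n + 2) K) : labelCochain f (chainBd F w) = 0 := by
  refine linearMap_mem_of_supported (N := ⊥) (labelCochain f ∘ₗ chainBd F) (fun l hl => ?_) hw
  rw [Submodule.mem_bot, LinearMap.comp_apply, chainBd_single, labelCochain_listBd,
    ← l.length_map f]
  exact sum_listVandermonde_eraseIdx _ (by rw [List.length_map, hl.1]; omega)

lemma labelCochain_congr {f g : E → F} {n : ℕ} {K : Set E} {c : List E →₀ F}
    (hc : c ∈ chainsIn F n K) (a : F) (h : ∀ x ∈ K, f x = g x + a) :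
    labelCochain f c = labelCochain g c := by
  refine sub_eq_zero.1 (linearMap_mem_of_supported (N := ⊥) (labelCochain f - labelCochain g)
    (fun l hl => ?_) hc)
  rw [Submodule.mem_bot, LinearMap.sub_apply, sub_eq_zero, labelCochain_single,
    labelCochain_single, ← listVandermonde_add (l.map g) a, List.map_map]
  congr 1
  exact List.map_congr_left fun x hx => h x (hl.2 x hx)

end Cochain

/-- A combinatorial covering theorem: consider labels of the points of a simplex, depending
equivariantly on an assignment of elements of a finite field to the vertices, such that the label
of a point only depends on the assignment on its support. Then there are arbitrarily small
lists of points which carry pairwise distinct labels. -/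
theorem exists_small_list_nodup [Finite F] {n : ℕ} (hn : 1 ≤ n) (hF : Nat.card F = n + 1)
    (lab : (Fin (n + 1) → F) → (Fin (n + 1) → ℝ) → F)
    (hadd : ∀ g a, ∀ v ∈ stdSimplex ℝ (Fin (n + 1)), lab (fun k => g k + a) v = lab g v + a)
    (hsupp : ∀ g g', ∀ v ∈ stdSimplex ℝ (Fin (n + 1)), (∀ i, v i ≠ 0 → g i = g' i) →
      lab g v = lab g' v) {ε : ℝ} (hε : 0 < ε) :
    ∃ g, ∃ l : List (Fin (n + 1) → ℝ), l.length = n + 1 ∧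
      (∀ x ∈ l, x ∈ stdSimplex ℝ (Fin (n + 1))) ∧ (∀ x ∈ l, ∀ y ∈ l, dist x y ≤ ε) ∧
      (l.map (lab g)).Nodup := by
  by_contra! hcon
  let Δ := stdSimplex ℝ (Fin (n + 1))
  let vert : Fin (n + 1) → Fin (n + 1) → ℝ := fun t => Pi.single t 1
  have hvert : ∀ t, vert t ∈ Δ := fun t => single_mem_stdSimplex ℝ t
  let a : Fin (n + 1) → F := fun t => lab 0 (vert t)
  let lab' : (Fin (n + 1) → F) → (Fin (n + 1) → ℝ) → F := fun g => lab fun k => g k - a k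
  have hlab'_vert : ∀ g t, lab' g (vert t) = g t := by
    intro g t
    have h1 : lab' g (vert t) = lab (fun k => (0 : Fin (n + 1) → F) k + (g t - a t)) (vert t) := by
      refine hsupp _ _ _ (hvert t) fun i hi => ?_
      obtain rfl : i = t := by
        by_contra h
        exact hi (by simp [vert, h])
      simp
    rw [h1, hadd _ _ _ (hvert t)]
    simp [a]
  have hlab'_add : ∀ g b, ∀ v ∈ Δ, lab' (fun k => g k + b) v = lab' g v + b := by
    intro g b v hv
    rw [← hadd _ _ _ hv]
    simp only [lab', add_sub_right_comm]
  let l : List (Fin (n + 1) → ℝ) := List.ofFn vert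
  have hlΔ : ∀ x ∈ l, x ∈ Δ := by
    intro x hx
    obtain ⟨t, rfl⟩ := (List.mem_ofFn' _ _).1 hx
    exact hvert t
  obtain ⟨d, hd⟩ := Metric.isBounded_iff.1 (bounded_stdSimplex (Fin (n + 1)))
  obtain ⟨s, hs, T, w, hw, hT, he⟩ := exists_small_subdivision (R := F) n
    (convex_stdSimplex ℝ (Fin (n + 1))) (List.length_ofFn) hlΔ
    (fun x hx y hy => hd (hlΔ x hx) (hlΔ y hy)) hε
  have herase : ∀ i : Fin (n + 1),
      T (Finsupp.single (l.eraseIdx i) 1) ∈ chainsIn F (n + 1) {v ∈ Δ | v i = 0} := by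
    intro i
    refine hT _ ?_ _ (Finsupp.single_mem_supported F _ ?_)
    · refine (convex_stdSimplex ℝ (Fin (n + 1))).inter ?_
      intro x (hx : x i = 0) y (hy : y i = 0) b c _ _ _
      show (b • x + c • y) i = 0
      simp [hx, hy]
    · rw [eraseIdx_ofFn]
      refine ⟨List.length_ofFn, fun x hx => ?_⟩
      obtain ⟨t, rfl⟩ := (List.mem_ofFn' _ _).1 hx
      exact ⟨hvert _, by simp [vert, (Fin.succAbove_ne i t).symm]⟩
  obtain ⟨g, hg⟩ := exists_vandermonde_ne_sum hn hF
    (fun i g => (-1) ^ (i : ℕ) * labelCochain (lab' g) (T (Finsupp.single (l.eraseIdx i) 1)))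
    (fun i g b => by
      rw [labelCochain_congr (herase i) b fun v hv => hlab'_add g b v hv.1])
    (fun i g b => by
      rw [labelCochain_congr (herase i) 0 fun v hv => ?_]
      rw [add_zero]
      refine hsupp _ _ _ hv.1 fun k hk => ?_
      rw [Function.update_of_ne (by rintro rfl; exact hk hv.2)])
  refine hg ?_
  have hφs : labelCochain (lab' g) s = 0 := by
    refine linearMap_mem_of_supported (N := ⊥) _ (fun l' hl' => ?_) hs
    rw [Submodule.mem_bot, labelCochain_single]
    by_contra hne
    exact hcon _ l' hl'.1 hl'.2.1 hl'.2.2 (nodup_of_listVandermonde_ne_zero hne)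
  have h1 := congrArg (labelCochain (lab' g)) he
  rw [map_add, map_add, hφs, labelCochain_chainBd _ hw, zero_add, add_zero, labelCochain_single,
    listBd_eq_sum, List.length_ofFn, Finset.sum_range, List.map_ofFn,
    show lab' g ∘ vert = g from funext (hlab'_vert g), listVandermonde_ofFn] at h1
  rw [h1]
  simp only [map_sum, map_smul, smul_eq_mul, l]

end Labels

section Configurations

lemma isCompact_confC3 (r : ℕ) : IsCompact (ConfC3 r) := by
  have hset : ConfC3 r = {M | ∀ b t, 0 ≤ M b t} ∩ ({M | (∑ b, ∑ t, M b t) = 1} ∩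
      {M | ∀ t b b', b ≠ b' → M b t * M b' t = 0}) := by
    ext M
    refine and_congr_right fun _ => and_congr_right fun _ => ?_
    refine forall_congr' fun t => forall_congr' fun b => forall_congr' fun b' => ?_
    rw [mul_eq_zero]
    tauto
  refine isCompact_Icc.of_isClosed_subset (s := Set.Icc (0 : Fin r → Fin r → ℝ) 1) ?_ ?_
  · rw [hset]
    refine IsClosed.inter ?_ (IsClosed.inter ?_ ?_)
    · simp only [Set.ofPred_forall]
      exact isClosed_iInter fun b => isClosed_iInter fun t =>
        isClosed_le continuous_const (by fun_prop)
    · exact isClosed_eq (by fun_prop) continuous_const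
    · simp only [Set.ofPred_forall]
      exact isClosed_iInter fun t => isClosed_iInter fun b => isClosed_iInter fun b' =>
        isClosed_iInter fun _ => isClosed_eq (by fun_prop) continuous_const
  · rintro M ⟨h0, h1, -⟩
    refine ⟨h0, fun b t => ?_⟩
    rw [Pi.one_apply, Pi.one_apply, ← h1]
    exact (Finset.single_le_sum (fun t _ => h0 b t) (Finset.mem_univ t)).trans
      (Finset.single_le_sum (f := fun b => ∑ t, M b t)
        (fun b _ => Finset.sum_nonneg fun t _ => h0 b t) (Finset.mem_univ b))

variable {r : ℕ}

lemma rowPerm_mul {m : ℕ} (σ τ : Equiv.Perm (Fin r)) (M : Fin r → Fin m → ℝ) :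
    rowPerm (σ * τ) M = rowPerm σ (rowPerm τ M) := by
  ext b t
  simp [rowPerm]

lemma rowPerm_one {m : ℕ} (M : Fin r → Fin m → ℝ) : rowPerm 1 M = M := rfl

lemma rowPerm_mem_confC3 (σ : Equiv.Perm (Fin r)) {M : Fin r → Fin r → ℝ} (hM : M ∈ ConfC3 r) :
    rowPerm σ M ∈ ConfC3 r := by
  refine ⟨fun b t => hM.1 _ t, ?_, fun t b b' h h' => σ⁻¹.injective (hM.2.2 t _ _ h h')⟩
  rw [← hM.2.1]
  exact Equiv.sum_comp σ⁻¹ fun b => ∑ t, M b t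

/-- A column with a nonzero entry, chosen independently of the order of the rows. -/
noncomputable def chosenColumn [NeZero r] (M : Fin r → Fin r → ℝ) : Fin r :=
  Classical.epsilon fun t => ∃ b, M b t ≠ 0

/-- The row of the nonzero entry of the chosen column. -/
noncomputable def chosenRow [NeZero r] (M : Fin r → Fin r → ℝ) : Fin r :=
  Classical.epsilon fun b => M b (chosenColumn M) ≠ 0

lemma chosenRow_spec [NeZero r] {M : Fin r → Fin r → ℝ} (hM : M ∈ ConfC3 r) :
    M (chosenRow M) (chosenColumn M) ≠ 0 := by
  have h : ∃ t, ∃ b, M b t ≠ 0 := by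
    by_contra! h
    have := hM.2.1
    simp [h] at this
  exact Classical.epsilon_spec (p := fun b => M b (chosenColumn M) ≠ 0)
    (Classical.epsilon_spec (p := fun t => ∃ b, M b t ≠ 0) h)

lemma chosenColumn_rowPerm [NeZero r] (σ : Equiv.Perm (Fin r)) (M : Fin r → Fin r → ℝ) :
    chosenColumn (rowPerm σ M) = chosenColumn M := by
  unfold chosenColumn
  congr 1
  ext t
  exact σ⁻¹.surjective.exists (p := fun b => M b t ≠ 0) |>.symm

lemma chosenRow_rowPerm [NeZero r] (σ : Equiv.Perm (Fin r)) {M : Fin r → Fin r → ℝ}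
    (hM : M ∈ ConfC3 r) : chosenRow (rowPerm σ M) = σ (chosenRow M) := by
  have h1 := chosenRow_spec (rowPerm_mem_confC3 σ hM)
  have h2 := chosenRow_spec hM
  rw [chosenColumn_rowPerm] at h1
  rw [← hM.2.2 _ _ _ h1 h2]
  simp

/-- The matrix with column sums `v` whose nonzero entries lie in the rows prescribed by `g`. -/
def allocation {F : Type*} [DecidableEq F] (β : Fin r ≃ F) (g : Fin r → F) (v : Fin r → ℝ) :
    Fin r → Fin r → ℝ :=
  fun b t => if β b = g t then v t else 0

lemma allocation_mem_confC3 {F : Type*} [DecidableEq F] (β : Fin r ≃ F) (g : Fin r → F)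
    {v : Fin r → ℝ} (hv : v ∈ stdSimplex ℝ (Fin r)) : allocation β g v ∈ ConfC3 r := by
  refine ⟨fun b t => ?_, ?_, fun t b b' h h' => ?_⟩
  · unfold allocation
    split_ifs
    · exact hv.1 t
    · exact le_rfl
  · rw [Finset.sum_comm, ← hv.2]
    refine Finset.sum_congr rfl fun t _ => ?_
    rw [Fintype.sum_eq_single (β.symm (g t))]
    · simp [allocation]
    · intro b hb
      exact if_neg fun h => hb (by rw [← h, β.symm_apply_apply])
  · simp only [allocation, ne_eq, ite_eq_right_iff, Classical.not_imp] at h h'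
    exact β.injective (h.1.trans h'.1.symm)

lemma dist_allocation_le {F : Type*} [DecidableEq F] (β : Fin r ≃ F) (g : Fin r → F)
    (v w : Fin r → ℝ) :
    dist (allocation β g v) (allocation β g w) ≤ dist v w := by
  refine (dist_pi_le_iff dist_nonneg).2 fun b => (dist_pi_le_iff dist_nonneg).2 fun t => ?_
  unfold allocation
  split_ifs
  · exact dist_le_pi_dist v w t
  · simp

variable {F : Type*} [Field F]

/-- The permutation of the rows given by a translation. -/
def shiftPerm (β : Fin r ≃ F) (a : F) : Equiv.Perm (Fin r) :=
  (β.trans (Equiv.addRight a)).trans β.symm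

lemma apply_shiftPerm (β : Fin r ≃ F) (a : F) (b : Fin r) : β (shiftPerm β a b) = β b + a := by
  simp [shiftPerm]

lemma shiftPerm_mul (β : Fin r ≃ F) (a b : F) :
    shiftPerm β a * shiftPerm β b = shiftPerm β (a + b) := by
  ext i : 1
  apply β.injective
  simp only [Equiv.Perm.mul_apply, apply_shiftPerm]
  ring

lemma shiftPerm_zero (β : Fin r ≃ F) : shiftPerm β 0 = 1 := by
  ext i : 1
  apply β.injective
  simp [apply_shiftPerm]

/-- A labelling subordinate to an equivariant covering can be chosen equivariantly with respect to
translations. -/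
lemma exists_equivariant_label [NeZero r] (β : Fin r ≃ F) (A : Fin r → Set (Fin r → Fin r → ℝ))
    (hcov : ∀ M ∈ ConfC3 r, ∃ i, M ∈ A i)
    (hequi : ∀ (σ : Equiv.Perm (Fin r)) i, ∀ M ∈ ConfC3 r, M ∈ A i → rowPerm σ M ∈ A (σ i)) :
    ∃ lam : (Fin r → Fin r → ℝ) → F, ∀ M ∈ ConfC3 r, M ∈ A (β.symm (lam M)) ∧
      ∀ a, lam (rowPerm (shiftPerm β a) M) = lam M + a := by
  let base : (Fin r → Fin r → ℝ) → (Fin r → Fin r → ℝ) :=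
    fun M => rowPerm (shiftPerm β (-β (chosenRow M))) M
  refine ⟨fun M => β (Classical.epsilon fun i => base M ∈ A i) + β (chosenRow M),
    fun M hM => ⟨?_, fun a => ?_⟩⟩
  · have h1 : base M ∈ ConfC3 r := rowPerm_mem_confC3 _ hM
    have h2 := hequi (shiftPerm β (β (chosenRow M))) _ _ h1 (Classical.epsilon_spec (hcov _ h1))
    rwa [← rowPerm_mul, shiftPerm_mul, add_neg_cancel, shiftPerm_zero, rowPerm_one] at h2
  · have h : base (rowPerm (shiftPerm β a) M) = base M := by
      simp only [base]
      rw [chosenRow_rowPerm _ hM, apply_shiftPerm, ← rowPerm_mul, shiftPerm_mul]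
      congr 2
      ring
    simp only [h, chosenRow_rowPerm _ hM, apply_shiftPerm, add_assoc]

variable [DecidableEq F]

lemma rowPerm_shiftPerm_allocation (β : Fin r ≃ F) (g : Fin r → F) (a : F) (v : Fin r → ℝ) :
    rowPerm (shiftPerm β a) (allocation β g v) = allocation β (fun k => g k + a) v := by
  ext b t
  have h : β b = β ((shiftPerm β a)⁻¹ b) + a := by
    rw [← apply_shiftPerm]
    simp
  simp only [rowPerm, allocation, h, add_left_inj]

/-- A Knaster–Kuratowski–Mazurkiewicz type theorem for equivariant closed coverings of the
configuration space. -/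
theorem exists_mem_forall_of_equivariant_covering [Finite F] {n : ℕ} (hn : 1 ≤ n)
    (β : Fin (n + 1) ≃ F) (A : Fin (n + 1) → Set (Fin (n + 1) → Fin (n + 1) → ℝ))
    (hclosed : ∀ i, IsClosed (A i)) (hcov : ∀ M ∈ ConfC3 (n + 1), ∃ i, M ∈ A i)
    (hequi : ∀ (σ : Equiv.Perm (Fin (n + 1))) i, ∀ M ∈ ConfC3 (n + 1),
      M ∈ A i → rowPerm σ M ∈ A (σ i)) :
    ∃ M ∈ ConfC3 (n + 1), ∀ i, M ∈ A i := by
  by_contra! hcon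
  obtain ⟨lam, hlam⟩ := exists_equivariant_label β A hcov hequi
  obtain ⟨δ, hδ, hball⟩ := lebesgue_number_lemma_of_metric (isCompact_confC3 (n + 1))
    (fun i => (hclosed i).isOpen_compl) fun M hM => Set.mem_iUnion.2 (hcon M hM)
  have hF : Nat.card F = n + 1 := by rw [← Nat.card_congr β, Nat.card_fin]
  obtain ⟨g, l, hl, hlΔ, hd, hnd⟩ := exists_small_list_nodup hn hF
    (fun g v => lam (allocation β g v))
    (fun g a v hv => by
      rw [← rowPerm_shiftPerm_allocation, (hlam _ (allocation_mem_confC3 β g hv)).2])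
    (fun g g' v _ h => by
      congr 1
      ext b t
      by_cases ht : v t = 0
      · simp [allocation, ht]
      · simp [allocation, h t ht]) (half_pos hδ)
  obtain ⟨x, hx⟩ := List.exists_mem_of_length_pos (l := l) (by omega)
  obtain ⟨i, hi⟩ := hball _ (allocation_mem_confC3 β g (hlΔ x hx))
  have hmem : β i ∈ l.map fun v => lam (allocation β g v) := by
    have := Fintype.ofFinite F
    rw [← List.mem_toFinset, Finset.eq_univ_of_card (List.toFinset _) (by
      rw [List.toFinset_card_of_nodup hnd, List.length_map, hl, ← hF, Nat.card_eq_fintype_card])]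
    exact Finset.mem_univ _
  obtain ⟨y, hy, hyi⟩ := List.mem_map.1 hmem
  have h1 := (hlam _ (allocation_mem_confC3 β g (hlΔ y hy))).1
  rw [hyi, β.symm_apply_apply] at h1
  refine hi ?_ h1
  rw [Metric.mem_ball]
  exact ((dist_allocation_le β g y x).trans (hd y hy x hx)).trans_lt (half_lt_self hδ)

end Configurations

section EnvyFree

lemma exists_perm_forall_pos {n : Type*} [Fintype n] [DecidableEq n] {P : Matrix n n ℝ}
    (hP : P ∈ doublyStochastic ℝ n) : ∃ σ : Equiv.Perm n, ∀ j, 0 < P (σ j) j := by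
  obtain ⟨w, hw0, hw1, hwP⟩ := exists_eq_sum_perm_of_mem_doublyStochastic hP
  obtain ⟨σ, -, hσ⟩ : ∃ σ ∈ Finset.univ, 0 < w σ :=
    Finset.exists_lt_of_sum_lt (f := fun _ => (0 : ℝ)) (by simp [hw1])
  refine ⟨σ⁻¹, fun j => ?_⟩
  have hPj : P (σ⁻¹ j) j = ∑ τ, w τ * τ.permMatrix ℝ (σ⁻¹ j) j := by
    rw [← hwP, Matrix.sum_apply]
    rfl
  rw [hPj]
  refine Finset.sum_pos' (fun τ _ => mul_nonneg (hw0 τ) ?_) ⟨σ, Finset.mem_univ σ, ?_⟩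
  · rw [Equiv.Perm.permMatrix, PEquiv.toMatrix_apply]
    split_ifs <;> simp
  · simpa [Equiv.Perm.permMatrix, PEquiv.toMatrix_apply] using hσ

lemma isometry_rowPerm {r m : ℕ} (σ : Equiv.Perm (Fin r)) :
    Isometry (rowPerm σ : (Fin r → Fin m → ℝ) → Fin r → Fin m → ℝ) := by
  have hle : ∀ (τ : Equiv.Perm (Fin r)) (M N : Fin r → Fin m → ℝ),
      dist (rowPerm τ M) (rowPerm τ N) ≤ dist M N := fun τ M N =>
    (dist_pi_le_iff dist_nonneg).2 fun b => dist_le_pi_dist M N (τ⁻¹ b)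
  refine Isometry.of_dist_eq fun M N => le_antisymm (hle σ M N) ?_
  simpa [← rowPerm_mul, rowPerm_one] using hle σ⁻¹ (rowPerm σ M) (rowPerm σ N)

/-- A function positive exactly on the open `ε`-neighbourhood of a nonempty set. -/
noncomputable def nearness {X : Type*} [PseudoMetricSpace X] (ε : ℝ) (S : Set X) (x : X) : ℝ :=
  max 0 (ε - Metric.infDist x S)

lemma continuous_nearness {X : Type*} [PseudoMetricSpace X] (ε : ℝ) (S : Set X) :
    Continuous (nearness ε S) :=
  continuous_const.max (continuous_const.sub (Metric.continuous_infDist_pt S))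

variable {r : ℕ} {D : Fin r → Fin r → Set (Fin r → Fin r → ℝ)}

lemma infDist_rowPerm (hsub : ∀ i j, D i j ⊆ ConfC3 r)
    (hequi : ∀ (σ : Equiv.Perm (Fin r)) (i j : Fin r), ∀ M ∈ ConfC3 r,
      (M ∈ D i j ↔ rowPerm σ M ∈ D (σ i) j)) (σ : Equiv.Perm (Fin r)) (i j : Fin r)
    (M : Fin r → Fin r → ℝ) :
    Metric.infDist (rowPerm σ M) (D (σ i) j) = Metric.infDist M (D i j) := by
  have himage : D (σ i) j = rowPerm σ '' D i j := by
    ext N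
    constructor
    · intro hN
      have hinv : rowPerm σ (rowPerm σ⁻¹ N) = N := by
        rw [← rowPerm_mul, mul_inv_cancel, rowPerm_one]
      refine ⟨rowPerm σ⁻¹ N, ?_, hinv⟩
      rwa [hequi σ i j _ (rowPerm_mem_confC3 _ (hsub _ _ hN)), hinv]
    · rintro ⟨M, hM, rfl⟩
      exact (hequi σ i j M (hsub _ _ hM)).1 hM
  rw [himage, Metric.infDist_image (isometry_rowPerm σ)]

lemma nonempty_of_covering_of_equivariant
    (hcov : ∀ j, ∀ M ∈ ConfC3 r, ∃ i, M ∈ D i j)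
    (hequi : ∀ (σ : Equiv.Perm (Fin r)) (i j : Fin r), ∀ M ∈ ConfC3 r,
      (M ∈ D i j ↔ rowPerm σ M ∈ D (σ i) j)) {M : Fin r → Fin r → ℝ} (hM : M ∈ ConfC3 r)
    (i j : Fin r) : (D i j).Nonempty := by
  obtain ⟨k, hk⟩ := hcov j M hM
  have := (hequi (Equiv.swap k i) k j M hM).1 hk
  rw [Equiv.swap_apply_left] at this
  exact ⟨_, this⟩

/-- Approximate envy-free divisions exist. -/
lemma exists_forall_infDist_lt {F : Type*} [Field F] [DecidableEq F] [Finite F] {n : ℕ}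
    (hn : 1 ≤ n) (β : Fin (n + 1) ≃ F)
    {D : Fin (n + 1) → Fin (n + 1) → Set (Fin (n + 1) → Fin (n + 1) → ℝ)}
    (hsub : ∀ i j, D i j ⊆ ConfC3 (n + 1))
    (hcov : ∀ j, ∀ M ∈ ConfC3 (n + 1), ∃ i, M ∈ D i j)
    (hequi : ∀ (σ : Equiv.Perm (Fin (n + 1))) (i j : Fin (n + 1)), ∀ M ∈ ConfC3 (n + 1),
      (M ∈ D i j ↔ rowPerm σ M ∈ D (σ i) j)) {ε : ℝ} (hε : 0 < ε) :
    ∃ M ∈ ConfC3 (n + 1), ∀ j, Metric.infDist M (D j j) < ε := by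
  let total : Fin (n + 1) → (Fin (n + 1) → Fin (n + 1) → ℝ) → ℝ :=
    fun j M => ∑ k, nearness ε (D k j) M
  let P : (Fin (n + 1) → Fin (n + 1) → ℝ) → Fin (n + 1) → Fin (n + 1) → ℝ :=
    fun M i j => nearness ε (D i j) M / total j M
  let W : Fin (n + 1) → (Fin (n + 1) → Fin (n + 1) → ℝ) → ℝ := fun i M => ∑ j, P M i j
  have hnonneg : ∀ i j M, 0 ≤ nearness ε (D i j) M := fun i j M => le_max_left _ _
  have htotal : ∀ j, ∀ M ∈ ConfC3 (n + 1), 0 < total j M := fun j M hM => by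
    obtain ⟨i, hi⟩ := hcov j M hM
    refine Finset.sum_pos' (fun k _ => hnonneg k j M) ⟨i, Finset.mem_univ i, ?_⟩
    rw [nearness, Metric.infDist_zero_of_mem hi, sub_zero]
    exact lt_max_of_lt_right hε
  have hWcont : ∀ i, ContinuousOn (W i) (ConfC3 (n + 1)) := fun i =>
    continuousOn_finsetSum _ fun j _ => (continuous_nearness ε _).continuousOn.div
      (continuous_finsetSum _ fun k _ => continuous_nearness ε _).continuousOn
      fun M hM => (htotal j M hM).ne'
  have hnear : ∀ (σ : Equiv.Perm (Fin (n + 1))) i j M,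
      nearness ε (D (σ i) j) (rowPerm σ M) = nearness ε (D i j) M := fun σ i j M => by
    rw [nearness, infDist_rowPerm hsub hequi, nearness]
  have hWequi : ∀ (σ : Equiv.Perm (Fin (n + 1))) i M, W (σ i) (rowPerm σ M) = W i M := by
    intro σ i M
    refine Finset.sum_congr rfl fun j _ => ?_
    simp only [P, hnear]
    congr 1
    refine (Equiv.sum_comp σ _).symm.trans ?_
    exact Finset.sum_congr rfl fun k _ => hnear σ k j M
  obtain ⟨M, hM, hmax⟩ := exists_mem_forall_of_equivariant_covering hn β
    (fun i => {M | M ∈ ConfC3 (n + 1) ∧ ∀ k, W k M ≤ W i M})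
    (fun i => by
      have : {M | M ∈ ConfC3 (n + 1) ∧ ∀ k, W k M ≤ W i M} =
          ⋂ k, {M | M ∈ ConfC3 (n + 1) ∧ W k M ≤ W i M} := by
        ext M
        simp [forall_and]
      rw [this]
      exact isClosed_iInter fun k =>
        (isCompact_confC3 (n + 1)).isClosed.isClosed_le (hWcont k) (hWcont i))
    (fun M hM => by
      obtain ⟨i, hi⟩ := Finite.exists_max fun k => W k M
      exact ⟨i, hM, hi⟩)
    (fun σ i M hM hi => ⟨rowPerm_mem_confC3 σ hM, fun k => by
      have hk : W k (rowPerm σ M) = W (σ⁻¹ k) M := by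
        rw [← hWequi σ (σ⁻¹ k)]
        simp
      rw [hk, hWequi]
      exact hi.2 _⟩)
  have hcol : ∀ j, ∑ i, P M i j = 1 := fun j => by
    simp only [P, ← Finset.sum_div]
    exact div_self (htotal j M hM).ne'
  have hW : ∀ i, W i M = 1 := by
    have hsum : ∑ i, W i M = n + 1 := by
      simp only [W]
      rw [Finset.sum_comm]
      simp [hcol]
    intro i
    have hconst : ∀ k, W k M = W i M := fun k => le_antisymm ((hmax i).2 k) ((hmax k).2 i)
    simp only [hconst, Finset.sum_const, Finset.card_univ, Fintype.card_fin, nsmul_eq_mul] at hsum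
    push_cast at hsum
    exact mul_left_cancel₀ (by positivity : (n + 1 : ℝ) ≠ 0) (hsum.trans (mul_one _).symm)
  obtain ⟨σ, hσ⟩ := exists_perm_forall_pos (P := Matrix.of (P M)) (mem_doublyStochastic_iff_sum.2
    ⟨fun i j => div_nonneg (hnonneg i j M) (htotal j M hM).le, hW, hcol⟩)
  refine ⟨rowPerm σ⁻¹ M, rowPerm_mem_confC3 _ hM, fun j => ?_⟩
  have h1 : 0 < nearness ε (D (σ j) j) M := by
    by_contra! h
    have := hσ j
    simp [P, le_antisymm h (hnonneg _ _ _)] at this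
  have h2 : Metric.infDist (rowPerm σ⁻¹ M) (D j j) = Metric.infDist M (D (σ j) j) := by
    rw [← infDist_rowPerm hsub hequi σ⁻¹ (σ j) j]
    simp
  rw [h2]
  rw [nearness, lt_max_iff] at h1
  simpa using h1

end EnvyFree

/-- Envy-free division with unrestricted allocations: for `r` a prime power,
closed covering equivariant new-style preferences on `C₃` admit an
envy-free division. -/
theorem envy_free_unrestricted (r : ℕ) (hr : IsPrimePow r)
    (D : Fin r → Fin r → Set (Fin r → Fin r → ℝ))
    (hsub : ∀ i j, D i j ⊆ ConfC3 r)
    (hclosed : ∀ i j, IsClosed {x : ConfC3 r | (x : Fin r → Fin r → ℝ) ∈ D i j})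
    (hcov : ∀ j, ∀ M ∈ ConfC3 r, ∃ i, M ∈ D i j)
    (hequi : ∀ (σ : Equiv.Perm (Fin r)) (i j : Fin r), ∀ M ∈ ConfC3 r,
      (M ∈ D i j ↔ rowPerm σ M ∈ D (σ i) j)) :
    (⋂ i, D i i).Nonempty := by
  obtain ⟨p, k, hp, hk, rfl⟩ := hr
  have : Fact p.Prime := ⟨hp.nat_prime⟩
  have hcard := GaloisField.card p k hk.ne'
  have hlt : 1 < p ^ k := Nat.one_lt_pow hk.ne' hp.nat_prime.one_lt
  generalize p ^ k = r at *
  obtain ⟨n, rfl⟩ : ∃ n, r = n + 1 := ⟨r - 1, by omega⟩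
  classical
  have := Nat.finite_of_card_ne_zero (hcard.trans_ne (Nat.succ_ne_zero n))
  have happrox : ∀ ε : ℝ, 0 < ε →
      ∃ M ∈ ConfC3 (n + 1), ∀ j, Metric.infDist M (D j j) < ε := fun ε hε =>
    exists_forall_infDist_lt (by omega) (Finite.equivFinOfCardEq hcard).symm hsub hcov hequi hε
  obtain ⟨N, hN, -⟩ := happrox 1 one_pos
  have hcompact := isCompact_confC3 (n + 1)
  have hDclosed : ∀ j, IsClosed (D j j) := fun j => by
    have h := (hclosed j j).trans hcompact.isClosed
    convert h using 1
    ext M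
    simpa using @hsub j j M
  obtain ⟨M, hM, hmin⟩ := hcompact.exists_isMinOn ⟨N, hN⟩
    (f := fun M => ∑ j, Metric.infDist M (D j j))
    (continuous_finsetSum _ fun j _ => Metric.continuous_infDist_pt _).continuousOn
  refine ⟨M, Set.mem_iInter.2 fun j => ?_⟩
  rw [(hDclosed j).mem_iff_infDist_zero
    (nonempty_of_covering_of_equivariant hcov hequi hN j j)]
  refine le_antisymm (le_of_forall_pos_le_add fun ε hε => ?_) Metric.infDist_nonneg
  obtain ⟨M', hM', hlt'⟩ := happrox (ε / (n + 1)) (by positivity)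
  calc Metric.infDist M (D j j) ≤ ∑ j, Metric.infDist M (D j j) :=
        Finset.single_le_sum (f := fun j => Metric.infDist M (D j j))
          (fun _ _ => Metric.infDist_nonneg) (Finset.mem_univ j)
    _ ≤ ∑ j, Metric.infDist M' (D j j) := hmin hM'
    _ ≤ ∑ _j : Fin (n + 1), ε / (n + 1) := Finset.sum_le_sum fun j _ => (hlt' j).le
    _ = 0 + ε := by
      rw [Finset.sum_const, Finset.card_univ, Fintype.card_fin, nsmul_eq_mul]
      push_cast
      field_simp
      ring
end
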